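/- arXiv:2301.09481 — 8 statements merged into one kernel-verified Lean document; each statement's English description precedes it below -/
import Mathlib

section
/- Let 1 < p < ∞ and let T ∈ B(ℓ^p) be Hankelian, with matrix entries t_{ij} = c_{i+j}. For every integer n ≥ 1, the finite-rank operator T_n := Σ_{k=0}^{n} (1 − k/n) c_k γ_k satisfies ‖T_n‖_{B(ℓ^p)} ≤ ‖T‖_{B(ℓ^p)}. -/
open scoped ENNReal

lemma fejer_kernel_weights (n : ℕ) (hn : 1 ≤ n) :
    ∃ (N : ℕ) (ω : ℂ) (w : ℕ → ℝ), ‖ω‖ = 1 ∧ (∀ m, 0 ≤ w m) ∧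
      ∀ k, k ≤ 2 * n - 2 → ∑ m ∈ Finset.range N, (w m : ℂ) * (ω ^ m) ^ k =
        if k < n then 1 - (k : ℂ) / n else 0 := by
  have hN : 3 * n ≠ 0 := by omega
  have hprim := Complex.isPrimitiveRoot_exp (3 * n) hN
  set ω := Complex.exp (2 * Real.pi * Complex.I / ((3 * n : ℕ) : ℂ)) with hω
  have hnorm : ‖ω‖ = 1 := hprim.norm'_eq_one hN
  have hω0 : ω ≠ 0 := by
    intro h
    rw [h] at hnorm
    simp at hnorm
  have hn0 : (n : ℂ) ≠ 0 := by exact_mod_cast (by omega : n ≠ 0)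
  have hconj : (starRingEnd ℂ) ω = ω⁻¹ := by
    rw [Complex.inv_def, Complex.normSq_eq_norm_sq, hnorm]; simp
  refine ⟨3 * n, ω, fun m => (1 / (n * (3 * n))) *
    Complex.normSq (∑ a ∈ Finset.range n, (ω ^ m) ^ a), hnorm, ?_, ?_⟩
  · intro m
    exact mul_nonneg (by positivity) (Complex.normSq_nonneg _)
  · intro k hk
    have orth : ∀ a ∈ Finset.range n, ∀ b ∈ Finset.range n,
        ∑ m ∈ Finset.range (3 * n), (ω ^ (a + k) * (ω ^ b)⁻¹) ^ m
          = if a + k = b then (3 * n : ℂ) else 0 := by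
      intro a ha b hb
      rw [Finset.mem_range] at ha hb
      split_ifs with h
      · subst h
        rw [mul_inv_cancel₀ (pow_ne_zero _ hω0)]
        simp
      · have hne : ω ^ (a + k) * (ω ^ b)⁻¹ ≠ 1 := by
          intro h1
          apply h
          apply hprim.pow_inj (by omega) (by omega)
          rwa [mul_inv_eq_one₀ (pow_ne_zero _ hω0)] at h1
        rw [geom_sum_eq hne, mul_pow, inv_pow, ← pow_mul, ← pow_mul, mul_comm (a + k), mul_comm b,
          pow_mul ω (3 * n), pow_mul ω (3 * n), hprim.pow_eq_one]
        simp
    have key : ∀ m, ((1 / (n * (3 * n)) *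
        Complex.normSq (∑ a ∈ Finset.range n, (ω ^ m) ^ a) : ℝ) : ℂ) * (ω ^ m) ^ k
        = (1 / (n * (3 * n))) * ∑ a ∈ Finset.range n, ∑ b ∈ Finset.range n,
          (ω ^ (a + k) * (ω ^ b)⁻¹) ^ m := by
      intro m
      rw [Complex.ofReal_mul, ← Complex.mul_conj, map_sum, Finset.sum_mul_sum, mul_assoc,
        Finset.sum_mul]
      push_cast
      congr 1
      refine Finset.sum_congr rfl fun a _ => ?_
      rw [Finset.sum_mul]
      refine Finset.sum_congr rfl fun b _ => ?_
      rw [map_pow, map_pow, hconj]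
      simp only [mul_pow, inv_pow, ← pow_mul]
      rw [add_mul, pow_add, mul_comm a, mul_comm k, mul_comm b]
      ring
    rw [Finset.sum_congr rfl fun m _ => key m, ← Finset.mul_sum, Finset.sum_comm]
    have h2 : ∑ a ∈ Finset.range n, ∑ m ∈ Finset.range (3 * n), ∑ b ∈ Finset.range n,
          (ω ^ (a + k) * (ω ^ b)⁻¹) ^ m = ((n - k : ℕ) : ℂ) * (3 * n) := by
      have : ∀ a ∈ Finset.range n, ∑ m ∈ Finset.range (3 * n), ∑ b ∈ Finset.range n,
          (ω ^ (a + k) * (ω ^ b)⁻¹) ^ m = if a < n - k then (3 * n : ℂ) else 0 := by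
        intro a ha
        rw [Finset.sum_comm, Finset.sum_congr rfl (orth a ha), Finset.sum_ite_eq]
        have : a + k ∈ Finset.range n ↔ a < n - k := by rw [Finset.mem_range]; omega
        simp only [this]
      rw [Finset.sum_congr rfl this, ← Finset.sum_filter]
      have : (Finset.range n).filter (fun a => a < n - k) = Finset.range (n - k) := by
        ext a; simp only [Finset.mem_filter, Finset.mem_range]; omega
      rw [this]; simp
    rw [h2]
    split_ifs with h
    · rw [Nat.cast_sub h.le]; field_simp
    · rw [Nat.sub_eq_zero_of_le (by omega)]; simp

lemma exists_diag (p : ℝ≥0∞) [Fact (1 ≤ p)] (d : ℕ → ℂ) (hd : ∀ i, ‖d i‖ ≤ 1) :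
    ∃ M : lp (fun _ : ℕ => ℂ) p →L[ℂ] lp (fun _ : ℕ => ℂ) p,
      ‖M‖ ≤ 1 ∧ ∀ x i, (M x : ∀ _ : ℕ, ℂ) i = d i * (x : ∀ _ : ℕ, ℂ) i := by
  have hb : ∀ (x : lp (fun _ : ℕ => ℂ) p) i,
      ‖d i * (x : ∀ _ : ℕ, ℂ) i‖ ≤ ‖(x : ∀ _ : ℕ, ℂ) i‖ := fun x i => by
    rw [norm_mul]; exact mul_le_of_le_one_left (norm_nonneg _) (hd i)
  let L : lp (fun _ : ℕ => ℂ) p →ₗ[ℂ] lp (fun _ : ℕ => ℂ) p :=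
    { toFun := fun x => ⟨fun i => d i * (x : ∀ _ : ℕ, ℂ) i, (lp.memℓp x).mono' (hb x)⟩
      map_add' := fun x y => by
        ext i
        exact mul_add _ _ _
      map_smul' := fun r x => by
        ext i
        exact mul_left_comm _ _ _ }
  have hp0 : p ≠ 0 := (zero_lt_one.trans_le (Fact.out : 1 ≤ p)).ne'
  refine ⟨L.mkContinuous 1 fun x => ?_, L.mkContinuous_norm_le zero_le_one _, fun x i => rfl⟩
  rw [one_mul]
  exact lp.norm_mono hp0 (hb x)

/-- Let `1 < p < ∞` and let `T ∈ B(ℓ^p)` be Hankelian, with matrix entries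
`t_{ij} = c_{i+j}`. For every integer `n ≥ 1`, the finite-rank operator
`T_n := Σ_{k=0}^{n} (1 − k/n) c_k γ_k` satisfies `‖T_n‖ ≤ ‖T‖`.
Here `γ k` is the family of Hankel operators with matrix `1` on the antidiagonal `i+j=k`. -/
theorem fejer_truncation_norm_le (p : ℝ≥0∞) [Fact (1 ≤ p)] (hp : 1 < p) (hp' : p ≠ ∞)
    (γ : ℕ → (lp (fun _ : ℕ => ℂ) p →L[ℂ] lp (fun _ : ℕ => ℂ) p))
    (hγ : ∀ k i j : ℕ, (γ k (lp.single p j 1) : ∀ _ : ℕ, ℂ) i = if i + j = k then 1 else 0)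
    (T : lp (fun _ : ℕ => ℂ) p →L[ℂ] lp (fun _ : ℕ => ℂ) p) (c : ℕ → ℂ)
    (hT : ∀ i j : ℕ, (T (lp.single p j 1) : ∀ _ : ℕ, ℂ) i = c (i + j))
    (n : ℕ) (hn : 1 ≤ n) :
    ‖∑ k ∈ Finset.range (n + 1), ((1 - (k : ℂ) / (n : ℂ)) * c k) • γ k‖ ≤ ‖T‖ := by
  obtain ⟨N, ω, w, hω, hw, hsum⟩ := fejer_kernel_weights n hn
  have hn0 : (n : ℂ) ≠ 0 := by exact_mod_cast (by omega : n ≠ 0)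
  have hD : ∀ m : ℕ, ∃ M : lp (fun _ : ℕ => ℂ) p →L[ℂ] lp (fun _ : ℕ => ℂ) p,
      ‖M‖ ≤ 1 ∧ ∀ x i, (M x : ∀ _ : ℕ, ℂ) i =
        (if i < n then (ω ^ m) ^ i else 0) * (x : ∀ _ : ℕ, ℂ) i := fun m =>
    exists_diag p _ fun i => by
      split_ifs <;> simp [hω]
  choose M hM1 hM using hD
  have hMs : ∀ m j, M m (lp.single p j 1) =
      (if j < n then (ω ^ m) ^ j else 0) • lp.single p j (1 : ℂ) := by
    intro m j
    ext i
    rw [hM, lp.coeFn_smul, Pi.smul_apply, smul_eq_mul]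
    by_cases h : i = j
    · subst h; rfl
    · rw [lp.single_apply_ne p j _ h]; simp
  have hwsum : ∑ m ∈ Finset.range N, w m = 1 := by
    have := hsum 0 (by omega)
    rw [if_pos (by omega)] at this
    simp only [pow_zero, mul_one, Nat.cast_zero, zero_div, sub_zero] at this
    exact_mod_cast this
  have hcoe : ∀ (s : Finset ℕ) (F : ℕ → lp (fun _ : ℕ => ℂ) p) (i : ℕ),
      ((∑ m ∈ s, F m : lp (fun _ : ℕ => ℂ) p) : ∀ _ : ℕ, ℂ) i =
        ∑ m ∈ s, (F m : ∀ _ : ℕ, ℂ) i := by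
    intro s F i
    rw [lp.coeFn_sum, Finset.sum_apply]
  have heq : ∑ k ∈ Finset.range (n + 1), ((1 - (k : ℂ) / (n : ℂ)) * c k) • γ k =
      ∑ m ∈ Finset.range N, (w m : ℂ) • ((M m).comp (T.comp (M m))) := by
    refine lp.ext_continuousLinearMap hp' fun j => ?_
    ext i
    simp only [ContinuousLinearMap.comp_apply, lp.singleContinuousLinearMap_apply,
      ContinuousLinearMap.sum_apply, ContinuousLinearMap.smul_apply, hcoe, lp.coeFn_smul,
      Pi.smul_apply, smul_eq_mul, hMs, map_smul, hM, hγ, hT]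
    rw [show (∑ k ∈ Finset.range (n + 1), (1 - (k : ℂ) / n) * c k * if i + j = k then 1 else 0)
      = (if i + j < n then 1 - ((i + j : ℕ) : ℂ) / n else 0) * c (i + j) by
        simp only [mul_ite, mul_one, mul_zero, Finset.sum_ite_eq, Finset.mem_range]
        rcases lt_trichotomy (i + j) n with h | h | h
        · rw [if_pos (by omega), if_pos h]
        · rw [if_pos (by omega), if_neg (by omega), h, div_self hn0]; simp
        · rw [if_neg (by omega), if_neg (by omega)]; simp]
    by_cases h : i < n ∧ j < n
    · rw [← hsum (i + j) (by omega), Finset.sum_mul]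
      refine Finset.sum_congr rfl fun m _ => ?_
      rw [if_pos h.1, if_pos h.2, pow_add]
      ring
    · rw [if_neg (by omega), zero_mul]
      symm
      refine Finset.sum_eq_zero fun m _ => ?_
      by_cases h1 : i < n
      · rw [if_neg (fun h2 => h ⟨h1, h2⟩)]; simp
      · rw [if_neg h1]; simp
  rw [heq]
  calc _ ≤ ∑ m ∈ Finset.range N, w m * ‖T‖ := by
        refine norm_sum_le_of_le _ fun m _ => ?_
        rw [norm_smul, Complex.norm_real, Real.norm_of_nonneg (hw m)]
        refine mul_le_mul_of_nonneg_left ?_ (hw m)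
        calc _ ≤ ‖M m‖ * (‖T‖ * ‖M m‖) := (ContinuousLinearMap.opNorm_comp_le _ _).trans
                (mul_le_mul_of_nonneg_left (ContinuousLinearMap.opNorm_comp_le _ _)
                  (norm_nonneg _))
          _ ≤ 1 * (‖T‖ * 1) := by gcongr <;> exact hM1 m
          _ = ‖T‖ := by ring
    _ = ‖T‖ := by rw [← Finset.sum_mul, hwsum, one_mul]
end

section
/- Let 1 < p < ∞ with conjugate exponent p'. For every Hankelian operator T ∈ B(ℓ^p) there exists a sequence (T_n)_{n≥1} of finite linear combinations of the operators γ_k (k ≥ 0) such that ‖T_n‖_{B(ℓ^p)} ≤ ‖T‖_{B(ℓ^p)} for all n and ⟨T_n x, y⟩ → ⟨T x, y⟩ as n → ∞ for every x ∈ ℓ^p and y ∈ ℓ^{p'}, where ⟨x,y⟩ = Σ_{i≥0} x_i y_i. -/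
open scoped ENNReal

lemma hk_geom {M : ℕ} {ω : ℂ} (h : IsPrimitiveRoot ω M) {s b : ℕ} (hs : s < M) (hb : b < M) :
    ∑ m ∈ Finset.range M, (ω ^ s * (ω ^ b)⁻¹) ^ m = if s = b then (M : ℂ) else 0 := by
  have hω : ω ≠ 0 := h.ne_zero (by omega)
  split_ifs with hsb
  · subst hsb
    simp [hω]
  · have hz : ω ^ s * (ω ^ b)⁻¹ ≠ 1 := by
      intro hz
      rw [mul_inv_eq_one₀ (pow_ne_zero _ hω)] at hz
      exact hsb (h.pow_inj hs hb hz)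
    rw [geom_sum_eq hz, mul_pow, inv_pow, ← pow_mul, ← pow_mul, mul_comm s, mul_comm b, pow_mul,
      pow_mul, h.pow_eq_one]
    simp

lemma hk_count (N k : ℕ) (C : ℂ) :
    ∑ a ∈ Finset.range N, ∑ b ∈ Finset.range N, (if a + k = b then C else 0) =
      ((N - k : ℕ) : ℂ) * C := by
  have h1 : ∀ a ∈ Finset.range N, ∑ b ∈ Finset.range N, (if a + k = b then C else 0) =
      if a ∈ Finset.range (N - k) then C else 0 := by
    intro a _
    rw [Finset.sum_ite_eq]
    simp only [Finset.mem_range]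
    congr 1
    simp only [eq_iff_iff]
    omega
  rw [Finset.sum_congr rfl h1, Finset.sum_ite_mem,
    Finset.inter_eq_right.mpr (Finset.range_subset_range.mpr (Nat.sub_le _ _))]
  simp

lemma hk_kernel (N : ℕ) (hN : 0 < N) : ∃ (M : ℕ) (ω : ℂ) (w : ℕ → ℝ), ‖ω‖ = 1 ∧ (∀ m, 0 ≤ w m) ∧
    ∀ k, k ≤ 2 * N → ∑ m ∈ Finset.range M, (w m : ℂ) * ω ^ (m * k) = ((N - k : ℕ) : ℂ) / N := by
  have hM : 3 * N ≠ 0 := by omega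
  have hM' : ((3 * N : ℕ) : ℂ) ≠ 0 := by exact_mod_cast hM
  have hN' : (N : ℂ) ≠ 0 := by exact_mod_cast hN.ne'
  obtain ⟨ω, h⟩ : ∃ ω : ℂ, IsPrimitiveRoot ω (3 * N) := ⟨_, Complex.isPrimitiveRoot_exp _ hM⟩
  have hn : ‖ω‖ = 1 := h.norm'_eq_one hM
  refine ⟨3 * N, ω, fun m => ‖∑ a ∈ Finset.range N, ω ^ (m * a)‖ ^ 2 / (((3 * N : ℕ) : ℝ) * N), hn,
    fun m => by positivity, fun k hk => ?_⟩
  have key : ∀ m, ((‖∑ a ∈ Finset.range N, ω ^ (m * a)‖ ^ 2 : ℝ) : ℂ) * ω ^ (m * k) =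
      ∑ a ∈ Finset.range N, ∑ b ∈ Finset.range N, (ω ^ (a + k) * (ω ^ b)⁻¹) ^ m := by
    intro m
    have hc : (starRingEnd ℂ) ω = ω⁻¹ := (Complex.inv_eq_conj hn).symm
    rw [Complex.ofReal_pow, ← Complex.mul_conj', map_sum, Finset.sum_mul_sum, Finset.sum_mul]
    refine Finset.sum_congr rfl fun a _ => ?_
    rw [Finset.sum_mul]
    refine Finset.sum_congr rfl fun b _ => ?_
    rw [map_pow, hc]
    simp only [mul_pow, inv_pow, ← pow_mul, pow_add, add_mul, mul_comm m]
    ring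
  calc _ = (∑ m ∈ Finset.range (3 * N), ((‖∑ a ∈ Finset.range N, ω ^ (m * a)‖ ^ 2 : ℝ) : ℂ)
            * ω ^ (m * k)) / (((3 * N : ℕ) : ℂ) * N) := by
        rw [Finset.sum_div]
        refine Finset.sum_congr rfl fun m _ => ?_
        push_cast
        ring
    _ = _ := by
        simp_rw [key]
        rw [Finset.sum_comm]
        have : ∀ a ∈ Finset.range N, ∑ m ∈ Finset.range (3 * N), ∑ b ∈ Finset.range N,
            (ω ^ (a + k) * (ω ^ b)⁻¹) ^ m =
            ∑ b ∈ Finset.range N, if a + k = b then ((3 * N : ℕ) : ℂ) else 0 := by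
          intro a ha
          rw [Finset.sum_comm]
          refine Finset.sum_congr rfl fun b hb => ?_
          rw [Finset.mem_range] at ha hb
          exact hk_geom h (by omega) (by omega)
        rw [Finset.sum_congr rfl this, hk_count]
        field_simp

lemma hk_diag (p : ℝ≥0∞) [Fact (1 ≤ p)] (d : ℕ → ℂ) (hd : ∀ i, ‖d i‖ ≤ 1) :
    ∃ D : lp (fun _ : ℕ => ℂ) p →L[ℂ] lp (fun _ : ℕ => ℂ) p, ‖D‖ ≤ 1 ∧
      ∀ x i, (D x : ∀ _ : ℕ, ℂ) i = d i * (x : ∀ _ : ℕ, ℂ) i := by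
  have h : ∀ i, ‖(d i • ContinuousLinearMap.id ℂ ℂ)‖ ≤ 1 := by
    intro i
    rw [norm_smul]
    simpa using hd i
  refine ⟨lp.mapCLM p (fun i => d i • ContinuousLinearMap.id ℂ ℂ) zero_le_one h,
    lp.norm_mapCLM_le _ _ _ _, fun x i => ?_⟩
  simp [lp.mapCLM_apply_coe]

lemma hk_ext (p : ℝ≥0∞) [Fact (1 ≤ p)] (hp' : p ≠ ∞)
    (A B : lp (fun _ : ℕ => ℂ) p →L[ℂ] lp (fun _ : ℕ => ℂ) p)
    (h : ∀ i j : ℕ, (A (lp.single p j 1) : ∀ _ : ℕ, ℂ) i = (B (lp.single p j 1) : ∀ _ : ℕ, ℂ) i) :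
    A = B := by
  refine lp.ext_continuousLinearMap hp' fun j => ?_
  refine ContinuousLinearMap.ext_ring ?_
  exact lp.ext (funext fun i => h i j)

lemma hk_approx (p : ℝ≥0∞) [Fact (1 ≤ p)] (hp' : p ≠ ∞)
    (γ : ℕ → (lp (fun _ : ℕ => ℂ) p →L[ℂ] lp (fun _ : ℕ => ℂ) p))
    (hγ : ∀ k i j : ℕ, (γ k (lp.single p j 1) : ∀ _ : ℕ, ℂ) i = if i + j = k then 1 else 0)
    (T : lp (fun _ : ℕ => ℂ) p →L[ℂ] lp (fun _ : ℕ => ℂ) p) (c : ℕ → ℂ)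
    (hT : ∀ i j : ℕ, (T (lp.single p j 1) : ∀ _ : ℕ, ℂ) i = c (i + j)) (N : ℕ) (hN : 0 < N) :
    ∃ S ∈ Submodule.span ℂ (Set.range γ), ‖S‖ ≤ ‖T‖ ∧
      ∀ i j : ℕ, (S (lp.single p j 1) : ∀ _ : ℕ, ℂ) i = ((N - (i + j) : ℕ) : ℂ) / N * c (i + j) := by
  obtain ⟨M, ω, w, hω, hw, hk⟩ := hk_kernel N hN
  have hD : ∀ m : ℕ, ∃ D : lp (fun _ : ℕ => ℂ) p →L[ℂ] lp (fun _ : ℕ => ℂ) p, ‖D‖ ≤ 1 ∧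
      ∀ x i, (D x : ∀ _ : ℕ, ℂ) i = (if i < N then ω ^ (m * i) else 0) * (x : ∀ _ : ℕ, ℂ) i := by
    intro m
    refine hk_diag p _ fun i => ?_
    split_ifs <;> simp [hω]
  choose D hD1 hD2 using hD
  have hDs : ∀ m j, D m (lp.single p j 1) =
      (if j < N then ω ^ (m * j) else 0 : ℂ) • lp.single p j (1 : ℂ) := by
    intro m j
    refine lp.ext (funext fun i => ?_)
    rw [hD2, lp.coeFn_smul, Pi.smul_apply, lp.single_apply, smul_eq_mul]
    by_cases hij : i = j
    · subst hij; rfl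
    · rw [Pi.single_eq_of_ne hij]; simp
  let S : lp (fun _ : ℕ => ℂ) p →L[ℂ] lp (fun _ : ℕ => ℂ) p :=
    ∑ k ∈ Finset.range N, (((N - k : ℕ) : ℂ) / N * c k) • γ k
  have hS : ∀ i j : ℕ, (S (lp.single p j 1) : ∀ _ : ℕ, ℂ) i =
      ((N - (i + j) : ℕ) : ℂ) / N * c (i + j) := by
    intro i j
    simp only [S, ContinuousLinearMap.sum_apply, ContinuousLinearMap.smul_apply, lp.coeFn_sum,
      Finset.sum_apply, lp.coeFn_smul, Pi.smul_apply, hγ, smul_eq_mul, mul_ite, mul_one, mul_zero,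
      Finset.sum_ite_eq, Finset.mem_range]
    split_ifs with h
    · rfl
    · simp [Nat.sub_eq_zero_of_le (not_lt.mp h)]
  have hS' : S = ∑ m ∈ Finset.range M, (w m : ℂ) • ((D m).comp (T.comp (D m))) := by
    refine hk_ext p hp' _ _ fun i j => ?_
    rw [hS]
    simp only [ContinuousLinearMap.sum_apply, ContinuousLinearMap.smul_apply, lp.coeFn_sum,
      Finset.sum_apply, lp.coeFn_smul, Pi.smul_apply, smul_eq_mul, ContinuousLinearMap.comp_apply,
      hDs, map_smul, hD2, hT]
    by_cases h : i < N ∧ j < N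
    · rw [← hk (i + j) (by omega), Finset.sum_mul]
      refine Finset.sum_congr rfl fun m _ => ?_
      rw [if_pos h.1, if_pos h.2]
      ring
    · rw [Nat.sub_eq_zero_of_le (by omega), Finset.sum_eq_zero]
      · simp
      · intro m _
        rcases not_and_or.mp h with h | h <;> simp [h]
  refine ⟨S, ?_, ?_, hS⟩
  · exact Submodule.sum_mem _ fun k _ => Submodule.smul_mem _ _ (Submodule.subset_span ⟨k, rfl⟩)
  · have hw1 : ∑ m ∈ Finset.range M, w m = 1 := by
      have := hk 0 (by omega)
      have hN' : (N : ℂ) ≠ 0 := by exact_mod_cast hN.ne'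
      simp only [mul_zero, pow_zero, mul_one, Nat.sub_zero, div_self hN'] at this
      exact_mod_cast this
    rw [hS']
    calc _ ≤ ∑ m ∈ Finset.range M, w m * ‖T‖ := by
          refine norm_sum_le_of_le _ fun m _ => ?_
          rw [norm_smul, Complex.norm_real, Real.norm_of_nonneg (hw m)]
          refine mul_le_mul_of_nonneg_left ?_ (hw m)
          calc _ ≤ ‖D m‖ * (‖T‖ * ‖D m‖) := (ContinuousLinearMap.opNorm_comp_le _ _).trans
                (mul_le_mul_of_nonneg_left (ContinuousLinearMap.opNorm_comp_le _ _) (norm_nonneg _))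
            _ ≤ 1 * (‖T‖ * 1) := by gcongr <;> exact hD1 m
            _ = ‖T‖ := by ring
      _ = ‖T‖ := by rw [← Finset.sum_mul, hw1, one_mul]

lemma hk_fejer (k : ℕ) : Filter.Tendsto (fun n : ℕ => ((n + 1 - k : ℕ) : ℂ) / ((n + 1 : ℕ) : ℂ))
    Filter.atTop (nhds 1) := by
  have h := (tendsto_const_div_atTop_nhds_zero_nat (k : ℂ)).comp (Filter.tendsto_add_atTop_nat 1)
  have h2 := h.const_sub 1
  rw [sub_zero] at h2
  refine h2.congr' ?_
  filter_upwards [Filter.eventually_ge_atTop k] with n hn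
  have : ((n + 1 : ℕ) : ℂ) ≠ 0 := by exact_mod_cast n.succ_ne_zero
  rw [Nat.cast_sub (by omega), sub_div, div_self this]
  rfl



/-- Let `1 < p < ∞` with conjugate exponent `p'`. For every Hankelian operator
`T ∈ B(ℓ^p)` there exists a sequence `(T_n)` of finite linear combinations of the operators
`γ_k` such that `‖T_n‖ ≤ ‖T‖` for all `n` and `⟨T_n x, y⟩ → ⟨T x, y⟩` for every `x ∈ ℓ^p`,
`y ∈ ℓ^{p'}`, where `⟨x,y⟩ = Σ_i x_i y_i`. -/
theorem hankel_weak_star_approx (p q : ℝ≥0∞) [Fact (1 ≤ p)] [Fact (1 ≤ q)]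
    (hp : 1 < p) (hp' : p ≠ ∞) (hpq : p⁻¹ + q⁻¹ = 1)
    (γ : ℕ → (lp (fun _ : ℕ => ℂ) p →L[ℂ] lp (fun _ : ℕ => ℂ) p))
    (hγ : ∀ k i j : ℕ, (γ k (lp.single p j 1) : ∀ _ : ℕ, ℂ) i = if i + j = k then 1 else 0)
    (T : lp (fun _ : ℕ => ℂ) p →L[ℂ] lp (fun _ : ℕ => ℂ) p) (c : ℕ → ℂ)
    (hT : ∀ i j : ℕ, (T (lp.single p j 1) : ∀ _ : ℕ, ℂ) i = c (i + j)) :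
    ∃ Tn : ℕ → (lp (fun _ : ℕ => ℂ) p →L[ℂ] lp (fun _ : ℕ => ℂ) p),
      (∀ n, Tn n ∈ Submodule.span ℂ (Set.range γ)) ∧
      (∀ n, ‖Tn n‖ ≤ ‖T‖) ∧
      ∀ (x : lp (fun _ : ℕ => ℂ) p) (y : lp (fun _ : ℕ => ℂ) q),
        Filter.Tendsto (fun n => ∑' i : ℕ, (Tn n x : ∀ _ : ℕ, ℂ) i * (y : ∀ _ : ℕ, ℂ) i)
          Filter.atTop (nhds (∑' i : ℕ, (T x : ∀ _ : ℕ, ℂ) i * (y : ∀ _ : ℕ, ℂ) i)) := by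
  choose Tn h1 h2 h3 using fun n : ℕ => hk_approx p hp' γ hγ T c hT (n + 1) n.succ_pos
  refine ⟨Tn, h1, h2, fun x y => ?_⟩
  haveI : p.HolderConjugate q := ENNReal.holderConjugate_iff.mpr hpq
  have hB : ∀ i : ℕ, ‖ContinuousLinearMap.mul ℂ ℂ‖ ≤ ((1 : NNReal) : ℝ) := fun i => by simp
  let φ : lp (fun _ : ℕ => ℂ) p →L[ℂ] ℂ :=
    (lp.dualPairing p q (fun _ : ℕ => ContinuousLinearMap.mul ℂ ℂ) hB).flip y
  have hφ : ∀ z, φ z = ∑' i : ℕ, (z : ∀ _ : ℕ, ℂ) i * (y : ∀ _ : ℕ, ℂ) i := fun z => rfl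
  simp only [← hφ]
  have hsm : ∀ z : lp (fun _ : ℕ => ℂ) p,
      Summable fun i : ℕ => ‖(z : ∀ _ : ℕ, ℂ) i‖ * ‖(y : ∀ _ : ℕ, ℂ) i‖ := by
    intro z
    have := (lp.memℓp z).holder 1 (lp.memℓp y) (fun _ : ℕ => ContinuousLinearMap.mul ℂ ℂ) hB
    have := this.summable (by simp)
    simpa using this
  have hbasis : ∀ j, Filter.Tendsto (fun n => φ (Tn n (lp.single p j 1))) Filter.atTop
      (nhds (φ (T (lp.single p j 1)))) := by
    intro j
    simp only [hφ]
    refine tendsto_tsum_of_dominated_convergence (hsm (T (lp.single p j 1))) ?_ ?_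
    · intro i
      simp only [h3, hT]
      have := ((hk_fejer (i + j)).mul_const (c (i + j))).mul_const ((y : ∀ _ : ℕ, ℂ) i)
      rwa [one_mul] at this
    · refine Filter.Eventually.of_forall fun n i => ?_
      rw [h3, hT, norm_mul, norm_mul]
      gcongr
      refine mul_le_of_le_one_left (norm_nonneg _) ?_
      rw [norm_div, Complex.norm_natCast, Complex.norm_natCast]
      refine div_le_one_of_le₀ ?_ (Nat.cast_nonneg _)
      exact_mod_cast Nat.sub_le _ _
  have hequi : Equicontinuous (fun n (x : lp (fun _ : ℕ => ℂ) p) => φ (Tn n x)) := by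
    refine (LipschitzWith.uniformEquicontinuous _ (‖φ‖₊ * ‖T‖₊) fun n => ?_).equicontinuous
    refine (φ.comp (Tn n)).lipschitz.weaken ?_
    have : ‖φ.comp (Tn n)‖ ≤ ‖φ‖ * ‖T‖ := (φ.opNorm_comp_le _).trans (by gcongr; exact h2 n)
    exact this
  have hcl := hequi.isClosed_setOfPred_tendsto (l := Filter.atTop) (f := fun x => φ (T x))
    (φ.continuous.comp T.continuous)
  refine hcl.mem_of_tendsto (lp.hasSum_single hp' x) (Filter.Eventually.of_forall fun s => ?_)
  simp only [Set.mem_setOf_eq, map_sum]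
  refine tendsto_finsetSum _ fun j _ => ?_
  have hs : lp.single p j ((x : ∀ _ : ℕ, ℂ) j) =
      ((x : ∀ _ : ℕ, ℂ) j) • (lp.single p j 1 : lp (fun _ : ℕ => ℂ) p) := by
    rw [← lp.single_smul, smul_eq_mul, mul_one]
  rw [hs]
  simp only [map_smul]
  exact (hbasis j).const_smul _
end

section
/- Let 1 < p < ∞. If T ∈ B(ℓ^p) is Hankelian, then there exists a bounded operator S ∈ B(ℓ²) whose matrix coincides with that of T (i.e. the i-th coordinate of S e_j equals the i-th coordinate of T e_j for all i,j ≥ 0) and such that ‖S‖_{B(ℓ²)} ≤ ‖T‖_{B(ℓ^p)}; in particular every bounded Hankel operator on ℓ^p is a bounded Hankel operator on ℓ². -/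
open scoped ENNReal

section HankelAux

open scoped Matrix.Norms.L2Operator
open Matrix Filter Topology

/-- A complex symmetric matrix contracting (up to `M`) some `ℓ^r` norm has `ℓ²` norm at most `M`:
`‖A‖² = ρ(A* A)` and any eigenvalue of `A* A = conj(A) A` is bounded by `M²`. -/
lemma symm_l2_norm_le {N : ℕ} (A : Matrix (Fin N) (Fin N) ℂ) (hA : Aᵀ = A) (r M : ℝ)
    (hr : 0 < r) (hM : 0 ≤ M)
    (h : ∀ v : Fin N → ℂ, ∑ i, ‖(A *ᵥ v) i‖ ^ r ≤ M ^ r * ∑ i, ‖v i‖ ^ r) : ‖A‖ ≤ M := by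
  rcases Nat.eq_zero_or_pos N with rfl | hN
  · have : A = 0 := Subsingleton.elim _ _
    simpa [this] using hM
  haveI : NeZero N := ⟨hN.ne'⟩
  haveI : Nontrivial (Matrix (Fin N) (Fin N) ℂ) := inferInstance
  have hsa : IsSelfAdjoint (star A * A) := IsSelfAdjoint.star_mul_self A
  obtain ⟨z, hz, hz'⟩ := spectrum.exists_nnnorm_eq_spectralRadius (star A * A)
  rw [hsa.spectralRadius_eq_nnnorm, ENNReal.coe_inj] at hz'
  have hz2 : ‖z‖ = ‖A‖ * ‖A‖ := by
    rw [← CStarRing.norm_star_mul_self]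
    exact congrArg NNReal.toReal hz'
  rw [← Matrix.spectrum_toLin', ← Module.End.hasEigenvalue_iff_mem_spectrum] at hz
  obtain ⟨v, hv⟩ := hz.exists_hasEigenvector
  have hv1 : (star A * A) *ᵥ v = z • v := by
    have := hv.apply_eq_smul
    simpa [Matrix.toLin'_apply] using this
  have hv0 : v ≠ 0 := hv.2
  have hstar : ∀ w : Fin N → ℂ, star A *ᵥ w = star (A *ᵥ star w) := by
    intro w
    have : star A = A.map star := by
      rw [Matrix.star_eq_conjTranspose, Matrix.conjTranspose, hA]
    rw [this]
    ext i
    simp [Matrix.mulVec, dotProduct]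
  have h1 : ∑ i, ‖z • v i‖ ^ r ≤ M ^ r * (M ^ r * ∑ i, ‖v i‖ ^ r) := by
    calc ∑ i, ‖z • v i‖ ^ r = ∑ i, ‖(A *ᵥ star (A *ᵥ v)) i‖ ^ r := by
          refine Finset.sum_congr rfl fun i _ => ?_
          have := congrFun hv1 i
          rw [← Matrix.mulVec_mulVec, hstar] at this
          rw [Pi.smul_apply] at this
          rw [← this]
          simp
      _ ≤ M ^ r * ∑ i, ‖(star (A *ᵥ v)) i‖ ^ r := h _
      _ = M ^ r * ∑ i, ‖(A *ᵥ v) i‖ ^ r := by simp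
      _ ≤ _ := by
          have := h v
          gcongr
  have hpos : 0 < ∑ i, ‖v i‖ ^ r := by
    obtain ⟨i, hi⟩ := Function.ne_iff.mp hv0
    refine Finset.sum_pos' (fun i _ => by positivity) ⟨i, Finset.mem_univ _, ?_⟩
    have : 0 < ‖v i‖ := norm_pos_iff.mpr hi
    positivity
  have h2 : ∑ i, ‖z • v i‖ ^ r = ‖z‖ ^ r * ∑ i, ‖v i‖ ^ r := by
    rw [Finset.mul_sum]
    refine Finset.sum_congr rfl fun i _ => ?_
    rw [norm_smul, Real.mul_rpow (norm_nonneg _) (norm_nonneg _)]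
  rw [h2, ← mul_assoc, ← Real.mul_rpow hM hM] at h1
  have h3 := le_of_mul_le_mul_right h1 hpos
  rw [Real.rpow_le_rpow_iff (norm_nonneg _) (by positivity) hr, hz2] at h3
  exact le_of_not_gt fun hlt => by nlinarith [norm_nonneg A]

lemma hankel_finite_bound (p : ℝ≥0∞) [Fact (1 ≤ p)] (hp' : p ≠ ∞)
    (T : lp (fun _ : ℕ => ℂ) p →L[ℂ] lp (fun _ : ℕ => ℂ) p) (c : ℕ → ℂ)
    (hT : ∀ i j : ℕ, (T (lp.single p j 1) : ∀ _ : ℕ, ℂ) i = c (i + j)) (N : ℕ) (x : ℕ → ℂ) :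
    ∑ i ∈ Finset.range N, ‖∑ j ∈ Finset.range N, c (i + j) * x j‖ ^ 2
      ≤ ‖T‖ ^ 2 * ∑ j ∈ Finset.range N, ‖x j‖ ^ 2 := by
  have hr : 0 < p.toReal :=
    ENNReal.toReal_pos (zero_lt_one.trans_le Fact.out).ne' hp'
  set A : Matrix (Fin N) (Fin N) ℂ := Matrix.of fun i j => c (i + j) with hAdef
  have hA : ‖A‖ ≤ ‖T‖ := by
    refine symm_l2_norm_le A ?_ p.toReal ‖T‖ hr (norm_nonneg _) ?_
    · ext i j
      simp [hAdef, add_comm]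
    intro v
    set f : ℕ → ℂ := fun j => if h : j < N then v ⟨j, h⟩ else 0 with hf
    have hfv : ∀ j : Fin N, f j = v j := fun j => by simp [hf]
    set X : lp (fun _ : ℕ => ℂ) p := ∑ j ∈ Finset.range N, lp.single p j (f j) with hX
    have hTX : ∀ i : ℕ, (T X : ∀ _ : ℕ, ℂ) i = ∑ j ∈ Finset.range N, c (i + j) * f j := by
      intro i
      have : T X = ∑ j ∈ Finset.range N, f j • T (lp.single p j 1) := by
        rw [hX, map_sum]
        refine Finset.sum_congr rfl fun j _ => ?_
        rw [← map_smul, ← lp.single_smul, smul_eq_mul, mul_one]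
      rw [this, lp.coeFn_sum, Finset.sum_apply]
      refine Finset.sum_congr rfl fun j _ => ?_
      rw [lp.coeFn_smul, Pi.smul_apply, hT, smul_eq_mul, mul_comm]
    have h1 := lp.sum_rpow_le_norm_rpow hr (T X) (Finset.range N)
    have h2 : ‖T X‖ ^ p.toReal ≤ (‖T‖ * ‖X‖) ^ p.toReal :=
      Real.rpow_le_rpow (norm_nonneg _) (T.le_opNorm X) hr.le
    rw [Real.mul_rpow (norm_nonneg _) (norm_nonneg _), hX,
      lp.norm_sum_single hr f (Finset.range N), ← hX] at h2
    have h3 := h1.trans h2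
    simp only [hTX] at h3
    simp only [Finset.sum_range, hfv] at h3
    exact h3
  have h4 := A.l2_opNorm_mulVec (WithLp.toLp 2 fun i : Fin N => x i)
  have h5 := h4.trans (mul_le_mul_of_nonneg_right hA (norm_nonneg _))
  have h6 := pow_le_pow_left₀ (norm_nonneg _) h5 2
  rw [mul_pow, EuclideanSpace.norm_sq_eq, EuclideanSpace.norm_sq_eq] at h6
  simp only [Finset.sum_range]
  exact h6

end HankelAux

open Filter Topology in
/-- Let `1 < p < ∞`. If `T ∈ B(ℓ^p)` is Hankelian, then there exists a bounded
operator `S ∈ B(ℓ²)` whose matrix coincides with that of `T` and such that `‖S‖ ≤ ‖T‖`;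
in particular every bounded Hankel operator on `ℓ^p` is a bounded Hankel operator on `ℓ²`. -/
theorem hankel_lp_subset_hankel_l2 (p : ℝ≥0∞) [Fact (1 ≤ p)] (hp : 1 < p) (hp' : p ≠ ∞)
    (T : lp (fun _ : ℕ => ℂ) p →L[ℂ] lp (fun _ : ℕ => ℂ) p) (c : ℕ → ℂ)
    (hT : ∀ i j : ℕ, (T (lp.single p j 1) : ∀ _ : ℕ, ℂ) i = c (i + j)) :
    ∃ S : lp (fun _ : ℕ => ℂ) 2 →L[ℂ] lp (fun _ : ℕ => ℂ) 2,
      (∀ i j : ℕ, (S (lp.single 2 j 1) : ∀ _ : ℕ, ℂ) i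
          = (T (lp.single p j 1) : ∀ _ : ℕ, ℂ) i) ∧
      ‖S‖ ≤ ‖T‖ := by
  have key := hankel_finite_bound p hp' T c hT
  have h2 : 0 < (2 : ℝ≥0∞).toReal := by norm_num
  -- `c` is square summable
  have hc : Summable fun k => ‖c k‖ ^ 2 := by
    refine summable_of_sum_range_le (c := ‖T‖ ^ 2) (fun _ => by positivity) fun N => ?_
    rcases Nat.eq_zero_or_pos N with rfl | hN
    · simp
    have := key N (Pi.single 0 1)
    have e1 : ∀ i, ∑ j ∈ Finset.range N, c (i + j) * (Pi.single 0 1 : ℕ → ℂ) j = c i := by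
      intro i
      rw [Finset.sum_eq_single 0] <;> simp +contextual [hN.ne']
    have e2 : ∑ j ∈ Finset.range N, ‖(Pi.single 0 1 : ℕ → ℂ) j‖ ^ 2 = 1 := by
      rw [Finset.sum_eq_single 0] <;> simp +contextual [hN.ne']
    simpa [e1, e2] using this
  have hxs : ∀ x : lp (fun _ : ℕ => ℂ) 2, Summable fun j => ‖x j‖ ^ 2 := by
    intro x
    simpa using (lp.memℓp x).summable h2
  have hsum : ∀ (x : lp (fun _ : ℕ => ℂ) 2) (i : ℕ), Summable fun j => c (i + j) * x j := by
    intro x i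
    have hci : Summable fun j => ‖c (i + j)‖ ^ 2 := by
      simpa [add_comm] using (summable_nat_add_iff i).mpr hc
    refine Summable.of_norm_bounded (hci.add (hxs x)) fun j => ?_
    rw [norm_mul]
    nlinarith [sq_nonneg (‖c (i + j)‖ - ‖x j‖), sq_nonneg ‖c (i + j)‖, sq_nonneg ‖x j‖]
  have hbound : ∀ (x : lp (fun _ : ℕ => ℂ) 2) (s : Finset ℕ),
      ∑ i ∈ s, ‖∑' j, c (i + j) * x j‖ ^ (2 : ℝ≥0∞).toReal
        ≤ (‖T‖ * ‖x‖) ^ (2 : ℝ≥0∞).toReal := by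
    intro x s
    have hlim : Tendsto (fun N => ∑ i ∈ s, ‖∑ j ∈ Finset.range N, c (i + j) * x j‖ ^ 2) atTop
        (𝓝 (∑ i ∈ s, ‖∑' j, c (i + j) * x j‖ ^ 2)) :=
      tendsto_finsetSum _ fun i _ => ((hsum x i).hasSum.tendsto_sum_nat.norm).pow 2
    have : ∑ i ∈ s, ‖∑' j, c (i + j) * x j‖ ^ 2 ≤ (‖T‖ * ‖x‖) ^ 2 := by
      refine le_of_tendsto hlim ?_
      obtain ⟨K, hK⟩ := s.exists_nat_subset_range
      filter_upwards [eventually_ge_atTop K] with N hN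
      have hx := lp.sum_rpow_le_norm_rpow h2 x (Finset.range N)
      simp only [ENNReal.toReal_ofNat, Real.rpow_ofNat] at hx
      calc _ ≤ ∑ i ∈ Finset.range N, ‖∑ j ∈ Finset.range N, c (i + j) * x j‖ ^ 2 :=
            Finset.sum_le_sum_of_subset_of_nonneg
              (hK.trans (Finset.range_mono hN)) fun _ _ _ => by positivity
        _ ≤ _ := key N x
        _ ≤ ‖T‖ ^ 2 * ‖x‖ ^ 2 := by gcongr
        _ = _ := by ring
    simpa using this
  let L : lp (fun _ : ℕ => ℂ) 2 →ₗ[ℂ] lp (fun _ : ℕ => ℂ) 2 :=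
    { toFun := fun x => ⟨fun i => ∑' j, c (i + j) * x j, memℓp_gen' (hbound x)⟩
      map_add' := fun x y => by
        ext i
        simp only [lp.coeFn_add, Pi.add_apply, mul_add]
        exact (hsum x i).tsum_add (hsum y i)
      map_smul' := fun a x => by
        ext i
        simp only [lp.coeFn_smul, Pi.smul_apply, smul_eq_mul, RingHom.id_apply]
        rw [← tsum_mul_left]
        exact tsum_congr fun j => by ring }
  have hL : ∀ x, ‖L x‖ ≤ ‖T‖ * ‖x‖ := fun x =>
    lp.norm_le_of_forall_sum_le h2 (by positivity) (hbound x)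
  refine ⟨L.mkContinuous ‖T‖ hL, fun i j => ?_, L.mkContinuous_norm_le (norm_nonneg _) hL⟩
  rw [hT]
  change ∑' k, c (i + k) * (lp.single 2 j (1 : ℂ) : lp (fun _ : ℕ => ℂ) 2) k = _
  rw [tsum_eq_single j]
  · simp
  · intro k hk
    rw [lp.single_apply_ne _ _ _ hk, mul_zero]
end

section
/- Let 1 < p < ∞ with conjugate exponent p' and let T ∈ B(L^p(ℝ₊)). The following are equivalent. (i) T is Hankelian. (ii) For all sequences (f_n)_{n≥1} in L^p(ℝ₊) and (g_n)_{n≥1} in L^{p'}(ℝ₊) with Σ_n ‖f_n‖_p ‖g_n‖_{p'} < ∞ and Σ_n (f_n ∗ g_n)(u) = 0 for every u > 0, one has Σ_n ⟨T f_n, g_n⟩ = 0. -/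
open scoped ENNReal
open MeasureTheory

/-- Lebesgue measure on `ℝ₊ = (0,∞)`. -/
noncomputable def muplus : Measure ℝ := volume.restrict (Set.Ioi 0)

/-- The translate `τ_v f` of a function on `ℝ₊`: `(τ_v f)(t) = f(t−v)` for `t > v`,
`0` for `t ≤ v`. -/
noncomputable def shiftR (v : ℝ) (f : ℝ → ℂ) : ℝ → ℂ := fun t => if v < t then f (t - v) else 0

/-- `T ∈ B(L^p(ℝ₊))` is Hankelian: `⟨T(τ_v f), g⟩ = ⟨T f, τ_v g⟩`. -/
def IsHankelianLp (p q : ℝ≥0∞) [Fact (1 ≤ p)] [Fact (1 ≤ q)]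
    (T : Lp ℂ p muplus →L[ℂ] Lp ℂ p muplus) : Prop :=
  ∀ v : ℝ, 0 < v → ∀ (f fv : Lp ℂ p muplus) (g : Lp ℂ q muplus) (gv : Lp ℂ q muplus),
    (fv : ℝ → ℂ) =ᵐ[muplus] shiftR v (f : ℝ → ℂ) →
    (gv : ℝ → ℂ) =ᵐ[muplus] shiftR v (g : ℝ → ℂ) →
    ∫ t, (T fv : ℝ → ℂ) t * (g : ℝ → ℂ) t ∂muplus
      = ∫ t, (T f : ℝ → ℂ) t * (gv : ℝ → ℂ) t ∂muplus

noncomputable section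

open Filter Topology

namespace HankelAux

/-- extension by zero -/
def ext0 (f : ℝ → ℂ) : ℝ → ℂ := (Set.Ioi (0:ℝ)).indicator f

lemma memLp_ext0 {p : ℝ≥0∞} {f : ℝ → ℂ} (hf : MemLp f p muplus) : MemLp (ext0 f) p volume :=
  (memLp_indicator_iff_restrict measurableSet_Ioi).2 hf

lemma ext0_congr {f g : ℝ → ℂ} (h : f =ᵐ[muplus] g) : ext0 f =ᵐ[volume] ext0 g :=
  (ae_eq_restrict_iff_indicator_ae_eq measurableSet_Ioi).1 h 

/-- extension by zero on `Lp` -/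
def J {p : ℝ≥0∞} (f : Lp ℂ p muplus) : Lp ℂ p (volume : Measure ℝ) :=
  (memLp_ext0 (Lp.memLp f)).toLp _

lemma norm_J {p : ℝ≥0∞} (f : Lp ℂ p muplus) : ‖J f‖ = ‖f‖ := by
  rw [J, Lp.norm_toLp, Lp.norm_def, ext0, eLpNorm_indicator_eq_eLpNorm_restrict measurableSet_Ioi]
  rfl

/-- Restriction to the half line. -/
def Rst (p : ℝ≥0∞) [Fact (1 ≤ p)] : Lp ℂ p (volume : Measure ℝ) →L[ℂ] Lp ℂ p muplus :=
  LpToLpRestrictCLM ℝ ℂ ℂ volume p (Set.Ioi 0)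

lemma Rst_coe {p : ℝ≥0∞} [Fact (1 ≤ p)] (h : Lp ℂ p (volume : Measure ℝ)) :
    (Rst p h : ℝ → ℂ) =ᵐ[muplus] h :=
  LpToLpRestrictCLM_coeFn (μ := volume) ℂ (Set.Ioi (0:ℝ)) h

/-- Translation on `Lp` of the half line. -/
def V {p : ℝ≥0∞} [Fact (1 ≤ p)] (s : ℝ) (f : Lp ℂ p muplus) : Lp ℂ p muplus :=
  Rst p (DomAddAct.mk (-s) +ᵥ J f)

lemma V_coe {p : ℝ≥0∞} [Fact (1 ≤ p)] (s : ℝ) (f : Lp ℂ p muplus) :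
    (V s f : ℝ → ℂ) =ᵐ[muplus] fun t => ext0 f (t - s) := by
  have h1 := Rst_coe (DomAddAct.mk (-s) +ᵥ J f)
  have h2 := DomAddAct.vadd_Lp_ae_eq (DomAddAct.mk (-s)) (J f)
  have h3 : (J f : ℝ → ℂ) =ᵐ[volume] ext0 f := MemLp.coeFn_toLp _
  have h4 := (quasiMeasurePreserving_add_left (volume : Measure ℝ) (-s)).ae_eq h3
  refine h1.trans (ae_restrict_of_ae ?_)
  filter_upwards [h2, h4] with t h2 h4
  rw [h2]
  simp only [Function.comp] at h4
  simp [h4, sub_eq_neg_add]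

lemma norm_V_le {p : ℝ≥0∞} [Fact (1 ≤ p)] (s : ℝ) (f : Lp ℂ p muplus) : ‖V s f‖ ≤ ‖f‖ := by
  rw [← norm_J f, ← DomAddAct.norm_vadd_Lp (DomAddAct.mk (-s)) (J f)]
  rw [V, Lp.norm_def, Lp.norm_def]
  refine ENNReal.toReal_mono (Lp.eLpNorm_ne_top _) ?_
  rw [eLpNorm_congr_ae (Rst_coe (DomAddAct.mk (-s) +ᵥ J f))]
  exact eLpNorm_mono_measure _ Measure.restrict_le_self

lemma continuous_V {p : ℝ≥0∞} [Fact (1 ≤ p)] (hp : p ≠ ∞) (f : Lp ℂ p muplus) :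
    Continuous fun s => V s f := by
  have : Fact (p ≠ ∞) := ⟨hp⟩
  unfold V
  have h1 : Continuous fun s : ℝ => DomAddAct.mk (-s) :=
    (DomAddAct.continuous_mk (M := ℝ)).comp continuous_neg
  have : Continuous fun s : ℝ => (DomAddAct.mk (-s) +ᵥ J f) :=
    h1.vadd (continuous_const (y := J f))
  exact (Rst p).continuous.comp this

lemma V_zero {p : ℝ≥0∞} [Fact (1 ≤ p)] (f : Lp ℂ p muplus) : V 0 f = f := by
  apply Lp.ext
  filter_upwards [V_coe 0 f, (ae_restrict_mem measurableSet_Ioi : ∀ᵐ t ∂muplus, t ∈ Set.Ioi 0)]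
    with t h ht
  rw [h, sub_zero, ext0, Set.indicator_of_mem ht]

lemma shiftR_eq {v : ℝ} (f : ℝ → ℂ) (t : ℝ) : shiftR v f t = ext0 f (t - v) := by
  simp [shiftR, ext0, Set.indicator]

lemma V_coe' {p : ℝ≥0∞} [Fact (1 ≤ p)] (s : ℝ) (f : Lp ℂ p muplus) :
    (V s f : ℝ → ℂ) =ᵐ[muplus] shiftR s f := by
  filter_upwards [V_coe s f] with t h
  rw [h, shiftR_eq]

lemma shiftR_congr {s : ℝ} {f g : ℝ → ℂ} (h : f =ᵐ[muplus] g) :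
    shiftR s f =ᵐ[muplus] shiftR s g := by
  have h4 := ((measurePreserving_sub_right (volume : Measure ℝ) s).quasiMeasurePreserving).ae_eq (ext0_congr h)
  refine ae_restrict_of_ae ?_
  filter_upwards [h4] with t h
  simpa [shiftR_eq] using h

lemma V_add {p : ℝ≥0∞} [Fact (1 ≤ p)] {s t : ℝ} (hs : 0 < s) (ht : 0 < t) (f : Lp ℂ p muplus) :
    (V (s + t) f : ℝ → ℂ) =ᵐ[muplus] shiftR t (V s f) := by
  refine (V_coe' _ _).trans (EventuallyEq.trans ?_ (shiftR_congr (V_coe' s f)).symm)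
  refine Eventually.of_forall fun x => ?_
  simp only [shiftR]
  by_cases h1 : s + t < x
  · rw [if_pos h1, if_pos (by linarith), if_pos (by linarith)]; congr 1; ring
  · rw [if_neg h1]; split_ifs <;> first | rfl | (exfalso; linarith)

/-- The pairing. -/
def pair (p q : ℝ≥0∞) [Fact (1 ≤ p)] [Fact (1 ≤ q)] [ENNReal.HolderConjugate p q] :
    Lp ℂ p muplus →L[ℂ] Lp ℂ q muplus →L[ℂ] ℂ :=
  (ContinuousLinearMap.mul ℂ ℂ).lpPairing muplus p q

lemma pair_eq (p q : ℝ≥0∞) [Fact (1 ≤ p)] [Fact (1 ≤ q)] [ENNReal.HolderConjugate p q]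
    (f : Lp ℂ p muplus) (g : Lp ℂ q muplus) :
    pair p q f g = ∫ t, (f : ℝ → ℂ) t * (g : ℝ → ℂ) t ∂muplus := by
  rw [pair, ContinuousLinearMap.lpPairing_eq_integral]; rfl

/-- Bochner convolution. -/
def bconv {p : ℝ≥0∞} [Fact (1 ≤ p)] (a : ℝ → ℂ) (φ : Lp ℂ p muplus) : Lp ℂ p muplus :=
  ∫ s, a s • V s φ ∂muplus

lemma integrable_bconv {p : ℝ≥0∞} [Fact (1 ≤ p)] (hp : p ≠ ∞) {a : ℝ → ℂ}
    (ha : Integrable a muplus) (φ : Lp ℂ p muplus) :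
    Integrable (fun s => a s • V s φ) muplus := by
  refine Integrable.smul_bdd ha ‖φ‖ (continuous_V hp φ).aestronglyMeasurable
    (Eventually.of_forall fun s => norm_V_le s φ)

lemma ext0_integrable {a : ℝ → ℂ} (ha : Integrable a muplus) : Integrable (ext0 a) volume :=
  (integrable_indicator_iff measurableSet_Ioi).2 ha

lemma integral_ext0 {E : Type*} [NormedAddCommGroup E] [NormedSpace ℝ E] [NormedSpace ℂ E]
    (a : ℝ → ℂ) (h : ℝ → E) :
    ∫ s, ext0 a s • h s = ∫ s, a s • h s ∂muplus := by
  rw [muplus, ← integral_indicator measurableSet_Ioi]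
  refine integral_congr_ae (Eventually.of_forall fun s => ?_)
  by_cases hs : s ∈ Set.Ioi (0:ℝ) <;> simp [ext0, Set.indicator, hs] 

lemma conv_int {a b : ℝ → ℂ} (ha : Integrable a) (hb : Integrable b) :
    Integrable (fun z : ℝ × ℝ => a z.2 * b (z.1 - z.2)) (volume.prod volume) :=
  Integrable.convolution_integrand (ContinuousLinearMap.mul ℝ ℂ) ha hb

lemma conv_integrable {a b : ℝ → ℂ} (ha : Integrable a) (hb : Integrable b) :
    Integrable (fun t => ∫ s, a s * b (t - s)) :=
  (conv_int ha hb).integral_prod_left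

lemma conv_comm (a b : ℝ → ℂ) (t : ℝ) : ∫ s, a s * b (t - s) = ∫ s, b s * a (t - s) := by
  rw [← integral_sub_left_eq_self _ volume t]
  refine integral_congr_ae (Eventually.of_forall fun s => ?_)
  simp [mul_comm]

lemma bconv_pair {p : ℝ≥0∞} [Fact (1 ≤ p)] (hp : p ≠ ∞) {a : ℝ → ℂ}
    (ha : Integrable a muplus) (φ : Lp ℂ p muplus) (L : Lp ℂ p muplus →L[ℂ] ℂ) :
    L (bconv a φ) = ∫ s, a s * L (V s φ) ∂muplus := by
  rw [bconv, ← ContinuousLinearMap.integral_comp_comm L (integrable_bconv hp ha φ)]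
  simp

instance : SigmaFinite muplus := by unfold muplus; infer_instance

lemma bconv_coe (p q : ℝ≥0∞) [Fact (1 ≤ p)] [Fact (1 ≤ q)] [ENNReal.HolderConjugate p q]
    (hp : p ≠ ∞) {a : ℝ → ℂ}
    (ha : Integrable a muplus) (φ : Lp ℂ p muplus) (hφ : Integrable φ muplus) :
    (bconv a φ : ℝ → ℂ) =ᵐ[muplus] fun t => ∫ s, ext0 a s * ext0 φ (t - s) := by
  have hci := conv_integrable (ext0_integrable ha) (ext0_integrable hφ)
  have hci' : Integrable (fun t => ∫ s, ext0 a s * ext0 φ (t - s)) muplus := hci.restrict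
  refine ae_eq_of_forall_setIntegral_eq_of_sigmaFinite ?_ ?_ ?_
  · intro s hs hs'
    have : IsFiniteMeasure (muplus.restrict s) := ⟨by simpa using hs'⟩
    exact MemLp.integrable Fact.out ((Lp.memLp (bconv a φ)).restrict s)
  · intro s _ _
    exact hci'.restrict
  · intro E hE hE'
    have key : ∀ h : Lp ℂ p muplus,
        (pair p q).flip (indicatorConstLp q hE hE'.ne 1) h = ∫ t in E, h t ∂muplus := by
      intro h
      rw [ContinuousLinearMap.flip_apply, pair_eq, ← integral_indicator hE]
      refine integral_congr_ae ?_
      filter_upwards [indicatorConstLp_coeFn (p := q) (hs := hE) (hμs := hE'.ne) (c := (1:ℂ))]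
        with t ht
      rw [ht]
      by_cases h1 : t ∈ E <;> simp [h1]
    rw [← key, bconv_pair hp ha]
    simp only [key]
    have h2 : ∀ s, ∫ t in E, (V s φ) t ∂muplus = ∫ t in E, ext0 φ (t - s) ∂muplus :=
      fun s => integral_congr_ae (ae_restrict_of_ae (V_coe s φ))
    simp only [h2]
    have h3 := integral_ext0 a (fun s => ∫ t in E, ext0 φ (t - s) ∂muplus)
    simp only [smul_eq_mul] at h3
    rw [← h3]
    simp only [← integral_const_mul]
    have hle : muplus.restrict E ≤ volume :=
      Measure.restrict_le_self.trans Measure.restrict_le_self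
    rw [integral_integral_swap]
    have h4 : Integrable (fun z : ℝ × ℝ => ext0 a z.2 * ext0 φ (z.1 - z.2))
        ((muplus.restrict E).prod volume) :=
      (conv_int (ext0_integrable ha) (ext0_integrable hφ)).mono_measure
        (Measure.prod_mono hle le_rfl)
    exact h4.swap

lemma bconv_comm (p q : ℝ≥0∞) [Fact (1 ≤ p)] [Fact (1 ≤ q)] [ENNReal.HolderConjugate p q]
    (hp : p ≠ ∞) (f φ : Lp ℂ p muplus) (hf : Integrable f muplus) (hφ : Integrable φ muplus) :
    bconv f φ = bconv φ f := by
  apply Lp.ext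
  refine (bconv_coe p q hp hf φ hφ).trans (EventuallyEq.trans ?_ (bconv_coe p q hp hφ f hf).symm)
  exact Eventually.of_forall fun t => conv_comm _ _ t

lemma integral_norm_conv_le {a b : ℝ → ℂ} (ha : Integrable a) (hb : Integrable b) :
    ∫ u, ‖∫ s, a s * b (u - s)‖ ≤ (∫ s, ‖a s‖) * ∫ s, ‖b s‖ := by
  have h := integral_convolution (μ := volume) (ν := volume) (ContinuousLinearMap.mul ℝ ℝ) ha.norm hb.norm
  simp only [ContinuousLinearMap.mul_apply'] at h
  rw [← h]
  refine integral_mono (conv_integrable ha hb).norm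
    (ha.norm.integrable_convolution (ContinuousLinearMap.mul ℝ ℝ) hb.norm) fun u => ?_
  refine (norm_integral_le_integral_norm _).trans (le_of_eq ?_)
  simp [convolution_def]

lemma conv_rep {f g k : ℝ → ℂ} (hf : Integrable f muplus) (hg : Integrable g muplus)
    (hk : Continuous k) {C : ℝ} (hC : ∀ u, ‖k u‖ ≤ C) :
    ∫ s, f s * ∫ t, g t * k (s + t) ∂muplus ∂muplus
      = ∫ u, k u * ∫ s, ext0 f s * ext0 g (u - s) := by
  have h0 : ∀ s, ∫ t, g t * k (s + t) ∂muplus = ∫ u, ext0 g (u - s) * k u := by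
    intro s
    have h3 := integral_ext0 g (fun t => k (s + t))
    simp only [smul_eq_mul] at h3
    rw [← h3, ← integral_sub_right_eq_self _ s]
    simp
  simp only [h0]
  have h3 := integral_ext0 f (fun s => ∫ u, ext0 g (u - s) * k u)
  simp only [smul_eq_mul] at h3
  rw [← h3]
  simp only [← integral_const_mul]
  rw [integral_integral_swap]
  · refine integral_congr_ae (Eventually.of_forall fun u => ?_)
    refine integral_congr_ae (Eventually.of_forall fun s => ?_)
    simp only; ring
  · have h4 := conv_int (ext0_integrable hf) (ext0_integrable hg)
    have h5 := (h4.bdd_mul (c := C) (f := fun z : ℝ × ℝ => k z.1)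
      (hk.comp continuous_fst).aestronglyMeasurable (Eventually.of_forall fun z => hC _)).swap
    refine h5.congr (Eventually.of_forall fun z => ?_)
    simp only [Function.comp, Prod.fst_swap, Prod.snd_swap, Function.uncurry]; ring

lemma conv_Ioo (f g : ℝ → ℂ) {u : ℝ} :
    ∫ s, ext0 f s * ext0 g (u - s) = ∫ t in Set.Ioo 0 u, f (u - t) * g t := by
  rw [conv_comm, ← integral_indicator measurableSet_Ioo]
  refine integral_congr_ae (Eventually.of_forall fun t => ?_)
  simp only [ext0, Set.indicator, Set.mem_Ioi, Set.mem_Ioo, sub_pos]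
  by_cases h1 : 0 < t <;> by_cases h2 : t < u <;> simp [h1, h2, mul_comm]

lemma hankel_pair {p q : ℝ≥0∞} [Fact (1 ≤ p)] [Fact (1 ≤ q)] [ENNReal.HolderConjugate p q]
    {T : Lp ℂ p muplus →L[ℂ] Lp ℂ p muplus} (hT : IsHankelianLp p q T) {s t : ℝ}
    (hs : 0 < s) (ht : 0 < t) (φ : Lp ℂ p muplus) (ψ : Lp ℂ q muplus) :
    pair p q (T (V s φ)) (V t ψ) = pair p q (T (V (s + t) φ)) ψ := by
  rw [pair_eq, pair_eq]
  exact (hT t ht (V s φ) (V (s + t) φ) ψ (V t ψ) (V_add hs ht φ) (V_coe' t ψ)).symm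

lemma ae_pos : ∀ᵐ t ∂muplus, 0 < t := ae_restrict_mem measurableSet_Ioi

lemma hankel_rep {p q : ℝ≥0∞} [Fact (1 ≤ p)] [Fact (1 ≤ q)] [ENNReal.HolderConjugate p q]
    (hp : p ≠ ∞) (hq : q ≠ ∞)
    {T : Lp ℂ p muplus →L[ℂ] Lp ℂ p muplus} (hT : IsHankelianLp p q T)
    (φ : Lp ℂ p muplus) (ψ : Lp ℂ q muplus) {f g : ℝ → ℂ}
    (hf : Integrable f muplus) (hg : Integrable g muplus) :
    pair p q (T (bconv f φ)) (bconv g ψ)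
      = ∫ s, f s * ∫ t, g t * pair p q (T (V (s + t) φ)) ψ ∂muplus ∂muplus := by
  have h1 := bconv_pair hp hf φ (((pair p q).flip (bconv g ψ)).comp T)
  simp only [ContinuousLinearMap.comp_apply, ContinuousLinearMap.flip_apply] at h1
  rw [h1]
  refine integral_congr_ae ?_
  filter_upwards [ae_pos] with s hs
  rw [bconv_pair hq hg ψ (pair p q (T (V s φ)))]
  congr 1
  refine integral_congr_ae ?_
  filter_upwards [ae_pos] with t ht
  rw [hankel_pair hT hs ht]

lemma integral_norm_ext0 (f : ℝ → ℂ) : ∫ s, ‖ext0 f s‖ = ∫ s, ‖f s‖ ∂muplus := by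
  rw [muplus, ← integral_indicator measurableSet_Ioi]
  refine integral_congr_ae (Eventually.of_forall fun s => ?_)
  by_cases hs : s ∈ Set.Ioi (0:ℝ) <;> simp [ext0, Set.indicator, hs] 

lemma sum_zero_L1 {p q : ℝ≥0∞} [Fact (1 ≤ p)] [Fact (1 ≤ q)] [ENNReal.HolderConjugate p q]
    (hp : p ≠ ∞) (hq : q ≠ ∞)
    {T : Lp ℂ p muplus →L[ℂ] Lp ℂ p muplus} (hT : IsHankelianLp p q T)
    (φ : Lp ℂ p muplus) (ψ : Lp ℂ q muplus) {f g : ℕ → ℝ → ℂ}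
    (hf : ∀ n, Integrable (f n) muplus) (hg : ∀ n, Integrable (g n) muplus)
    (hs : Summable fun n => (∫ s, ‖f n s‖ ∂muplus) * ∫ s, ‖g n s‖ ∂muplus)
    (h0 : ∀ u : ℝ, 0 < u → (∑' n : ℕ, ∫ t in Set.Ioo 0 u, (f n) (u - t) * (g n) t) = 0) :
    ∑' n, pair p q (T (bconv (f n) φ)) (bconv (g n) ψ) = 0 := by
  set k : ℝ → ℂ := fun u => pair p q (T (V u φ)) ψ with hk
  have hkc : Continuous k :=
    (((pair p q).flip ψ).comp T).continuous.comp (continuous_V hp φ)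
  have hkb : ∀ u, ‖k u‖ ≤ ‖((pair p q).flip ψ).comp T‖ * ‖φ‖ := fun u =>
    ((((pair p q).flip ψ).comp T).le_opNorm (V u φ)).trans
      (mul_le_mul_of_nonneg_left (norm_V_le u φ) (norm_nonneg _))
  set C := ‖((pair p q).flip ψ).comp T‖ * ‖φ‖
  have hi : ∀ n, Integrable fun u => k u * ∫ s, ext0 (f n) s * ext0 (g n) (u - s) := fun n =>
    (conv_integrable (ext0_integrable (hf n)) (ext0_integrable (hg n))).bdd_mul (c := C)
      hkc.aestronglyMeasurable (Eventually.of_forall hkb)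
  have e1 : ∀ n, pair p q (T (bconv (f n) φ)) (bconv (g n) ψ)
      = ∫ u, k u * ∫ s, ext0 (f n) s * ext0 (g n) (u - s) := fun n => by
    rw [hankel_rep hp hq hT φ ψ (hf n) (hg n), ← conv_rep (hf n) (hg n) hkc hkb]
  simp only [e1]
  have hC0 : 0 ≤ C := (norm_nonneg _).trans (hkb 0)
  rw [integral_tsum_of_summable_integral_norm hi]
  · rw [← integral_zero ℝ ℂ]
    refine integral_congr_ae (Eventually.of_forall fun u => ?_)
    simp only [conv_Ioo, tsum_mul_left]
    rcases lt_or_ge 0 u with hu | hu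
    · rw [h0 u hu, mul_zero]
    · simp [Set.Ioo_eq_empty (not_lt.2 hu)]
  · refine Summable.of_nonneg_of_le (fun n => integral_nonneg fun _ => norm_nonneg _) (fun n => ?_)
      (hs.mul_left C)
    rw [← integral_norm_ext0, ← integral_norm_ext0]
    have hcn := (conv_integrable (ext0_integrable (hf n)) (ext0_integrable (hg n))).norm
    refine le_trans ?_ (mul_le_mul_of_nonneg_left (integral_norm_conv_le
      (ext0_integrable (hf n)) (ext0_integrable (hg n))) hC0)
    rw [← integral_const_mul]
    refine integral_mono (hi n).norm (hcn.const_mul C) fun u => ?_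
    simp only [norm_mul]
    exact mul_le_mul_of_nonneg_right (hkb u) (norm_nonneg _)

/-- Averaging kernel. -/
def avg (δ : ℝ) : ℝ → ℂ := (Set.Ioo 0 δ).indicator fun _ => (δ : ℂ)⁻¹

lemma memLp_avg (p : ℝ≥0∞) (δ : ℝ) : MemLp (avg δ) p muplus := by
  refine memLp_indicator_const p measurableSet_Ioo _ (Or.inr ?_)
  refine ((Measure.le_iff'.1 Measure.restrict_le_self _).trans_lt ?_).ne
  simp

lemma bconv_congr {p : ℝ≥0∞} [Fact (1 ≤ p)] {a b : ℝ → ℂ} (h : a =ᵐ[muplus] b)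
    (f : Lp ℂ p muplus) : bconv a f = bconv b f := by
  refine integral_congr_ae ?_
  filter_upwards [h] with t ht
  rw [ht]

lemma bconv_avg {p : ℝ≥0∞} [Fact (1 ≤ p)] {δ : ℝ} (hδ : 0 < δ) (f : Lp ℂ p muplus) :
    bconv (avg δ) f = (δ : ℂ)⁻¹ • ∫ s in (0:ℝ)..δ, V s f := by
  rw [intervalIntegral.integral_of_le hδ.le, ← integral_smul, integral_Ioc_eq_integral_Ioo,
    bconv, ← integral_ext0, ← integral_indicator measurableSet_Ioo]
  refine integral_congr_ae (Eventually.of_forall fun s => ?_)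
  simp only [ext0, avg, Set.indicator, Set.mem_Ioi, Set.mem_Ioo]
  by_cases h1 : 0 < s <;> by_cases h2 : s < δ <;> simp [h1, h2]

lemma norm_bconv_avg_le {p : ℝ≥0∞} [Fact (1 ≤ p)] {δ : ℝ} (hδ : 0 < δ) (f : Lp ℂ p muplus) :
    ‖bconv (avg δ) f‖ ≤ ‖f‖ := by
  rw [bconv_avg hδ, norm_smul]
  have := intervalIntegral.norm_integral_le_of_norm_le_const (a := 0) (b := δ)
    (f := fun s => V s f) (C := ‖f‖) fun s _ => norm_V_le s f
  rw [sub_zero, abs_of_pos hδ] at this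
  calc _ ≤ ‖(δ : ℂ)⁻¹‖ * (‖f‖ * δ) := by gcongr
    _ = ‖f‖ := by
      rw [norm_inv, Complex.norm_real, Real.norm_of_nonneg hδ.le]; field_simp

lemma tendsto_bconv_avg {p : ℝ≥0∞} [Fact (1 ≤ p)] (hp : p ≠ ∞) (f : Lp ℂ p muplus) :
    Tendsto (fun δ => bconv (avg δ) f) (𝓝[>] 0) (𝓝 f) := by
  have hc := continuous_V hp f
  have h := intervalIntegral.integral_hasDerivAt_right (a := 0) (b := 0) (f := fun s => V s f)
    (hc.intervalIntegrable _ _) hc.stronglyMeasurable.stronglyMeasurableAtFilter hc.continuousAt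
  rw [V_zero] at h
  have h2 := h.tendsto_slope_zero_right
  refine h2.congr' ?_
  filter_upwards [self_mem_nhdsWithin] with δ hδ
  rw [bconv_avg hδ]
  simp [← Complex.ofReal_inv]
  rfl

lemma pair_bound {p q : ℝ≥0∞} [Fact (1 ≤ p)] [Fact (1 ≤ q)] [ENNReal.HolderConjugate p q]
    (T : Lp ℂ p muplus →L[ℂ] Lp ℂ p muplus) {f f' : Lp ℂ p muplus} {g g' : Lp ℂ q muplus}
    (hf : ‖f'‖ ≤ ‖f‖) (hg : ‖g'‖ ≤ ‖g‖) :
    ‖pair p q (T f') g'‖ ≤ ‖pair p q‖ * ‖T‖ * (‖f‖ * ‖g‖) := by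
  calc _ ≤ ‖pair p q‖ * ‖T f'‖ * ‖g'‖ := (pair p q).le_opNorm₂ _ _
    _ ≤ ‖pair p q‖ * (‖T‖ * ‖f‖) * ‖g‖ := by
      gcongr
      exact (T.le_opNorm _).trans (by gcongr)
    _ = _ := by ring

lemma pair_tendsto {p q : ℝ≥0∞} [Fact (1 ≤ p)] [Fact (1 ≤ q)] [ENNReal.HolderConjugate p q]
    (T : Lp ℂ p muplus →L[ℂ] Lp ℂ p muplus) {ι : Type*} {l : Filter ι}
    {F : ι → Lp ℂ p muplus} {G : ι → Lp ℂ q muplus} {f : Lp ℂ p muplus} {g : Lp ℂ q muplus}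
    (hF : Tendsto F l (𝓝 f)) (hG : Tendsto G l (𝓝 g)) :
    Tendsto (fun i => pair p q (T (F i)) (G i)) l (𝓝 (pair p q (T f) g)) := by
  have h1 : Tendsto (fun i => pair p q (T (F i))) l (𝓝 (pair p q (T f))) :=
    (((pair p q).comp T).continuous.tendsto f).comp hF
  exact (isBoundedBilinearMap_apply.continuous.tendsto (pair p q (T f), g)).comp (h1.prodMk_nhds hG)

lemma step1 {p q : ℝ≥0∞} [Fact (1 ≤ p)] [Fact (1 ≤ q)] [ENNReal.HolderConjugate p q]
    (hp : p ≠ ∞) (hq : q ≠ ∞)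
    {T : Lp ℂ p muplus →L[ℂ] Lp ℂ p muplus} (hT : IsHankelianLp p q T)
    (f : ℕ → Lp ℂ p muplus) (g : ℕ → Lp ℂ q muplus)
    (hf : ∀ n, Integrable (f n) muplus) (hg : ∀ n, Integrable (g n) muplus)
    (hs : Summable fun n => (∫ s, ‖f n s‖ ∂muplus) * ∫ s, ‖g n s‖ ∂muplus)
    (hs' : Summable fun n => ‖f n‖ * ‖g n‖)
    (h0 : ∀ u : ℝ, 0 < u → (∑' n : ℕ, ∫ t in Set.Ioo 0 u, (f n) (u - t) * (g n) t) = 0) :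
    ∑' n, pair p q (T (f n)) (g n) = 0 := by
  have hqp : ENNReal.HolderConjugate q p := .symm
  have key : ∀ δ : ℝ, 0 < δ →
      ∑' n, pair p q (T (bconv (avg δ) (f n))) (bconv (avg δ) (g n)) = 0 := by
    intro δ hδ
    rw [← sum_zero_L1 hp hq hT ((memLp_avg p δ).toLp _) ((memLp_avg q δ).toLp _) hf hg hs h0]
    refine tsum_congr fun n => ?_
    have hi : Integrable (avg δ) muplus := memLp_one_iff_integrable.1 (memLp_avg 1 δ)
    have c1 : ((memLp_avg p δ).toLp (avg δ) : ℝ → ℂ) =ᵐ[muplus] avg δ := MemLp.coeFn_toLp _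
    have c2 : ((memLp_avg q δ).toLp (avg δ) : ℝ → ℂ) =ᵐ[muplus] avg δ := MemLp.coeFn_toLp _
    rw [bconv_comm p q hp (f n) _ (hf n) (hi.congr c1.symm),
      bconv_comm q p hq (g n) _ (hg n) (hi.congr c2.symm), bconv_congr c1, bconv_congr c2]
  have lim : Tendsto (fun δ : ℝ =>
      ∑' n, pair p q (T (bconv (avg δ) (f n))) (bconv (avg δ) (g n))) (𝓝[>] 0)
      (𝓝 (∑' n, pair p q (T (f n)) (g n))) := by
    refine tendsto_tsum_of_dominated_convergence (hs'.mul_left (‖pair p q‖ * ‖T‖))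
      (fun n => pair_tendsto T (tendsto_bconv_avg hp _) (tendsto_bconv_avg hq _)) ?_
    filter_upwards [self_mem_nhdsWithin] with δ hδ n
    exact pair_bound T (norm_bconv_avg_le hδ _) (norm_bconv_avg_le hδ _)
  refine tendsto_nhds_unique lim (tendsto_const_nhds.congr' ?_)
  filter_upwards [self_mem_nhdsWithin] with δ hδ
  exact (key δ hδ).symm

/-- decaying weight -/
def wt (m : ℕ) (t : ℝ) : ℂ := (Real.exp (-(1 / ((m:ℝ) + 1)) * t) : ℝ)

lemma wt_cont (m : ℕ) : Continuous (wt m) := by unfold wt; fun_prop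

lemma wt_norm (m : ℕ) (t : ℝ) : ‖wt m t‖ = Real.exp (-(1 / ((m:ℝ) + 1)) * t) := by
  rw [wt, Complex.norm_real, Real.norm_of_nonneg (Real.exp_pos _).le]

lemma wt_le (m : ℕ) {t : ℝ} (ht : 0 < t) : ‖wt m t‖ ≤ 1 := by
  rw [wt_norm, Real.exp_le_one_iff]
  have : 0 < 1 / ((m:ℝ) + 1) := by positivity
  nlinarith

lemma wt_memLp (m : ℕ) (q : ℝ≥0∞) [h1 : Fact (1 ≤ q)] (hq : q ≠ ∞) : MemLp (wt m) q muplus := by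
  have hq0 : q ≠ 0 := (lt_of_lt_of_le one_pos h1.out).ne'
  have hqr : 0 < q.toReal := ENNReal.toReal_pos hq0 hq
  refine (integrable_norm_rpow_iff (wt_cont m).aestronglyMeasurable hq0 hq).1 ?_
  have : 0 < 1 / ((m:ℝ) + 1) := by positivity
  have h := exp_neg_integrableOn_Ioi 0 (mul_pos this hqr)
  refine Integrable.congr (μ := muplus) h (Eventually.of_forall fun t => ?_)
  simp only [wt_norm, ← Real.exp_mul]
  congr 1; ring

lemma damp_memLp {p : ℝ≥0∞} (m : ℕ) {f : ℝ → ℂ} (hf : MemLp f p muplus) :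
    MemLp (fun t => wt m t * f t) p muplus := by
  refine hf.of_le ((wt_cont m).aestronglyMeasurable.mul hf.1) ?_
  filter_upwards [ae_pos] with t ht
  rw [norm_mul]
  exact mul_le_of_le_one_left (norm_nonneg _) (wt_le m ht)

/-- damped function -/
def damp {p : ℝ≥0∞} (m : ℕ) (f : Lp ℂ p muplus) : Lp ℂ p muplus :=
  (damp_memLp m (Lp.memLp f)).toLp _

lemma damp_coe {p : ℝ≥0∞} (m : ℕ) (f : Lp ℂ p muplus) :
    (damp m f : ℝ → ℂ) =ᵐ[muplus] fun t => wt m t * f t := MemLp.coeFn_toLp _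

lemma norm_damp_le {p : ℝ≥0∞} (m : ℕ) (f : Lp ℂ p muplus) : ‖damp m f‖ ≤ ‖f‖ := by
  refine Lp.norm_le_norm_of_ae_le ?_
  filter_upwards [damp_coe m f, ae_pos] with t h ht
  rw [h, norm_mul]
  exact mul_le_of_le_one_left (norm_nonneg _) (wt_le m ht)

lemma damp_int {p q : ℝ≥0∞} [Fact (1 ≤ p)] [Fact (1 ≤ q)] [ENNReal.HolderConjugate q p]
    (hq : q ≠ ∞) (m : ℕ) (f : Lp ℂ p muplus) :
    Integrable (damp m f) muplus ∧
      ∫ t, ‖damp m f t‖ ∂muplus ≤ (eLpNorm (wt m) q muplus).toReal * ‖f‖ := by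
  have h1 : MemLp (wt m • (f : ℝ → ℂ)) 1 muplus :=
    MemLp.smul (p := q) (q := p) (r := 1) (Lp.memLp f) (wt_memLp m q hq)
  have h0 : (damp m f : ℝ → ℂ) =ᵐ[muplus] (wt m • (f : ℝ → ℂ)) := by
    filter_upwards [damp_coe m f] with t ht
    rw [ht, Pi.smul_apply', smul_eq_mul]
  have h2 : Integrable (damp m f) muplus :=
    (memLp_one_iff_integrable.1 h1).congr h0.symm
  refine ⟨h2, ?_⟩
  have h3 : eLpNorm (damp m f) 1 muplus ≤ eLpNorm (wt m) q muplus * eLpNorm f p muplus := by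
    rw [eLpNorm_congr_ae h0]
    exact eLpNorm_smul_le_mul_eLpNorm (p := q) (q := p) (r := 1)
      (Lp.memLp f).1 (wt_memLp m q hq).1
  have h4 := ENNReal.toReal_mono
    (ENNReal.mul_ne_top (wt_memLp m q hq).eLpNorm_ne_top (Lp.eLpNorm_ne_top f)) h3
  rw [ENNReal.toReal_mul, ← Lp.norm_def, eLpNorm_one_eq_lintegral_enorm,
    ← integral_norm_eq_lintegral_enorm h2.1] at h4
  exact h4

lemma tendsto_damp {p : ℝ≥0∞} [h1 : Fact (1 ≤ p)] (hp : p ≠ ∞) (f : Lp ℂ p muplus) :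
    Tendsto (fun m => damp m f) atTop (𝓝 f) := by
  have hp0 : p ≠ 0 := (lt_of_lt_of_le one_pos h1.out).ne'
  have hpr : 0 < p.toReal := ENNReal.toReal_pos hp0 hp
  rw [Lp.tendsto_Lp_iff_tendsto_eLpNorm']
  have e : ∀ m, eLpNorm ((damp m f : ℝ → ℂ) - (f : ℝ → ℂ)) p muplus
      = (∫⁻ t, ‖(wt m t - 1) * f t‖ₑ ^ p.toReal ∂muplus) ^ (1 / p.toReal) := by
    intro m
    rw [← eLpNorm_eq_lintegral_rpow_enorm_toReal hp0 hp]
    refine eLpNorm_congr_ae ?_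
    filter_upwards [damp_coe m f] with t h
    simp only [Pi.sub_apply, h]; ring
  simp only [e]
  have hz : (0:ℝ≥0∞) = (∫⁻ t, 0 ∂muplus) ^ (1 / p.toReal) := by
    rw [lintegral_zero, ENNReal.zero_rpow_of_pos (by positivity)]
  rw [hz]
  refine (ENNReal.continuous_rpow_const.tendsto _).comp ?_
  have hfm : AEMeasurable (fun t => (f : ℝ → ℂ) t) muplus := (Lp.memLp f).1.aemeasurable
  refine tendsto_lintegral_of_dominated_convergence' (fun t => ‖f t‖ₑ ^ p.toReal) ?_ ?_ ?_ ?_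
  · intro m
    have := (wt_cont m).measurable
    fun_prop
  · intro m
    filter_upwards [ae_pos] with t ht
    gcongr
    rw [← ofReal_norm, ← ofReal_norm, norm_mul]
    refine ENNReal.ofReal_le_ofReal (mul_le_of_le_one_left (norm_nonneg _) ?_)
    have := wt_le m ht
    rw [wt_norm] at this
    rw [wt, ← Complex.ofReal_one, ← Complex.ofReal_sub, Complex.norm_real, Real.norm_eq_abs, abs_le]
    constructor <;> linarith [Real.exp_pos (-(1 / ((m:ℝ) + 1)) * t)]
  · exact (lintegral_rpow_enorm_lt_top_of_eLpNorm_lt_top hp0 hp (Lp.memLp f).2).ne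
  · refine Eventually.of_forall fun t => ?_
    have hz : (0:ℝ≥0∞) = ‖((((Real.exp (-0 * t) : ℝ)) : ℂ) - 1) * f t‖ₑ ^ p.toReal := by
      simp [hpr]
    rw [hz]
    refine (ENNReal.continuous_rpow_const.tendsto _).comp ?_
    refine (continuous_enorm.tendsto _).comp ?_
    have hlim : Tendsto (fun m : ℕ => 1 / ((m:ℝ) + 1)) atTop (𝓝 0) :=
      tendsto_one_div_add_atTop_nhds_zero_nat
    have hc : Continuous fun x : ℝ => (((Real.exp (-x * t) : ℝ) : ℂ) - 1) * f t := by fun_prop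
    exact (hc.tendsto 0).comp hlim

lemma ae_Ioo {P : ℝ → Prop} (h : ∀ᵐ t ∂muplus, P t) (u : ℝ) :
    ∀ᵐ t ∂(volume.restrict (Set.Ioo 0 u)), P t :=
  ae_mono (Measure.restrict_mono (fun _ h => h.1) le_rfl) h

lemma ae_Ioo_refl {P : ℝ → Prop} (h : ∀ᵐ t ∂muplus, P t) (u : ℝ) :
    ∀ᵐ t ∂(volume.restrict (Set.Ioo 0 u)), P (u - t) := by
  have h1 : ∀ᵐ t ∂(volume : Measure ℝ), t ∈ Set.Ioi (0:ℝ) → P t :=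
    (ae_restrict_iff' measurableSet_Ioi).1 h
  have h2 := (Measure.measurePreserving_sub_left (volume : Measure ℝ) u).quasiMeasurePreserving.ae h1
  rw [ae_restrict_iff' measurableSet_Ioo]
  filter_upwards [h2] with t ht h3
  exact ht (by simpa using h3.2)

lemma step2 {p q : ℝ≥0∞} [Fact (1 ≤ p)] [Fact (1 ≤ q)] [ENNReal.HolderConjugate p q]
    (hp : p ≠ ∞) (hq : q ≠ ∞)
    {T : Lp ℂ p muplus →L[ℂ] Lp ℂ p muplus} (hT : IsHankelianLp p q T)
    (f : ℕ → Lp ℂ p muplus) (g : ℕ → Lp ℂ q muplus)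
    (hs' : Summable fun n => ‖f n‖ * ‖g n‖)
    (h0 : ∀ u : ℝ, 0 < u → (∑' n : ℕ, ∫ t in Set.Ioo 0 u, (f n) (u - t) * (g n) t) = 0) :
    ∑' n, pair p q (T (f n)) (g n) = 0 := by
  have hqp : ENNReal.HolderConjugate q p := .symm
  have key : ∀ m : ℕ, ∑' n, pair p q (T (damp m (f n))) (damp m (g n)) = 0 := by
    intro m
    refine step1 hp hq hT _ _ (fun n => (damp_int hq m (f n)).1) (fun n => (damp_int hp m (g n)).1)
      ?_ ?_ ?_
    · refine Summable.of_nonneg_of_le (fun n => ?_) (fun n => ?_)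
        (hs'.mul_left ((eLpNorm (wt m) q muplus).toReal * (eLpNorm (wt m) p muplus).toReal))
      · exact mul_nonneg (integral_nonneg fun _ => norm_nonneg _)
          (integral_nonneg fun _ => norm_nonneg _)
      · refine (mul_le_mul (damp_int hq m (f n)).2 (damp_int hp m (g n)).2
          (integral_nonneg fun _ => norm_nonneg _) (by positivity)).trans (le_of_eq ?_)
        ring
    · refine Summable.of_nonneg_of_le (fun n => by positivity) (fun n => ?_) hs'
      exact mul_le_mul (norm_damp_le _ _) (norm_damp_le _ _) (norm_nonneg _) (norm_nonneg _)
    · intro u hu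
      rw [← mul_zero (wt m u), ← h0 u hu, ← tsum_mul_left]
      refine tsum_congr fun n => ?_
      rw [← integral_const_mul]
      refine integral_congr_ae ?_
      filter_upwards [ae_Ioo (damp_coe m (g n)) u, ae_Ioo_refl (damp_coe m (f n)) u] with t h1 h2
      rw [h1, h2]
      have : wt m u = wt m (u - t) * wt m t := by
        simp only [wt]
        rw [← Complex.ofReal_mul, ← Real.exp_add]
        congr 2; ring
      rw [this]; ring
  have lim : Tendsto (fun m : ℕ =>
      ∑' n, pair p q (T (damp m (f n))) (damp m (g n))) atTop
      (𝓝 (∑' n, pair p q (T (f n)) (g n))) := by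
    refine tendsto_tsum_of_dominated_convergence (hs'.mul_left (‖pair p q‖ * ‖T‖))
      (fun n => pair_tendsto T (tendsto_damp hp _) (tendsto_damp hq _)) ?_
    exact Eventually.of_forall fun m n => pair_bound T (norm_damp_le _ _) (norm_damp_le _ _)
  simp only [key] at lim
  exact tendsto_nhds_unique lim tendsto_const_nhds

lemma shift_conv (f g : ℝ → ℂ) (u : ℝ) {v : ℝ} (hv : 0 < v) :
    ∫ t in Set.Ioo 0 u, shiftR v f (u - t) * g t
      = ∫ t in Set.Ioo 0 u, f (u - t) * shiftR v g t := by
  rw [← integral_indicator measurableSet_Ioo, ← integral_indicator measurableSet_Ioo,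
    ← integral_sub_right_eq_self _ v]
  refine integral_congr_ae (Eventually.of_forall fun t => ?_)
  simp only [Set.indicator, Set.mem_Ioo, shiftR]
  by_cases h1 : v < t
  · have h3 : 0 < t - v := by linarith
    have h4 : 0 < t := by linarith
    by_cases h2 : t < u
    · have h5 : t - v < u := by linarith
      have h6 : v < u - (t - v) := by linarith
      have h7 : u - (t - v) - v = u - t := by ring
      simp only [h1, h2, h3, h4, h5, h6, h7, and_self, if_true]
    · have h6 : ¬ v < u - (t - v) := by linarith
      simp only [h2, h6, and_false, if_false, zero_mul, ite_self]
  · have h3 : ¬ 0 < t - v := by linarith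
    simp only [h1, h3, false_and, if_false, mul_zero, ite_self]

end HankelAux

end

/-- `T ∈ B(L^p(ℝ₊))` is Hankelian iff for all sequences `(f_n)` in `L^p(ℝ₊)`
and `(g_n)` in `L^{p'}(ℝ₊)` with `Σ_n ‖f_n‖_p ‖g_n‖_{p'} < ∞` and
`Σ_n (f_n ∗ g_n)(u) = 0` for every `u > 0`, one has `Σ_n ⟨T f_n, g_n⟩ = 0`. -/
theorem hankelian_iff_annihilates_kernel (p q : ℝ≥0∞) [Fact (1 ≤ p)] [Fact (1 ≤ q)]
    (hp : 1 < p) (hp' : p ≠ ∞) (hpq : p⁻¹ + q⁻¹ = 1)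
    (T : Lp ℂ p muplus →L[ℂ] Lp ℂ p muplus) :
    IsHankelianLp p q T ↔
      ∀ (f : ℕ → Lp ℂ p muplus) (g : ℕ → Lp ℂ q muplus),
        (Summable fun n => ‖f n‖ * ‖g n‖) →
        (∀ u : ℝ, 0 < u →
          (∑' n : ℕ, ∫ t in Set.Ioo 0 u, (f n : ℝ → ℂ) (u - t) * (g n : ℝ → ℂ) t) = 0) →
        (∑' n : ℕ, ∫ t, (T (f n) : ℝ → ℂ) t * (g n : ℝ → ℂ) t ∂muplus) = 0 := by
  have hc : ENNReal.HolderConjugate p q := ⟨by simpa using hpq⟩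
  have hq : q ≠ ∞ := by
    rintro rfl
    simp at hpq
    exact hp.ne' hpq
  constructor
  · intro hT f g hs h0
    have := HankelAux.step2 hp' hq hT f g hs h0
    simpa only [HankelAux.pair_eq] using this
  · intro H v hv f fv g gv hf hg
    have h := H (fun n => if n = 0 then fv else if n = 1 then f else 0)
      (fun n => if n = 0 then g else if n = 1 then -gv else 0) ?_ ?_
    · simp only [← HankelAux.pair_eq p q] at h ⊢
      rw [tsum_eq_sum (s := Finset.range 2)] at h
      · simp [Finset.sum_range_succ] at h
        exact add_neg_eq_zero.1 h
      · intro n hn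
        have : n ≠ 0 ∧ n ≠ 1 := by simp at hn; omega
        simp [this.1, this.2]
    · refine summable_of_ne_finset_zero (s := Finset.range 2) fun n hn => ?_
      have : n ≠ 0 ∧ n ≠ 1 := by simp at hn; omega
      simp [this.1, this.2]
    · intro u hu
      rw [tsum_eq_sum (s := Finset.range 2)]
      · simp only [Finset.sum_range_succ, Finset.sum_range_zero, zero_add, if_true, one_ne_zero,
          if_false]
        have e1 : ∫ t in Set.Ioo 0 u, (fv : ℝ → ℂ) (u - t) * g t
            = ∫ t in Set.Ioo 0 u, shiftR v f (u - t) * g t := by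
          refine integral_congr_ae ?_
          filter_upwards [HankelAux.ae_Ioo_refl hf u] with t ht
          rw [ht]
        have e2 : ∫ t in Set.Ioo 0 u, (f : ℝ → ℂ) (u - t) * (-gv : Lp ℂ q muplus) t
            = - ∫ t in Set.Ioo 0 u, f (u - t) * shiftR v g t := by
          rw [← integral_neg]
          refine integral_congr_ae ?_
          filter_upwards [HankelAux.ae_Ioo hg u, HankelAux.ae_Ioo (Lp.coeFn_neg gv) u] with t ht ht2
          rw [ht2, Pi.neg_apply, ht, mul_neg]
        rw [e1, e2, HankelAux.shift_conv f g u hv, add_neg_cancel]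
      · intro n hn
        have : n ≠ 0 ∧ n ≠ 1 := by simp at hn; omega
        simp only [this.1, this.2, if_false]
        rw [← integral_zero ℝ ℂ (μ := volume.restrict (Set.Ioo 0 u))]
        refine integral_congr_ae ?_
        filter_upwards [HankelAux.ae_Ioo (Lp.coeFn_zero ℂ q muplus) u] with t ht
        rw [ht]; simp
end

section
/- Let 1 < p < ∞ with conjugate exponent p', let T ∈ B(L^p(ℝ₊)), and let k, l : ℝ → ℂ be continuous functions with compact support. Then for every f ∈ L^p(ℝ₊) and g ∈ L^{p'}(ℝ₊), the function u ↦ ⟨T((τ_u k)·f), (τ_{−u} l)·g⟩ is integrable over ℝ with ∫_ℝ |⟨T((τ_u k)·f), (τ_{−u} l)·g⟩| du ≤ ‖T‖ ‖f‖_p ‖g‖_{p'} ‖k‖_{L^p(ℝ)} ‖l‖_{L^{p'}(ℝ)}, and there exists a bounded operator T_{k,l} ∈ B(L^p(ℝ₊)) such that ⟨T_{k,l} f, g⟩ = ∫_ℝ ⟨T((τ_u k)·f), (τ_{−u} l)·g⟩ du for all such f, g; moreover ‖T_{k,l}‖ ≤ ‖T‖ ‖k‖_{L^p(ℝ)} ‖l‖_{L^{p'}(ℝ)}.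 -/
open scoped ENNReal
open MeasureTheory

section helpers

/-- The class of `t ↦ k (t - u)` in `L^∞(ℝ₊)`. -/
noncomputable def transCls (k : ℝ → ℂ) (hkc : Continuous k) (hks : HasCompactSupport k) (u : ℝ) :
    Lp ℂ ∞ muplus :=
  MemLp.toLp (fun t => k (t - u))
    (memLp_top_of_bound (by fun_prop : Continuous fun t => k (t - u)).aestronglyMeasurable
      (hkc.bounded_above_of_compact_support hks).choose
      (Filter.Eventually.of_forall fun t =>
        (hkc.bounded_above_of_compact_support hks).choose_spec (t - u)))

lemma transCls_coe (k : ℝ → ℂ) (hkc : Continuous k) (hks : HasCompactSupport k) (u : ℝ) :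
    (transCls k hkc hks u : ℝ → ℂ) =ᵐ[muplus] fun t => k (t - u) :=
  MemLp.coeFn_toLp _

lemma norm_top_le (f : Lp ℂ ∞ muplus) (C : ℝ) (hC : 0 ≤ C) (h : ∀ᵐ t ∂muplus, ‖f t‖ ≤ C) :
    ‖f‖ ≤ C := by
  rw [Lp.norm_def, eLpNorm_exponent_top]
  exact ENNReal.toReal_le_of_le_ofReal hC (eLpNormEssSup_le_of_ae_bound h)

lemma transCls_continuous (k : ℝ → ℂ) (hkc : Continuous k) (hks : HasCompactSupport k) :
    Continuous (transCls k hkc hks) := by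
  have huc := hks.uniformContinuous_of_continuous hkc
  rw [Metric.uniformContinuous_iff] at huc
  rw [Metric.continuous_iff]
  intro u ε hε
  obtain ⟨δ, hδ, h⟩ := huc (ε / 2) (by positivity)
  refine ⟨δ, hδ, fun v hv => ?_⟩
  rw [dist_eq_norm]
  refine lt_of_le_of_lt (norm_top_le _ (ε / 2) (by positivity) ?_) (by linarith)
  filter_upwards [transCls_coe k hkc hks u, transCls_coe k hkc hks v,
    Lp.coeFn_sub (transCls k hkc hks v) (transCls k hkc hks u)] with t h1 h2 h3
  rw [h3, Pi.sub_apply, h1, h2, ← dist_eq_norm]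
  refine (h ?_).le
  rw [Real.dist_eq] at hv ⊢
  rw [abs_sub_comm] at hv
  convert hv using 2
  ring

/-- multiplication operator. -/
noncomputable def mulOp (p : ℝ≥0∞) [Fact (1 ≤ p)] :
    Lp ℂ ∞ muplus →L[ℂ] Lp ℂ p muplus →L[ℂ] Lp ℂ p muplus :=
  (ContinuousLinearMap.mul ℂ ℂ).holderL muplus ∞ p p

lemma mulOp_coe (p : ℝ≥0∞) [Fact (1 ≤ p)] (a : Lp ℂ ∞ muplus) (f : Lp ℂ p muplus) :
    (mulOp p a f : ℝ → ℂ) =ᵐ[muplus] fun t => a t * f t := by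
  have := (ContinuousLinearMap.mul ℂ ℂ).coeFn_holder (r := p) a f
  simpa [mulOp] using this

lemma mulOp_trans_coe (p : ℝ≥0∞) [Fact (1 ≤ p)] (k : ℝ → ℂ) (hkc : Continuous k)
    (hks : HasCompactSupport k) (u : ℝ) (f : Lp ℂ p muplus) :
    (mulOp p (transCls k hkc hks u) f : ℝ → ℂ) =ᵐ[muplus] fun t => k (t - u) * f t := by
  filter_upwards [mulOp_coe p (transCls k hkc hks u) f, transCls_coe k hkc hks u] with t h1 h2
  rw [h1, h2]

lemma eLpNorm_mulOp (p : ℝ≥0∞) [Fact (1 ≤ p)] (hp' : p ≠ ∞) (k : ℝ → ℂ) (hkc : Continuous k)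
    (hks : HasCompactSupport k) (f : Lp ℂ p muplus) :
    eLpNorm (fun u => mulOp p (transCls k hkc hks u) f) p volume
      = eLpNorm k p volume * ‖f‖ₑ := by
  have hp1 : (1 : ℝ≥0∞) ≤ p := Fact.out
  have hp0 : p ≠ 0 := (lt_of_lt_of_le one_pos hp1).ne'
  have hP : 0 < p.toReal := ENNReal.toReal_pos hp0 hp'
  rw [Lp.enorm_def]
  simp only [eLpNorm_eq_lintegral_rpow_enorm_toReal hp0 hp']
  rw [← ENNReal.mul_rpow_of_nonneg _ _ (by positivity)]
  congr 1
  have key : ∀ u, ‖mulOp p (transCls k hkc hks u) f‖ₑ ^ p.toReal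
      = ∫⁻ t, ‖k (t - u)‖ₑ ^ p.toReal * ‖f t‖ₑ ^ p.toReal ∂muplus := by
    intro u
    rw [Lp.enorm_def, eLpNorm_eq_lintegral_rpow_enorm_toReal hp0 hp', ← ENNReal.rpow_mul,
      one_div_mul_cancel hP.ne', ENNReal.rpow_one]
    refine lintegral_congr_ae ?_
    filter_upwards [mulOp_trans_coe p k hkc hks u f] with t ht
    rw [ht, enorm_mul, ENNReal.mul_rpow_of_nonneg _ _ hP.le]
  simp only [key]
  have hkm : Measurable fun x => ‖k x‖ₑ ^ p.toReal := hkc.measurable.enorm.pow_const _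
  have : SFinite muplus := by unfold muplus; infer_instance
  rw [lintegral_lintegral_swap]
  · have h2 : ∀ t, ∫⁻ u, ‖k (t - u)‖ₑ ^ p.toReal * ‖f t‖ₑ ^ p.toReal
        = (∫⁻ u, ‖k u‖ₑ ^ p.toReal) * ‖f t‖ₑ ^ p.toReal := by
      intro t
      rw [lintegral_mul_const _ (by exact hkm.comp (measurable_const.sub measurable_id)),
        lintegral_sub_left_eq_self (fun u => ‖k u‖ₑ ^ p.toReal) t]
    simp only [h2]
    rw [lintegral_const_mul _ ((Lp.stronglyMeasurable f).enorm.pow_const _)]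
  · refine AEMeasurable.mul ?_ ?_
    · exact (hkm.comp (measurable_snd.sub measurable_fst)).aemeasurable
    · exact (((Lp.stronglyMeasurable f).enorm.pow_const _).comp measurable_snd).aemeasurable

lemma eLpNorm_mulOp_neg (p : ℝ≥0∞) [Fact (1 ≤ p)] (hp' : p ≠ ∞) (k : ℝ → ℂ) (hkc : Continuous k)
    (hks : HasCompactSupport k) (f : Lp ℂ p muplus) :
    eLpNorm (fun u => mulOp p (transCls k hkc hks (-u)) f) p volume
      = eLpNorm k p volume * ‖f‖ₑ := by
  have hp1 : (1 : ℝ≥0∞) ≤ p := Fact.out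
  have hp0 : p ≠ 0 := (lt_of_lt_of_le one_pos hp1).ne'
  rw [← eLpNorm_mulOp p hp' k hkc hks f]
  simp only [eLpNorm_eq_lintegral_rpow_enorm_toReal hp0 hp']
  rw [lintegral_neg_eq_self (fun u => ‖mulOp p (transCls k hkc hks u) f‖ₑ ^ p.toReal)]

lemma transCls_eq_zero (k : ℝ → ℂ) (hkc : Continuous k) (hks : HasCompactSupport k) (u : ℝ)
    (h : ∀ t, 0 < t → k (t - u) = 0) : transCls k hkc hks u = 0 := by
  rw [Lp.eq_zero_iff_ae_eq_zero]
  have : ∀ᵐ t ∂muplus, t ∈ Set.Ioi (0 : ℝ) := ae_restrict_mem measurableSet_Ioi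
  filter_upwards [transCls_coe k hkc hks u, this] with t h1 h2
  rw [h1, h t h2, Pi.zero_apply]

/-- the bilinear pairing. -/
noncomputable def pairing (p q : ℝ≥0∞) [Fact (1 ≤ p)] [Fact (1 ≤ q)] [p.HolderConjugate q] :
    Lp ℂ p muplus →L[ℂ] Lp ℂ q muplus →L[ℂ] ℂ :=
  (ContinuousLinearMap.mul ℂ ℂ).lpPairing muplus p q

lemma pairing_eq (p q : ℝ≥0∞) [Fact (1 ≤ p)] [Fact (1 ≤ q)] [p.HolderConjugate q]
    (f : Lp ℂ p muplus) (g : Lp ℂ q muplus) :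
    pairing p q f g = ∫ t, f t * g t ∂muplus := by
  rw [pairing, ContinuousLinearMap.lpPairing_eq_integral]
  simp

lemma norm_pairing_le (p q : ℝ≥0∞) [Fact (1 ≤ p)] [Fact (1 ≤ q)] [p.HolderConjugate q]
    (f : Lp ℂ p muplus) (g : Lp ℂ q muplus) :
    ‖pairing p q f g‖ ≤ ‖f‖ * ‖g‖ := by
  rw [pairing_eq]
  refine (norm_integral_le_lintegral_norm _).trans ?_
  rw [Lp.norm_def, Lp.norm_def, ← ENNReal.toReal_mul]
  refine ENNReal.toReal_mono (by finiteness) ?_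
  have := eLpNorm_smul_le_mul_eLpNorm (p := p) (q := q) (r := 1)
    (Lp.aestronglyMeasurable g) (Lp.aestronglyMeasurable f)
  rw [eLpNorm_one_eq_lintegral_enorm] at this
  simpa [ofReal_norm] using this

/-- `L^{q}` is norming for `L^p`. -/
lemma norm_le_of_pairing (p q : ℝ≥0∞) [Fact (1 ≤ p)] [Fact (1 ≤ q)] [p.HolderConjugate q]
    (hp : 1 < p) (hp' : p ≠ ∞) (h : Lp ℂ p muplus) (C : ℝ) (hC : 0 ≤ C)
    (hb : ∀ g : Lp ℂ q muplus, ‖pairing p q h g‖ ≤ C * ‖g‖) : ‖h‖ ≤ C := by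
  have hpq : p⁻¹ + q⁻¹ = 1 := by
    simpa using ENNReal.HolderTriple.inv_add_inv_eq_inv (p := p) (q := q) (r := 1)
  have hp0 : p ≠ 0 := (lt_trans one_pos hp).ne'
  have hP : 1 < p.toReal := by
    rw [← ENNReal.toReal_one]; exact (ENNReal.toReal_lt_toReal (by simp) hp').2 hp
  set P := p.toReal with hPdef
  have hq' : q ≠ ∞ := by
    rintro rfl
    simp at hpq
    exact hp.ne' hpq
  have hq0 : q ≠ 0 := by
    rintro rfl
    simp at hpq
  have hexp : q * ENNReal.ofReal (P - 1) = p := by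
    have h3 : P⁻¹ + q.toReal⁻¹ = 1 := by
      have := congrArg ENNReal.toReal hpq
      rwa [ENNReal.toReal_add (by simpa using hp0) (by simpa using hq0), ENNReal.toReal_inv,
        ENNReal.toReal_inv, ENNReal.toReal_one] at this
    have hQ : 0 < q.toReal := ENNReal.toReal_pos hq0 hq'
    rw [← ENNReal.ofReal_toReal hq', ← ENNReal.ofReal_mul hQ.le, ← ENNReal.ofReal_toReal hp',
      ← hPdef]
    congr 1
    have : 0 < P := by linarith
    field_simp at h3
    linarith
  set g0 : ℝ → ℂ := fun t => (starRingEnd ℂ) (h t) * ((‖h t‖ ^ (P - 2) : ℝ) : ℂ) with hg0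
  have hn : ∀ t, ‖g0 t‖ = ‖h t‖ ^ (P - 1) := by
    intro t
    simp only [hg0, norm_mul, RCLike.norm_conj, Complex.norm_real, Real.norm_eq_abs]
    rw [abs_of_nonneg (by positivity)]
    rcases (norm_nonneg (h t)).eq_or_lt with h0 | h0
    · rw [← h0, Real.zero_rpow (x := P - 1) (by linarith), zero_mul]
    · rw [← Real.rpow_one_add' h0.le (by linarith)]
      congr 1; ring
  have hm : AEStronglyMeasurable g0 muplus := by
    have := (Lp.stronglyMeasurable h).measurable
    apply Measurable.aestronglyMeasurable
    fun_prop
  have hN : eLpNorm g0 q muplus = ‖h‖ₑ ^ (P - 1) := by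
    rw [← eLpNorm_norm]
    simp only [hn]
    rw [eLpNorm_norm_rpow _ (by linarith), hexp, Lp.enorm_def]
  have hmem : MemLp g0 q muplus := by
    refine ⟨hm, ?_⟩
    rw [hN]
    exact ENNReal.rpow_lt_top_of_nonneg (by linarith) enorm_ne_top
  have hb0 := hb (hmem.toLp g0)
  have hint : pairing p q h (hmem.toLp g0) = ((‖h‖ ^ P : ℝ) : ℂ) := by
    rw [pairing_eq]
    have : ∫ t, h t * (hmem.toLp g0) t ∂muplus = ∫ t, ((‖h t‖ ^ P : ℝ) : ℂ) ∂muplus := by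
      refine integral_congr_ae ?_
      filter_upwards [hmem.coeFn_toLp] with t ht
      rw [ht]
      simp only [hg0]
      rw [← mul_assoc, Complex.mul_conj, Complex.normSq_eq_norm_sq, ← Complex.ofReal_mul]
      congr 1
      rcases (norm_nonneg (h t)).eq_or_lt with h0 | h0
      · rw [← h0, Real.zero_rpow (x := P) (by linarith)]; simp
      · rw [← Real.rpow_natCast, ← Real.rpow_add h0]
        congr 1; push_cast; ring
    rw [this, integral_complex_ofReal]
    congr 1
    rw [Lp.norm_def, eLpNorm_eq_lintegral_rpow_enorm_toReal hp0 hp', ENNReal.toReal_rpow,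
      ← ENNReal.rpow_mul, one_div_mul_cancel (by linarith), ENNReal.rpow_one,
      integral_eq_lintegral_of_nonneg_ae (Filter.Eventually.of_forall fun t => by positivity)]
    · congr 1
      refine lintegral_congr fun t => ?_
      rw [← ENNReal.ofReal_rpow_of_nonneg (norm_nonneg _) (by linarith), ofReal_norm]
    · have := (Lp.stronglyMeasurable h).measurable
      apply Measurable.aestronglyMeasurable
      fun_prop
  rw [hint, Lp.norm_toLp, hN, ← ENNReal.toReal_rpow, toReal_enorm, Complex.norm_real,
    Real.norm_of_nonneg (by positivity)] at hb0
  rcases (norm_nonneg h).eq_or_lt with h0 | h0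
  · rw [← h0]; exact hC
  · have hpos : 0 < ‖h‖ ^ (P - 1) := by positivity
    have : ‖h‖ ^ P = ‖h‖ * ‖h‖ ^ (P - 1) := by
      rw [← Real.rpow_one_add' h0.le (by linarith)]
      congr 1; ring
    rw [this] at hb0
    exact le_of_mul_le_mul_right hb0 hpos

/-- the integrand, operator valued. -/
noncomputable def opIntegrand (p : ℝ≥0∞) [Fact (1 ≤ p)]
    (T : Lp ℂ p muplus →L[ℂ] Lp ℂ p muplus)
    (k l : ℝ → ℂ) (hkc : Continuous k) (hks : HasCompactSupport k)
    (hlc : Continuous l) (hls : HasCompactSupport l) (u : ℝ) :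
    Lp ℂ p muplus →L[ℂ] Lp ℂ p muplus :=
  (mulOp p (transCls l hlc hls (-u))).comp (T.comp (mulOp p (transCls k hkc hks u)))

lemma opIntegrand_integrable (p : ℝ≥0∞) [Fact (1 ≤ p)]
    (T : Lp ℂ p muplus →L[ℂ] Lp ℂ p muplus)
    (k l : ℝ → ℂ) (hkc : Continuous k) (hks : HasCompactSupport k)
    (hlc : Continuous l) (hls : HasCompactSupport l) :
    Integrable (opIntegrand p T k l hkc hks hlc hls) volume := by
  refine Continuous.integrable_of_hasCompactSupport ?_ ?_
  · have h1 := transCls_continuous k hkc hks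
    have h2 := transCls_continuous l hlc hls
    have h3 : Continuous fun u => mulOp p (transCls k hkc hks u) := (mulOp p).continuous.comp h1
    have h4 : Continuous fun u => mulOp p (transCls l hlc hls (-u)) :=
      (mulOp p).continuous.comp (h2.comp continuous_neg)
    exact h4.clm_comp (continuous_const.clm_comp h3)
  · obtain ⟨R₁, hR₁⟩ := hks.isCompact.isBounded.subset_closedBall (0 : ℝ)
    obtain ⟨R₂, hR₂⟩ := hls.isCompact.isBounded.subset_closedBall (0 : ℝ)
    have hk0 : ∀ x, R₁ < x → k x = 0 := fun x hx => by
      by_contra hne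
      have := hR₁ (subset_tsupport k hne)
      rw [Metric.mem_closedBall, Real.dist_eq, sub_zero] at this
      linarith [le_abs_self x]
    have hl0 : ∀ x, R₂ < x → l x = 0 := fun x hx => by
      by_contra hne
      have := hR₂ (subset_tsupport l hne)
      rw [Metric.mem_closedBall, Real.dist_eq, sub_zero] at this
      linarith [le_abs_self x]
    refine HasCompactSupport.intro (K := Set.Icc (-R₁) R₂) isCompact_Icc fun u hu => ?_
    by_cases hu1 : u < -R₁
    · have : transCls k hkc hks u = 0 :=
        transCls_eq_zero k hkc hks u fun t ht => hk0 _ (by linarith)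
      simp [opIntegrand, this]
    · have hu2 : R₂ < u := by
        by_contra hcon
        exact hu ⟨not_lt.1 hu1, not_lt.1 hcon⟩
      have : transCls l hlc hls (-u) = 0 :=
        transCls_eq_zero l hlc hls (-u) fun t ht => hl0 _ (by linarith)
      simp [opIntegrand, this]

lemma pairing_opIntegrand (p q : ℝ≥0∞) [Fact (1 ≤ p)] [Fact (1 ≤ q)] [p.HolderConjugate q]
    (T : Lp ℂ p muplus →L[ℂ] Lp ℂ p muplus)
    (k l : ℝ → ℂ) (hkc : Continuous k) (hks : HasCompactSupport k)
    (hlc : Continuous l) (hls : HasCompactSupport l)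
    (f : Lp ℂ p muplus) (g : Lp ℂ q muplus) (u : ℝ) :
    pairing p q (opIntegrand p T k l hkc hks hlc hls u f) g
      = pairing p q (T (mulOp p (transCls k hkc hks u) f))
          (mulOp q (transCls l hlc hls (-u)) g) := by
  rw [pairing_eq, pairing_eq]
  refine integral_congr_ae ?_
  filter_upwards [mulOp_coe p (transCls l hlc hls (-u)) (T (mulOp p (transCls k hkc hks u) f)),
    mulOp_coe q (transCls l hlc hls (-u)) g] with t h1 h2
  simp only [opIntegrand, ContinuousLinearMap.comp_apply]
  rw [h1, h2]
  ring

/-- evaluation against `f` and `g` as a functional on operators. -/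
noncomputable def evalFG (p q : ℝ≥0∞) [Fact (1 ≤ p)] [Fact (1 ≤ q)] [p.HolderConjugate q]
    (f : Lp ℂ p muplus) (g : Lp ℂ q muplus) :
    (Lp ℂ p muplus →L[ℂ] Lp ℂ p muplus) →L[ℂ] ℂ :=
  ((pairing p q).flip g).comp (ContinuousLinearMap.apply ℂ (Lp ℂ p muplus) f)

lemma evalFG_apply (p q : ℝ≥0∞) [Fact (1 ≤ p)] [Fact (1 ≤ q)] [p.HolderConjugate q]
    (f : Lp ℂ p muplus) (g : Lp ℂ q muplus) (S : Lp ℂ p muplus →L[ℂ] Lp ℂ p muplus) :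
    evalFG p q f g S = pairing p q (S f) g := rfl

lemma main_bound (p q : ℝ≥0∞) [Fact (1 ≤ p)] [Fact (1 ≤ q)] [p.HolderConjugate q]
    (hp' : p ≠ ∞) (hq' : q ≠ ∞)
    (T : Lp ℂ p muplus →L[ℂ] Lp ℂ p muplus)
    (k l : ℝ → ℂ) (hkc : Continuous k) (hks : HasCompactSupport k)
    (hlc : Continuous l) (hls : HasCompactSupport l)
    (f : Lp ℂ p muplus) (g : Lp ℂ q muplus) :
    Integrable (fun u => pairing p q (opIntegrand p T k l hkc hks hlc hls u f) g) volume ∧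
    ∫ u, ‖pairing p q (opIntegrand p T k l hkc hks hlc hls u f) g‖
      ≤ ‖T‖ * ‖f‖ * ‖g‖ * (eLpNorm k p volume).toReal * (eLpNorm l q volume).toReal := by
  have hint : Integrable (fun u => pairing p q (opIntegrand p T k l hkc hks hlc hls u f) g)
      volume := by
    have h0 := (evalFG p q f g).integrable_comp (opIntegrand_integrable p T k l hkc hks hlc hls)
    simpa only [evalFG_apply] using h0
  refine ⟨hint, ?_⟩
  have hFc : Continuous fun u => mulOp p (transCls k hkc hks u) f :=
    ((mulOp p).continuous.comp (transCls_continuous k hkc hks)).clm_apply continuous_const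
  have hGc : Continuous fun u => mulOp q (transCls l hlc hls (-u)) g :=
    ((mulOp q).continuous.comp ((transCls_continuous l hlc hls).comp continuous_neg)).clm_apply
      continuous_const
  have hH := eLpNorm_le_eLpNorm_mul_eLpNorm_of_nnnorm (p := p) (q := q) (r := 1) (μ := volume)
    hFc.aestronglyMeasurable hGc.aestronglyMeasurable
    (fun x y => pairing p q (T x) y) ‖T‖₊ (Filter.Eventually.of_forall fun u => by
      rw [← NNReal.coe_le_coe]
      push_cast
      refine (norm_pairing_le p q _ _).trans ?_
      gcongr
      exact T.le_opNorm _)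
  rw [eLpNorm_mulOp p hp', eLpNorm_mulOp_neg q hq', eLpNorm_one_eq_lintegral_enorm] at hH
  rw [integral_norm_eq_lintegral_enorm hint.aestronglyMeasurable]
  simp only [pairing_opIntegrand]
  have hkm : eLpNorm k p volume ≠ ∞ := (hkc.memLp_of_hasCompactSupport hks).2.ne
  have hlm : eLpNorm l q volume ≠ ∞ := (hlc.memLp_of_hasCompactSupport hls).2.ne
  refine (ENNReal.toReal_mono (by finiteness) hH).trans (le_of_eq ?_)
  simp only [ENNReal.toReal_mul, toReal_enorm, ENNReal.coe_toReal, coe_nnnorm]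
  ring

end helpers

/-- for `T ∈ B(L^p(ℝ₊))` and `k, l ∈ C_c(ℝ)`, the function
`u ↦ ⟨T((τ_u k)·f), (τ_{−u} l)·g⟩` is integrable on `ℝ` with integral of its absolute value
bounded by `‖T‖ ‖f‖_p ‖g‖_{p'} ‖k‖_{L^p(ℝ)} ‖l‖_{L^{p'}(ℝ)}`, and there is a bounded
operator `T_{k,l}` with `⟨T_{k,l} f, g⟩ = ∫_ℝ ⟨T((τ_u k)·f), (τ_{−u} l)·g⟩ du` and
`‖T_{k,l}‖ ≤ ‖T‖ ‖k‖_{L^p(ℝ)} ‖l‖_{L^{p'}(ℝ)}`.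
Here `F u`, `G u` are the `L^p`/`L^{p'}` classes of `t ↦ k(t−u) f(t)` and `t ↦ l(t+u) g(t)`. -/
theorem smoothing_operator_Tkl (p q : ℝ≥0∞) [Fact (1 ≤ p)] [Fact (1 ≤ q)]
    (hp : 1 < p) (hp' : p ≠ ∞) (hpq : p⁻¹ + q⁻¹ = 1)
    (T : Lp ℂ p muplus →L[ℂ] Lp ℂ p muplus)
    (k l : ℝ → ℂ) (hkc : Continuous k) (hks : HasCompactSupport k)
    (hlc : Continuous l) (hls : HasCompactSupport l) :
    (∀ (f : Lp ℂ p muplus) (g : Lp ℂ q muplus)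
        (F : ℝ → Lp ℂ p muplus) (G : ℝ → Lp ℂ q muplus),
      (∀ u : ℝ, (F u : ℝ → ℂ) =ᵐ[muplus] fun t => k (t - u) * (f : ℝ → ℂ) t) →
      (∀ u : ℝ, (G u : ℝ → ℂ) =ᵐ[muplus] fun t => l (t + u) * (g : ℝ → ℂ) t) →
      Integrable (fun u => ∫ t, (T (F u) : ℝ → ℂ) t * (G u : ℝ → ℂ) t ∂muplus) volume ∧
      ∫ u, ‖∫ t, (T (F u) : ℝ → ℂ) t * (G u : ℝ → ℂ) t ∂muplus‖
        ≤ ‖T‖ * ‖f‖ * ‖g‖ * (eLpNorm k p volume).toReal * (eLpNorm l q volume).toReal) ∧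
    ∃ Tkl : Lp ℂ p muplus →L[ℂ] Lp ℂ p muplus,
      ‖Tkl‖ ≤ ‖T‖ * (eLpNorm k p volume).toReal * (eLpNorm l q volume).toReal ∧
      ∀ (f : Lp ℂ p muplus) (g : Lp ℂ q muplus)
          (F : ℝ → Lp ℂ p muplus) (G : ℝ → Lp ℂ q muplus),
        (∀ u : ℝ, (F u : ℝ → ℂ) =ᵐ[muplus] fun t => k (t - u) * (f : ℝ → ℂ) t) →
        (∀ u : ℝ, (G u : ℝ → ℂ) =ᵐ[muplus] fun t => l (t + u) * (g : ℝ → ℂ) t) →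
        ∫ t, (Tkl f : ℝ → ℂ) t * (g : ℝ → ℂ) t ∂muplus
          = ∫ u, ∫ t, (T (F u) : ℝ → ℂ) t * (G u : ℝ → ℂ) t ∂muplus := by
  have : p.HolderConjugate q := ⟨by simpa using hpq⟩
  have hq' : q ≠ ∞ := by
    rintro rfl
    simp at hpq
    exact hp.ne' hpq
  have hcongr : ∀ (f : Lp ℂ p muplus) (g : Lp ℂ q muplus)
        (F : ℝ → Lp ℂ p muplus) (G : ℝ → Lp ℂ q muplus),
      (∀ u : ℝ, (F u : ℝ → ℂ) =ᵐ[muplus] fun t => k (t - u) * (f : ℝ → ℂ) t) →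
      (∀ u : ℝ, (G u : ℝ → ℂ) =ᵐ[muplus] fun t => l (t + u) * (g : ℝ → ℂ) t) →
      ∀ u, ∫ t, (T (F u) : ℝ → ℂ) t * (G u : ℝ → ℂ) t ∂muplus
        = pairing p q (opIntegrand p T k l hkc hks hlc hls u f) g := by
    intro f g F G hF hG u
    have h1 : F u = mulOp p (transCls k hkc hks u) f :=
      Lp.ext ((hF u).trans (mulOp_trans_coe p k hkc hks u f).symm)
    have h2 : G u = mulOp q (transCls l hlc hls (-u)) g := by
      refine Lp.ext ((hG u).trans ?_)
      have := (mulOp_trans_coe q l hlc hls (-u) g).symm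
      simpa only [sub_neg_eq_add] using this
    rw [pairing_opIntegrand, ← h1, ← h2, pairing_eq]
  have hI := opIntegrand_integrable p T k l hkc hks hlc hls
  have hTkl : ∀ (f : Lp ℂ p muplus) (g : Lp ℂ q muplus),
      pairing p q ((∫ u, opIntegrand p T k l hkc hks hlc hls u) f) g
        = ∫ u, pairing p q (opIntegrand p T k l hkc hks hlc hls u f) g := by
    intro f g
    have := (evalFG p q f g).integral_comp_comm hI
    simpa only [evalFG_apply] using this.symm
  refine ⟨fun f g F G hF hG => ?_, ∫ u, opIntegrand p T k l hkc hks hlc hls u, ?_,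
    fun f g F G hF hG => ?_⟩
  · simp only [hcongr f g F G hF hG]
    exact main_bound p q hp' hq' T k l hkc hks hlc hls f g
  · refine ContinuousLinearMap.opNorm_le_bound _ (by positivity) fun f => ?_
    refine norm_le_of_pairing p q hp hp' _ _ (by positivity) fun g => ?_
    rw [hTkl]
    refine (norm_integral_le_integral_norm _).trans ?_
    refine (main_bound p q hp' hq' T k l hkc hks hlc hls f g).2.trans (le_of_eq ?_)
    ring
  · simp only [hcongr f g F G hF hG]
    rw [← hTkl, pairing_eq]
end

section
/- Let 1 < p < ∞ with conjugate exponent p' and let T ∈ B(L^p(ℝ₊)). For n ≥ 1 set k_n := (2n)^{−1/p} χ_{[−n,n]} and l_n := (2n)^{−1/p'} χ_{[−n,n]}. Then for every r > 0 and all continuous functions f, g on ℝ₊ with support contained in (0,r], one has |⟨T f, g⟩ − ⟨T_{k_n,l_n} f, g⟩| ≤ (2r/n) ‖T‖ ‖f‖_p ‖g‖_{p'}. -/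
open scoped ENNReal
open MeasureTheory

/-- The normalized indicator `k_n = (2n)^{−1/p} χ_{[−n,n]}` (as a complex-valued function). -/
noncomputable def kn (p : ℝ) (n : ℕ) : ℝ → ℂ := fun t =>
  if t ∈ Set.Icc (-(n : ℝ)) (n : ℝ) then (((2 * (n : ℝ)) ^ (-(1 / p)) : ℝ) : ℂ) else 0

/-- Cut-off of an `L^P` function at level `a`. -/
noncomputable def cutLp {P : ℝ≥0∞} {φ : ℝ → ℂ} (h : MemLp φ P muplus) (a : ℝ) :
    Lp ℂ P muplus :=
  (h.indicator (measurableSet_Iic (a := a))).toLp _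

lemma cutLp_coe {P : ℝ≥0∞} {φ : ℝ → ℂ} (h : MemLp φ P muplus) (a : ℝ) :
    (cutLp h a : ℝ → ℂ) =ᵐ[muplus] (Set.Iic a).indicator φ :=
  MemLp.coeFn_toLp _

lemma cutLp_norm_le {P : ℝ≥0∞} {φ : ℝ → ℂ} (h : MemLp φ P muplus) (a : ℝ) :
    ‖cutLp h a‖ ≤ (eLpNorm φ P muplus).toReal := by
  rw [cutLp, Lp.norm_toLp]
  exact ENNReal.toReal_mono h.2.ne (eLpNorm_indicator_le _)

lemma cutLp_eq {P : ℝ≥0∞} {φ : ℝ → ℂ} (h : MemLp φ P muplus) {a r : ℝ} (har : r ≤ a)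
    (hs : Function.support φ ⊆ Set.Ioc 0 r) : cutLp h a = h.toLp φ := by
  unfold cutLp
  congr 1
  rw [Set.indicator_eq_self]
  exact fun x hx => (hs hx).2.trans har

lemma memLp_of_supp {φ : ℝ → ℂ} (hc : Continuous φ) {r : ℝ}
    (hs : Function.support φ ⊆ Set.Ioc 0 r) (P : ℝ≥0∞) : MemLp φ P muplus := by
  have : HasCompactSupport φ :=
    HasCompactSupport.of_support_subset_isCompact isCompact_Icc (hs.trans Set.Ioc_subset_Icc_self)
  exact (hc.memLp_of_hasCompactSupport this (μ := volume)).restrict _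

lemma bdd_of_supp {φ : ℝ → ℂ} (hc : Continuous φ) {r : ℝ}
    (hs : Function.support φ ⊆ Set.Ioc 0 r) : ∃ C : ℝ, ∀ x, ‖φ x‖ ≤ C := by
  have : HasCompactSupport φ :=
    HasCompactSupport.of_support_subset_isCompact isCompact_Icc (hs.trans Set.Ioc_subset_Icc_self)
  exact hc.bounded_above_of_compact_support this

lemma cutLp_continuous {p : ℝ} (hp : 1 < p) [Fact (1 ≤ ENNReal.ofReal p)] {φ : ℝ → ℂ}
    (h : MemLp φ (ENNReal.ofReal p) muplus) {M : ℝ} (hM : ∀ x, ‖φ x‖ ≤ M) :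
    Continuous (cutLp h) := by
  have hM0 : 0 ≤ M := (norm_nonneg _).trans (hM 0)
  have key : ∀ a b, ‖cutLp h a - cutLp h b‖ ≤ M * |a - b| ^ (1 / p) := by
    intro a b
    rw [cutLp, cutLp, ← MemLp.toLp_sub, Lp.norm_toLp]
    refine ENNReal.toReal_le_of_le_ofReal (by positivity) ?_
    have h1 : eLpNorm ((Set.Iic a).indicator φ - (Set.Iic b).indicator φ) (ENNReal.ofReal p) muplus
        ≤ eLpNorm ((Set.uIoc b a).indicator (fun _ => M)) (ENNReal.ofReal p) muplus := by
      apply eLpNorm_mono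
      intro x
      have := hM x
      have hab := abs_of_nonneg hM0
      by_cases h1 : x ≤ a <;> by_cases h2 : x ≤ b
      · simp [h1, h2]
      · have : x ∈ Set.uIoc b a := Set.mem_uIoc.mpr (Or.inl ⟨not_le.mp h2, h1⟩)
        simpa [h1, h2, Set.indicator_of_mem this, hab] using hM x
      · have : x ∈ Set.uIoc b a := Set.mem_uIoc.mpr (Or.inr ⟨not_le.mp h1, h2⟩)
        simpa [h1, h2, Set.indicator_of_mem this, hab] using hM x
      · simp [h1, h2]
    refine h1.trans ((eLpNorm_indicator_const_le _ _).trans ?_)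
    rw [ENNReal.toReal_ofReal (by linarith), ENNReal.ofReal_mul hM0,
      ← ENNReal.ofReal_rpow_of_nonneg (abs_nonneg _) (by positivity),
      Real.enorm_eq_ofReal hM0]
    gcongr
    calc muplus (Set.uIoc b a) ≤ volume (Set.uIoc b a) := Measure.restrict_apply_le _ _
      _ = _ := by rw [Real.volume_uIoc]
  rw [continuous_iff_continuousAt]
  intro b
  rw [ContinuousAt, tendsto_iff_norm_sub_tendsto_zero]
  refine squeeze_zero (fun _ => norm_nonneg _) (fun a => key a b) ?_
  have : Continuous fun a : ℝ => M * |a - b| ^ (1 / p) := by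
    refine continuous_const.mul (Continuous.rpow_const (by fun_prop) fun _ => Or.inr (by positivity))
  have h2 := this.tendsto b
  simpa [Real.zero_rpow (by positivity : p⁻¹ ≠ 0)] using h2

lemma pair_norm_le {P Q : ℝ≥0∞} [Fact (1 ≤ P)] [Fact (1 ≤ Q)] [ENNReal.HolderConjugate P Q]
    (F : Lp ℂ P muplus) (G : Lp ℂ Q muplus) :
    ‖(ContinuousLinearMap.mul ℂ ℂ).lpPairing muplus P Q F G‖ ≤ ‖F‖ * ‖G‖ := by
  have h1 : (ContinuousLinearMap.mul ℂ ℂ).lpPairing muplus P Q F G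
      = L1.integral ((ContinuousLinearMap.mul ℂ ℂ).holder 1 F G) := by
    rw [ContinuousLinearMap.lpPairing_eq_integral, L1.integral_eq_integral]
    exact (integral_congr_ae (ContinuousLinearMap.coeFn_holder _ _ _)).symm
  rw [h1]
  refine (L1.norm_integral_le _).trans ((ContinuousLinearMap.norm_holder_apply_apply_le _ _ _).trans ?_)
  have := ContinuousLinearMap.opNorm_mul_le ℂ ℂ
  calc _ ≤ 1 * ‖F‖ * ‖G‖ := by gcongr
    _ = _ := by ring

/-- with `k_n = (2n)^{−1/p} χ_{[−n,n]}`, `l_n = (2n)^{−1/p'} χ_{[−n,n]}`, for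
continuous `f, g` supported in `(0,r]`,
`|⟨T f, g⟩ − ⟨T_{k_n,l_n} f, g⟩| ≤ (2r/n) ‖T‖ ‖f‖_p ‖g‖_{p'}`, where
`⟨T_{k_n,l_n} f, g⟩ = ∫_ℝ ⟨T((τ_u k_n)·f), (τ_{−u} l_n)·g⟩ du` and `F`, `Fu u` are the
`L^p` classes of `f` and `(τ_u k_n)·f`. -/
theorem approximation_by_Tknln (p q : ℝ) (hp : 1 < p) (hpq : 1 / p + 1 / q = 1)
    [Fact (1 ≤ ENNReal.ofReal p)]
    (T : Lp ℂ (ENNReal.ofReal p) muplus →L[ℂ] Lp ℂ (ENNReal.ofReal p) muplus)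
    (n : ℕ) (hn : 1 ≤ n) (r : ℝ) (hr : 0 < r)
    (f g : ℝ → ℂ) (hfc : Continuous f) (hgc : Continuous g)
    (hfs : Function.support f ⊆ Set.Ioc 0 r) (hgs : Function.support g ⊆ Set.Ioc 0 r)
    (F : Lp ℂ (ENNReal.ofReal p) muplus) (hF : (F : ℝ → ℂ) =ᵐ[muplus] f)
    (Fu : ℝ → Lp ℂ (ENNReal.ofReal p) muplus)
    (hFu : ∀ u : ℝ, (Fu u : ℝ → ℂ) =ᵐ[muplus] fun t => kn p n (t - u) * f t) :
    ‖(∫ t, (T F : ℝ → ℂ) t * g t ∂muplus)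
        - ∫ u : ℝ, ∫ t, (T (Fu u) : ℝ → ℂ) t * (kn q n (t + u) * g t) ∂muplus‖
      ≤ (2 * r / n) * ‖T‖ * (eLpNorm f (ENNReal.ofReal p) muplus).toReal
          * (eLpNorm g (ENNReal.ofReal q) muplus).toReal := by
  have hp0 : 0 < p := by linarith
  have hn0 : (0 : ℝ) < n := by exact_mod_cast hn
  have hip : 1 / p < 1 := by rw [div_lt_one hp0]; exact hp
  have hq0 : 0 < q := by
    have : 0 < 1 / q := by linarith
    exact one_div_pos.mp this
  have hq : 1 < q := by
    have h1 : 0 < 1 / p := by positivity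
    have : 1 / q < 1 := by linarith
    rwa [div_lt_one hq0] at this
  haveI : Fact (1 ≤ ENNReal.ofReal q) := ⟨by simpa using hq.le⟩
  haveI : ENNReal.HolderConjugate (ENNReal.ofReal p) (ENNReal.ofReal q) := by
    refine ⟨?_⟩
    rw [← ENNReal.ofReal_inv_of_pos hp0, ← ENNReal.ofReal_inv_of_pos hq0,
      ← ENNReal.ofReal_add (by positivity) (by positivity)]
    simp only [one_div] at hpq
    simp [hpq]
  have hf := memLp_of_supp hfc hfs (ENNReal.ofReal p)
  have hg := memLp_of_supp hgc hgs (ENNReal.ofReal q)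
  obtain ⟨Mf, hMf⟩ := bdd_of_supp hfc hfs
  obtain ⟨Mg, hMg⟩ := bdd_of_supp hgc hgs
  have hcf := cutLp_continuous hp hf hMf
  have hcg := cutLp_continuous hq hg hMg
  set B := (ContinuousLinearMap.mul ℂ ℂ).lpPairing muplus (ENNReal.ofReal p) (ENNReal.ofReal q)
    with hB
  have hFe : F = hf.toLp f := Lp.ext (hF.trans hf.coeFn_toLp.symm)
  set G := hg.toLp g with hG
  have hpos : ∀ᵐ t ∂muplus, 0 < t := ae_restrict_mem measurableSet_Ioi
  have hBint : ∀ (X : Lp ℂ (ENNReal.ofReal p) muplus) (Y : Lp ℂ (ENNReal.ofReal q) muplus)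
      (y : ℝ → ℂ), (Y : ℝ → ℂ) =ᵐ[muplus] y → ∫ t, (X : ℝ → ℂ) t * y t ∂muplus = B X Y := by
    intro X Y y hy
    rw [hB, ContinuousLinearMap.lpPairing_eq_integral]
    refine integral_congr_ae ?_
    filter_upwards [hy] with t ht
    simp [ht]
  set cp : ℂ := (((2 * (n : ℝ)) ^ (-(1 / p)) : ℝ) : ℂ) with hcp
  set cq : ℂ := (((2 * (n : ℝ)) ^ (-(1 / q)) : ℝ) : ℂ) with hcq
  have hcc : cp * cq = ((1 / (2 * n) : ℝ) : ℂ) := by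
    rw [hcp, hcq, ← Complex.ofReal_mul, ← Real.rpow_add (by positivity)]
    rw [show -(1 / p) + -(1 / q) = -1 by linarith, Real.rpow_neg_one, one_div]
  -- the inner integrand
  set J : ℝ → ℂ := fun u => B (T (cutLp hf (n + u))) (cutLp hg (n - u)) with hJ
  have hJc : Continuous J := by
    have h1 : Continuous fun u : ℝ => cutLp hf (n + u) := hcf.comp (by fun_prop)
    have h2 : Continuous fun u : ℝ => cutLp hg (n - u) := hcg.comp (by fun_prop)
    exact (B.continuous.comp (T.continuous.comp h1)).clm_apply h2
  have hin : ∀ u : ℝ, ∫ t, (T (Fu u) : ℝ → ℂ) t * (kn q n (t + u) * g t) ∂muplus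
      = (Set.Ioo (-(n : ℝ)) n).indicator (fun u => ((1 / (2 * n) : ℝ) : ℂ) * J u) u := by
    intro u
    by_cases hu : u ∈ Set.Ioo (-(n : ℝ)) n
    · rw [Set.indicator_of_mem hu]
      have e1 : Fu u = cp • cutLp hf (n + u) := by
        apply Lp.ext
        filter_upwards [hFu u, Lp.coeFn_smul cp (cutLp hf (n + u)), cutLp_coe hf (n + u), hpos]
          with t h1 h2 h3 h4
        rw [h1, h2, Pi.smul_apply, h3]
        have : t - u ∈ Set.Icc (-(n : ℝ)) n ↔ t ≤ n + u := by
          simp only [Set.mem_Icc]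
          constructor
          · intro h; linarith [h.2]
          · intro h; constructor <;> linarith [hu.2]
        by_cases h : t ≤ n + u <;> simp [kn, this, h, Set.indicator_apply, hcp]
      have e2 : ((cq • cutLp hg (n - u) : Lp ℂ (ENNReal.ofReal q) muplus) : ℝ → ℂ)
          =ᵐ[muplus] fun t => kn q n (t + u) * g t := by
        filter_upwards [Lp.coeFn_smul cq (cutLp hg (n - u)), cutLp_coe hg (n - u), hpos]
          with t h2 h3 h4
        rw [h2, Pi.smul_apply, h3]
        have : t + u ∈ Set.Icc (-(n : ℝ)) n ↔ t ≤ n - u := by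
          simp only [Set.mem_Icc]
          constructor
          · intro h; linarith [h.2]
          · intro h; constructor <;> linarith [hu.1]
        by_cases h : t ≤ n - u <;> simp [kn, this, h, Set.indicator_apply, hcq]
      rw [hBint _ _ _ e2, e1, ← hcc, hJ]
      simp only [map_smul, ContinuousLinearMap.smul_apply, smul_eq_mul]
      ring
    · rw [Set.indicator_of_notMem hu]
      by_cases hu' : u < n
      · have hu2 : u ≤ -n := by
          by_contra hh
          exact hu ⟨not_le.mp hh, hu'⟩
        have e1 : Fu u = 0 := by
          apply Lp.ext
          filter_upwards [hFu u, Lp.coeFn_zero ℂ (ENNReal.ofReal p) muplus, hpos] with t h1 h2 h3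
          rw [h1, h2]
          have : ¬ (t - u ≤ n) := by linarith
          simp [kn, this]
        rw [e1, map_zero]
        rw [integral_eq_zero_of_ae]
        filter_upwards [Lp.coeFn_zero ℂ (ENNReal.ofReal p) muplus] with t h2
        rw [h2]; simp
      · rw [integral_eq_zero_of_ae]
        filter_upwards [hpos] with t h3
        have : ¬ (t + u ≤ n) := by linarith
        simp [kn, this]
  have hI : ∫ u : ℝ, ∫ t, (T (Fu u) : ℝ → ℂ) t * (kn q n (t + u) * g t) ∂muplus
      = ∫ u in Set.Ioo (-(n : ℝ)) n, ((1 / (2 * n) : ℝ) : ℂ) * J u := by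
    rw [← integral_indicator measurableSet_Ioo]
    exact integral_congr_ae (Filter.Eventually.of_forall hin)
  have hI0 : ∫ t, (T F : ℝ → ℂ) t * g t ∂muplus
      = ∫ u in Set.Ioo (-(n : ℝ)) n, ((1 / (2 * n) : ℝ) : ℂ) * B (T F) G := by
    rw [hBint _ G g hg.coeFn_toLp, setIntegral_const]
    have : volume.real (Set.Ioo (-(n : ℝ)) n) = 2 * n := by
      rw [Real.volume_real_Ioo_of_le (by linarith)]; ring
    rw [this, Complex.real_smul, ← mul_assoc, ← Complex.ofReal_mul, mul_one_div_cancel (by positivity)]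
    simp
  have hint : IntegrableOn (fun u => ((1 / (2 * n) : ℝ) : ℂ) * J u) (Set.Ioo (-(n : ℝ)) n) := by
    have : Continuous (fun u => ((1 / (2 * n) : ℝ) : ℂ) * J u) := continuous_const.mul hJc
    exact (this.integrableOn_Icc).mono_set Set.Ioo_subset_Icc_self
  have hint0 : IntegrableOn (fun _ : ℝ => ((1 / (2 * n) : ℝ) : ℂ) * B (T F) G)
      (Set.Ioo (-(n : ℝ)) n) :=
    (continuous_const.integrableOn_Icc).mono_set Set.Ioo_subset_Icc_self
  rw [hI, hI0, ← integral_sub hint0 hint]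
  set nf := (eLpNorm f (ENNReal.ofReal p) muplus).toReal with hnf
  set ng := (eLpNorm g (ENNReal.ofReal q) muplus).toReal with hng
  have hF' : ‖F‖ ≤ nf := by rw [hFe, Lp.norm_toLp]
  have hG' : ‖G‖ ≤ ng := by rw [hG, Lp.norm_toLp]
  have hnf0 : 0 ≤ nf := ENNReal.toReal_nonneg
  have hng0 : 0 ≤ ng := ENNReal.toReal_nonneg
  have hb : ∀ X Y, ‖X‖ ≤ nf → ‖Y‖ ≤ ng → ‖B (T X) Y‖ ≤ ‖T‖ * nf * ng := by
    intro X Y hX hY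
    refine (pair_norm_le _ _).trans ?_
    gcongr
    exact T.le_opNorm_of_le hX
  set U : Set ℝ := Set.Ioo (-(n : ℝ)) (r - n) ∪ Set.Ioo (n - r) n with hU
  set D : ℝ → ℂ := fun u => ((1 / (2 * n) : ℝ) : ℂ) * B (T F) G - ((1 / (2 * n) : ℝ) : ℂ) * J u
    with hD
  have hDb : ∀ u, ‖D u‖ ≤ (1 / n) * (‖T‖ * nf * ng) := by
    intro u
    have h1 := hb F G hF' hG'
    have h2 : ‖J u‖ ≤ ‖T‖ * nf * ng := hb _ _ (cutLp_norm_le _ _) (cutLp_norm_le _ _)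
    have h3 : ‖B (T F) G - J u‖ ≤ 2 * (‖T‖ * nf * ng) := (norm_sub_le _ _).trans (by linarith)
    rw [hD]
    simp only
    rw [← mul_sub, norm_mul, Complex.norm_real, Real.norm_of_nonneg (by positivity)]
    calc _ ≤ 1 / (2 * (n : ℝ)) * (2 * (‖T‖ * nf * ng)) := by gcongr
      _ = _ := by field_simp
  have hDz : ∀ u ∈ Set.Ioo (-(n : ℝ)) n \ (Set.Ioo (-(n : ℝ)) n ∩ U), D u = 0 := by
    rintro u ⟨hu, hu2⟩
    have h1 : r - n ≤ u := by
      by_contra hh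
      exact hu2 ⟨hu, Or.inl ⟨hu.1, not_le.mp hh⟩⟩
    have h2 : u ≤ n - r := by
      by_contra hh
      exact hu2 ⟨hu, Or.inr ⟨not_le.mp hh, hu.2⟩⟩
    simp only [hD, hJ]
    rw [cutLp_eq hf (r := r) (by linarith) hfs, cutLp_eq hg (r := r) (by linarith) hgs, ← hFe, ← hG,
      sub_self]
  have hmU : MeasurableSet U := measurableSet_Ioo.union measurableSet_Ioo
  have hvol : volume (Set.Ioo (-(n : ℝ)) n ∩ U) ≤ ENNReal.ofReal (2 * r) := by
    refine (measure_mono Set.inter_subset_right).trans ((measure_union_le _ _).trans ?_)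
    rw [Real.volume_Ioo, Real.volume_Ioo, ← ENNReal.ofReal_add (by linarith) (by linarith)]
    apply ENNReal.ofReal_le_ofReal
    linarith
  have hred : ∫ u in Set.Ioo (-(n : ℝ)) n, D u = ∫ u in Set.Ioo (-(n : ℝ)) n ∩ U, D u :=
    setIntegral_eq_of_subset_of_forall_sdiff_eq_zero measurableSet_Ioo
      Set.inter_subset_left hDz
  rw [hred]
  refine (norm_setIntegral_le_of_norm_le_const (hvol.trans_lt ENNReal.ofReal_lt_top)
    (fun u _ => hDb u)).trans ?_
  have hv : volume.real (Set.Ioo (-(n : ℝ)) n ∩ U) ≤ 2 * r :=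
    ENNReal.toReal_le_of_le_ofReal (by positivity) hvol
  calc _ ≤ (1 / n) * (‖T‖ * nf * ng) * (2 * r) := by gcongr
    _ = _ := by ring
end

section
/- A function F : (0,∞) → ℂ belongs to A₂(ℝ₊) if and only if there exists h ∈ L¹(ℝ) whose Fourier transform 𝓕h vanishes on (−∞,0) and such that F(u) = (𝓕h)(u) for all u > 0; moreover in this case ‖F‖_{A₂} = ‖h‖_{L¹(ℝ)}. In other words, the map h ↦ (𝓕h)|_{(0,∞)} is an isometric isomorphism from the Hardy space H¹(ℝ) onto A₂(ℝ₊). -/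
open scoped ENNReal FourierTransform
open MeasureTheory

/-- `(f, g)` is an `A₂(ℝ₊)`-representation of `F`: `F = Σ_n f_n ∗ g_n` on `(0,∞)` with
`Σ_n ‖f_n‖₂ ‖g_n‖₂ < ∞`. -/
def A2Rep (F : ℝ → ℂ) (f g : ℕ → Lp ℂ 2 muplus) : Prop :=
  (Summable fun n => ‖f n‖ * ‖g n‖) ∧
  ∀ u : ℝ, 0 < u →
    F u = ∑' n : ℕ, ∫ t in Set.Ioo 0 u, (f n : ℝ → ℂ) (u - t) * (g n : ℝ → ℂ) t

/-- The set of sums `Σ_n ‖f_n‖₂‖g_n‖₂` over all `A₂`-representations of `F`;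
its infimum is the `A₂`-norm of `F`. -/
def A2NormSet (F : ℝ → ℂ) : Set ℝ :=
  {c : ℝ | ∃ f g : ℕ → Lp ℂ 2 muplus, A2Rep F f g ∧ c = ∑' n : ℕ, ‖f n‖ * ‖g n‖}



namespace A2H1

open scoped ContDiff SchwartzMap
open Complex (I)
open Real (fourierChar)
open scoped FourierTransform

/-- Membership in the Hardy space `H¹`. -/
def IsH1 (φ : ℝ → ℂ) : Prop := Integrable φ ∧ ∀ ξ : ℝ, ξ < 0 → 𝓕 φ ξ = 0

noncomputable abbrev L2 := Lp ℂ 2 (volume : Measure ℝ)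
noncomputable abbrev L1 := Lp ℂ 1 (volume : Measure ℝ)

/-- Pointwise product `L² × L² → L¹`. -/
noncomputable def prodL : L2 →L[ℂ] L2 →L[ℂ] L1 :=
  (ContinuousLinearMap.mul ℂ ℂ).holderL volume 2 2 1

lemma coeFn_prodL (a b : L2) : prodL a b =ᵐ[volume] fun x => a x * b x :=
  (ContinuousLinearMap.mul ℂ ℂ).coeFn_holder a b

lemma norm_prodL_le (a b : L2) : ‖prodL a b‖ ≤ ‖a‖ * ‖b‖ := by
  have h := (ContinuousLinearMap.mul ℂ ℂ).norm_holder_apply_apply_le (r := 1) (μ := volume) a b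
  have h1 : ‖ContinuousLinearMap.mul ℂ ℂ‖ ≤ 1 := ContinuousLinearMap.opNorm_mul_le ℂ ℂ
  refine h.trans ?_
  calc _ ≤ 1 * ‖a‖ * ‖b‖ := by gcongr
    _ = _ := by ring

lemma integrable_mul_L2 (a b : L2) : Integrable (fun x => a x * b x) :=
  (L1.integrable_coeFn (prodL a b)).congr (coeFn_prodL a b)

/-- Fourier transform on `L¹` evaluated at a point. -/
noncomputable def FT (u : ℝ) : L1 →L[ℂ] ℂ :=
  (BoundedContinuousFunction.evalCLM ℂ u) ∘L (Real.Lp.fourierTransformCLM ℝ ℂ)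

lemma FT_apply (u : ℝ) (c : L1) : FT u c = 𝓕 (c : ℝ → ℂ) u := rfl

lemma FT_prodL (u : ℝ) (a b : L2) : FT u (prodL a b) = 𝓕 (fun x => a x * b x) u := by
  rw [FT_apply]
  exact Real.fourier_congr_ae (coeFn_prodL a b) u

lemma fourier_continuous {h : ℝ → ℂ} (hh : Integrable h) : Continuous (𝓕 h) :=
  VectorFourier.fourierIntegral_continuous Real.continuous_fourierChar
    (innerSL ℝ).continuous₂ hh

lemma fourier_norm_le (h : ℝ → ℂ) (u : ℝ) : ‖𝓕 h u‖ ≤ ∫ x, ‖h x‖ := by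
  rw [Real.fourier_eq]
  refine (norm_integral_le_integral_norm _).trans ?_
  simp_rw [Circle.norm_smul]; rfl

lemma IsH1.zero {φ : ℝ → ℂ} (h : IsH1 φ) : 𝓕 φ 0 = 0 := by
  have hc := (fourier_continuous h.1).tendsto 0
  have h1 : Filter.Tendsto (𝓕 φ) (nhdsWithin 0 (Set.Iio 0)) (nhds (𝓕 φ 0)) :=
    hc.mono_left nhdsWithin_le_nhds
  refine tendsto_nhds_unique (h1.congr' ?_) tendsto_const_nhds
  filter_upwards [self_mem_nhdsWithin] with ξ hξ using h.2 ξ hξ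

lemma IsH1.le {φ : ℝ → ℂ} (h : IsH1 φ) {ξ : ℝ} (hξ : ξ ≤ 0) : 𝓕 φ ξ = 0 := by
  rcases hξ.lt_or_eq with h1 | rfl
  exacts [h.2 _ h1, h.zero]

lemma IsH1.congr {φ ψ : ℝ → ℂ} (h : IsH1 φ) (e : φ =ᵐ[volume] ψ) : IsH1 ψ :=
  ⟨h.1.congr e, fun ξ hξ => by rw [← Real.fourier_congr_ae e]; exact h.2 ξ hξ⟩

/-- multiplication formula for `L¹` functions -/
lemma integral_fourier_mul {f g : ℝ → ℂ} (hf : Integrable f) (hg : Integrable g) :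
    ∫ x, 𝓕 f x * g x = ∫ x, f x * 𝓕 g x := by
  simpa using! VectorFourier.integral_fourierIntegral_smul_eq_flip (L := innerₗ ℝ)
    Real.continuous_fourierChar continuous_inner hf hg

/-- Plancherel transform on `L²(ℝ)`. -/
noncomputable def Φ : L2 ≃ₗᵢ[ℂ] L2 := Lp.fourierTransformₗᵢ ℝ ℂ

/-- Schwartz functions as elements of `L²`. -/
noncomputable def iS (f : 𝓢(ℝ, ℂ)) : L2 := f.toLp 2

lemma iS_ae (f : 𝓢(ℝ, ℂ)) : iS f =ᵐ[volume] f := SchwartzMap.coeFn_toLp f 2 volume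

lemma iS_dense : DenseRange iS :=
  SchwartzMap.denseRange_toLpCLM (F := ℂ) (E := ℝ) (μ := volume) (p := 2) ENNReal.ofNat_ne_top

lemma Φ_iS (f : 𝓢(ℝ, ℂ)) : Φ (iS f) = iS (𝓕 f) := SchwartzMap.toLp_fourier_eq f

lemma FT_zero_prodL (a b : L2) : FT 0 (prodL a b) = ∫ x, a x * b x := by
  simp only [FT_prodL,
        Real.fourier_real_eq, mul_zero, neg_zero, AddChar.map_zero_eq_one, one_smul]

/-- multiplication formula for `L²` functions against Schwartz functions -/
lemma integral_fourier_mul_L2 (a : L2) (g : 𝓢(ℝ, ℂ)) :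
    ∫ x, (Φ a) x * g x = ∫ x, a x * (𝓕 g : 𝓢(ℝ, ℂ)) x := by
  have key : FT 0 (prodL (Φ a) (iS g)) = FT 0 (prodL a (iS (𝓕 g))) := by
    refine DenseRange.induction_on
      (p := fun a : L2 => FT 0 (prodL (Φ a) (iS g)) = FT 0 (prodL a (iS (𝓕 g))))
      iS_dense a ?_ ?_
    · apply isClosed_eq
      · exact (FT 0).continuous.comp ((prodL.flip (iS g)).continuous.comp Φ.continuous)
      · exact (FT 0).continuous.comp ((prodL.flip (iS (𝓕 g))).continuous)
    · intro f
      rw [Φ_iS, FT_zero_prodL, FT_zero_prodL]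
      have h1 := SchwartzMap.integral_fourier_mul_eq f g
      refine Eq.trans ?_ (h1.trans ?_)
      · apply integral_congr_ae
        filter_upwards [iS_ae (𝓕 f), iS_ae g] with x h1 h2
        rw [h1, h2]
      · apply integral_congr_ae
        filter_upwards [iS_ae (𝓕 g), iS_ae f] with x h1 h2
        rw [h1, h2]
  rw [FT_zero_prodL, FT_zero_prodL] at key
  refine Eq.trans ?_ (key.trans ?_)
  · apply integral_congr_ae
    filter_upwards [iS_ae g] with x h2
    rw [h2]
  · apply integral_congr_ae
    filter_upwards [iS_ae (𝓕 g)] with x h2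
    rw [h2]

lemma mp_sub (u : ℝ) : MeasurePreserving (fun t : ℝ => u - t) volume volume :=
  Measure.measurePreserving_sub_left volume u

/-- reflection `t ↦ c (u - t)` on `L²` -/
noncomputable def refl (u : ℝ) (c : L2) : L2 := Lp.compMeasurePreserving _ (mp_sub u) c

lemma refl_ae (u : ℝ) (c : L2) : refl u c =ᵐ[volume] fun t => c (u - t) :=
  Lp.coeFn_compMeasurePreserving c (mp_sub u)

lemma refl_cont (u : ℝ) : Continuous (refl u) :=
  (Lp.isometry_compMeasurePreserving (mp_sub u)).continuous

lemma conv_schwartz (f g : 𝓢(ℝ, ℂ)) (u : ℝ) :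
    𝓕 (fun x => f x * g x) u = ∫ t, 𝓕 (f : ℝ → ℂ) (u - t) * 𝓕 (g : ℝ → ℂ) t := by
  have hfi : Integrable (fun x => (fourierChar (-(x * u)) : ℂ) * f x) := by
    have := (Real.fourierIntegral_convergent_iff (μ := volume) (f := f) u).2 f.integrable
    simpa [Circle.smul_def, mul_comm] using this
  have h1 := integral_fourier_mul (((𝓕 g : 𝓢(ℝ, ℂ)).integrable (μ := volume)).comp_neg) hfi
  have h2 : ∀ x : ℝ, 𝓕 (fun x => (𝓕 g : 𝓢(ℝ, ℂ)) (-x)) x = g x := by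
    intro x
    rw [← Real.fourierInv_eq_fourier_comp_neg, ← SchwartzMap.fourierInv_coe]
    simp
  simp_rw [h2] at h1
  rw [Real.fourier_real_eq]
  refine Eq.trans ?_ (h1.trans ?_)
  · refine integral_congr_ae (.of_forall fun x => ?_)
    simp only [Circle.smul_def, smul_eq_mul]; ring
  · rw [← integral_neg_eq_self]
    refine integral_congr_ae (.of_forall fun t => ?_)
    simp only [neg_neg]
    rw [mul_comm, SchwartzMap.fourier_coe]
    congr 1
    rw [Real.fourier_real_eq, Real.fourier_real_eq]
    refine integral_congr_ae (.of_forall fun x => ?_)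
    simp only [Circle.smul_def, smul_eq_mul]
    rw [← mul_assoc, ← Circle.coe_mul, ← AddChar.map_add_eq_mul]
    congr 3; ring

lemma prodL_cont : Continuous (fun p : L2 × L2 => prodL p.1 p.2) :=
  (prodL.continuous.comp continuous_fst).clm_apply continuous_snd

lemma cont_aux1 (u : ℝ) : Continuous (fun p : L2 × L2 => FT u (prodL p.1 p.2)) :=
  Continuous.comp (g := fun c : L1 => FT u c) (f := fun p : L2 × L2 => prodL p.1 p.2)
    (FT u).continuous prodL_cont

lemma cont_aux2 (u : ℝ) :
    Continuous (fun p : L2 × L2 => FT 0 (prodL (refl u (Φ p.1)) (Φ p.2))) :=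
  Continuous.comp (g := fun p : L2 × L2 => FT 0 (prodL p.1 p.2))
    (f := fun p : L2 × L2 => (refl u (Φ p.1), Φ p.2)) (cont_aux1 0)
    (Continuous.prodMk ((refl_cont u).comp (Φ.continuous.comp continuous_fst))
      (Φ.continuous.comp continuous_snd))

/-- convolution theorem -/
lemma conv_thm (a b : L2) (u : ℝ) :
    𝓕 (fun x => a x * b x) u = ∫ t, (Φ a) (u - t) * (Φ b) t := by
  have key : FT u (prodL a b) = FT 0 (prodL (refl u (Φ a)) (Φ b)) := by
    refine DenseRange.induction_on₂
      (p := fun a b : L2 => FT u (prodL a b) = FT 0 (prodL (refl u (Φ a)) (Φ b)))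
      iS_dense ?_ ?_ a b
    · exact isClosed_eq (cont_aux1 u) (cont_aux2 u)
    · intro f g
      rw [FT_zero_prodL, FT_prodL, Φ_iS, Φ_iS]
      have e1 : (fun x => iS f x * iS g x) =ᵐ[volume] fun x => f x * g x := by
        filter_upwards [iS_ae f, iS_ae g] with x h1 h2
        rw [h1, h2]
      rw [Real.fourier_congr_ae e1, conv_schwartz]
      apply integral_congr_ae
      filter_upwards [refl_ae u (iS (𝓕 f)), iS_ae (𝓕 g),
        (mp_sub u).quasiMeasurePreserving.ae_eq_comp (iS_ae (𝓕 f))] with t h1 h2 h3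
      rw [h1, h2]
      simp only [Function.comp_apply] at h3
      rw [h3]; rfl
  rw [FT_zero_prodL, FT_prodL] at key
  rw [key]
  apply integral_congr_ae
  filter_upwards [refl_ae u (Φ a)] with t ht
  rw [ht]


lemma fourier_injective {f g : ℝ → ℂ} (hf : Integrable f) (hg : Integrable g)
    (h : ∀ ξ, 𝓕 f ξ = 𝓕 g ξ) : f =ᵐ[volume] g := by
  refine ae_eq_of_integral_contDiff_smul_eq hf.locallyIntegrable hg.locallyIntegrable ?_
  intro k k1 k2
  have c1 : ContDiff ℝ ∞ (fun x => (k x : ℂ)) := Complex.ofRealCLM.contDiff.comp k1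
  have c2 : HasCompactSupport (fun x => (k x : ℂ)) := k2.comp_left (g := Complex.ofReal) rfl
  set G : 𝓢(ℝ, ℂ) := c2.toSchwartzMap c1 with hG
  have e : ∀ f : ℝ → ℂ, Integrable f → ∫ x, k x • f x = ∫ x, 𝓕 f x * (𝓕⁻ G : 𝓢(ℝ, ℂ)) x := by
    intro f hf
    rw [integral_fourier_mul hf ((𝓕⁻ G : 𝓢(ℝ, ℂ)).integrable (μ := volume))]
    refine integral_congr_ae (.of_forall fun x => ?_)
    have : 𝓕 ((𝓕⁻ G : 𝓢(ℝ, ℂ)) : ℝ → ℂ) x = G x := by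
      rw [← SchwartzMap.fourier_coe]; simp
    simp only [this]
    simp [hG, mul_comm]
  rw [e f hf, e g hg]
  simp only [h]

/-- `r x = 1 / (1 - 2 π i x)` -/
noncomputable def r (x : ℝ) : ℂ := (1 - 2 * Real.pi * I * x)⁻¹

lemma den_ne (x : ℝ) : (1 - 2 * Real.pi * I * x : ℂ) ≠ 0 := by
  intro h
  have := congrArg Complex.re h
  simp at this

lemma r_ne (x : ℝ) : r x ≠ 0 := inv_ne_zero (den_ne x)

lemma r_cont : Continuous r := by
  unfold r
  exact Continuous.inv₀ (by fun_prop) den_ne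

lemma normSq_den (x : ℝ) :
    Complex.normSq (1 - 2 * Real.pi * I * x : ℂ) = 1 + 4 * Real.pi ^ 2 * x ^ 2 := by
  simp [Complex.normSq_apply]; ring

lemma r_norm_le (x : ℝ) : ‖r x‖ ≤ 1 := by
  unfold r
  rw [norm_inv]
  apply inv_le_one_of_one_le₀
  have := Complex.re_le_norm (1 - 2 * Real.pi * I * x : ℂ)
  simpa using this

lemma r_integral (x : ℝ) :
    ∫ t in Set.Ioi (0:ℝ), (Real.exp (-t) : ℂ) * (fourierChar (x * t) : ℂ) = r x := by
  have h := integral_exp_mul_complex_Ioi (a := -(1 - 2 * Real.pi * I * x : ℂ)) (by simp) 0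
  rw [← neg_div_neg_eq] at h
  simp only [Complex.ofReal_zero, mul_zero, Complex.exp_zero, neg_neg, one_div] at h
  rw [r, ← h]
  refine integral_congr_ae (.of_forall fun t => ?_)
  simp only [Real.fourierChar_apply]
  rw [Complex.ofReal_exp, ← Complex.exp_add]
  congr 1
  push_cast; ring

lemma integrable_r_mul {φ : ℝ → ℂ} (h : Integrable φ) : Integrable (fun x => r x * φ x) :=
  h.bdd_mul (c := 1) r_cont.aestronglyMeasurable (.of_forall r_norm_le)

lemma fourier_r_mul {φ : ℝ → ℂ} (h : Integrable φ) (ξ : ℝ) :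
    𝓕 (fun x => r x * φ x) ξ = ∫ t in Set.Ioi (0:ℝ), (Real.exp (-t) : ℂ) * 𝓕 φ (ξ - t) := by
  have hprodint : Integrable (fun p : ℝ × ℝ => (fourierChar (-(p.1 * (ξ - p.2))) : ℂ) *
      (φ p.1 * (Real.exp (-p.2) : ℂ))) (volume.prod (volume.restrict (Set.Ioi 0))) := by
    refine Integrable.bdd_mul (c := 1) ?_ ?_ ?_
    · refine Integrable.mul_prod (f := φ) (g := fun t : ℝ => (Real.exp (-t) : ℂ)) h ?_
      exact (integrableOn_exp_neg_Ioi 0).ofReal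
    · apply Continuous.aestronglyMeasurable
      exact continuous_subtype_val.comp (Real.continuous_fourierChar.comp (by fun_prop))
    · exact .of_forall fun _ => (Circle.norm_coe _).le
  have hs := integral_integral_swap (f := fun x t => (fourierChar (-(x * (ξ - t))) : ℂ) *
      (φ x * (Real.exp (-t) : ℂ))) hprodint
  rw [Real.fourier_real_eq]
  refine Eq.trans ?_ (hs.trans ?_)
  · refine integral_congr_ae (.of_forall fun x => ?_)
    simp only [Circle.smul_def, smul_eq_mul]
    rw [← r_integral x]
    rw [← integral_mul_const, ← integral_const_mul]
    refine integral_congr_ae (.of_forall fun t => ?_)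
    have : (fourierChar (-(x * (ξ - t))) : ℂ)
        = (fourierChar (-(x * ξ)) : ℂ) * (fourierChar (x * t) : ℂ) := by
      rw [← Circle.coe_mul, ← AddChar.map_add_eq_mul]
      congr 2; ring
    simp only [this]; ring
  · refine integral_congr_ae (.of_forall fun t => ?_)
    simp only [Real.fourier_real_eq, Circle.smul_def, smul_eq_mul]
    rw [← integral_const_mul]
    refine integral_congr_ae (.of_forall fun x => ?_)
    ring

lemma IsH1.r_mul {φ : ℝ → ℂ} (h : IsH1 φ) : IsH1 (fun x => r x * φ x) := by
  refine ⟨integrable_r_mul h.1, fun ξ hξ => ?_⟩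
  rw [fourier_r_mul h.1]
  refine setIntegral_eq_zero_of_forall_eq_zero fun t ht => ?_
  rw [h.2 _ (by have : 0 < t := ht; linarith), mul_zero]

/-- the character `x ↦ exp (2 π i l x)` -/
noncomputable def ec (l x : ℝ) : ℂ := (fourierChar (x * l) : ℂ)

lemma ec_cont (l : ℝ) : Continuous (ec l) :=
  continuous_subtype_val.comp (Real.continuous_fourierChar.comp (by fun_prop))

lemma ec_norm (l x : ℝ) : ‖ec l x‖ = 1 := Circle.norm_coe _

lemma integrable_ec_mul {φ : ℝ → ℂ} (l : ℝ) (h : Integrable φ) :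
    Integrable (fun x => ec l x * φ x) :=
  h.bdd_mul (c := 1) (ec_cont l).aestronglyMeasurable (.of_forall fun x => (ec_norm l x).le)

lemma fourier_ec_mul (φ : ℝ → ℂ) (l ξ : ℝ) : 𝓕 (fun x => ec l x * φ x) ξ = 𝓕 φ (ξ - l) := by
  rw [Real.fourier_real_eq, Real.fourier_real_eq]
  refine integral_congr_ae (.of_forall fun x => ?_)
  simp only [Circle.smul_def, smul_eq_mul, ec]
  rw [← mul_assoc, ← Circle.coe_mul, ← AddChar.map_add_eq_mul]
  congr 3; ring

lemma IsH1.ec_mul {φ : ℝ → ℂ} (h : IsH1 φ) {l : ℝ} (hl : 0 ≤ l) :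
    IsH1 (fun x => ec l x * φ x) := by
  refine ⟨integrable_ec_mul l h.1, fun ξ hξ => ?_⟩
  rw [fourier_ec_mul, h.2 _ (by linarith)]

lemma fourier_sub {f g : ℝ → ℂ} (hf : Integrable f) (hg : Integrable g) (ξ : ℝ) :
    𝓕 (fun x => f x - g x) ξ = 𝓕 f ξ - 𝓕 g ξ := by
  rw [Real.fourier_real_eq, Real.fourier_real_eq, Real.fourier_real_eq, ← integral_sub]
  · simp only [smul_sub]
  · simpa [mul_comm] using (Real.fourierIntegral_convergent_iff (μ := volume) (f := f) ξ).2 hf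
  · simpa [mul_comm] using (Real.fourierIntegral_convergent_iff (μ := volume) (f := g) ξ).2 hg

lemma fourier_const_mul (c : ℂ) (f : ℝ → ℂ) (ξ : ℝ) :
    𝓕 (fun x => c * f x) ξ = c * 𝓕 f ξ := by
  rw [Real.fourier_real_eq, Real.fourier_real_eq, ← integral_const_mul]
  refine integral_congr_ae (.of_forall fun x => ?_)
  simp only [Circle.smul_def, smul_eq_mul]; ring

lemma IsH1.const_mul {φ : ℝ → ℂ} (h : IsH1 φ) (c : ℂ) : IsH1 (fun x => c * φ x) :=
  ⟨h.1.const_mul c, fun ξ hξ => by rw [fourier_const_mul, h.2 ξ hξ, mul_zero]⟩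

lemma IsH1.sub {φ ψ : ℝ → ℂ} (h : IsH1 φ) (h' : IsH1 ψ) : IsH1 (fun x => φ x - ψ x) :=
  ⟨h.1.sub h'.1, fun ξ hξ => by rw [fourier_sub h.1 h'.1, h.2 ξ hξ, h'.2 ξ hξ, sub_zero]⟩

/-- `z = 1 - 2 r` -/
noncomputable def z (x : ℝ) : ℂ := 1 - 2 * r x

lemma IsH1.z_mul {φ : ℝ → ℂ} (h : IsH1 φ) : IsH1 (fun x => z x * φ x) := by
  refine (h.sub (h.r_mul.const_mul 2)).congr (.of_forall fun x => ?_)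
  simp only [z]; ring

lemma z_cont : Continuous z := by
  unfold z; have := r_cont; fun_prop

lemma z_eq (x : ℝ) : z x * (starRingEnd ℂ) (r x) = - r x := by
  have h1 := den_ne x
  have h2 : (1 + 2 * Real.pi * I * x : ℂ) ≠ 0 := by
    have := den_ne (-x); simpa using this
  have h3 : (starRingEnd ℂ) (r x) = (1 + 2 * Real.pi * I * x : ℂ)⁻¹ := by
    simp [r, Complex.conj_ofNat]
  rw [h3, z, r]
  field_simp
  ring

lemma z_norm (x : ℝ) : ‖z x‖ = 1 := by
  have h := congrArg norm (z_eq x)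
  rw [norm_mul, RCLike.norm_conj, norm_neg] at h
  exact mul_right_cancel₀ (norm_ne_zero_iff.2 (r_ne x)) (by rw [h, one_mul])

/-- Key lemma: `A ∈ L²` and `r A ∈ H¹` imply `A ∈ H²`. -/
lemma mem_H2 (A : L2) (h : IsH1 (fun x => r x * A x)) : ∀ᵐ ξ, ξ ∈ Set.Iio (0:ℝ) → (Φ A) ξ = 0 := by
  refine IsOpen.ae_eq_zero_of_integral_contDiff_smul_eq_zero isOpen_Iio ?_ ?_
  · exact ((Lp.memLp (Φ A)).locallyIntegrable (by norm_num)).locallyIntegrableOn _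
  intro k k1 k2 k3
  have c1 : ContDiff ℝ ∞ (fun x => (k x : ℂ)) := Complex.ofRealCLM.contDiff.comp k1
  have c2 : HasCompactSupport (fun x => (k x : ℂ)) := k2.comp_left (g := Complex.ofReal) rfl
  set kc : ℝ → ℂ := fun x => (k x : ℂ) with hkc
  set G : 𝓢(ℝ, ℂ) := c2.toSchwartzMap c1 with hG
  have hGk : (G : ℝ → ℂ) = kc := rfl
  have e1 : ∫ x, k x • (Φ A) x = ∫ x, A x * (𝓕 G : 𝓢(ℝ, ℂ)) x := by
    rw [← integral_fourier_mul_L2]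
    refine integral_congr_ae (.of_forall fun x => ?_)
    simp [hGk, hkc, mul_comm]
  have ik : Integrable kc := c1.continuous.integrable_of_hasCompactSupport c2
  have ik' : Integrable (deriv kc) :=
    (c1.continuous_deriv (by simp)).integrable_of_hasCompactSupport c2.deriv
  have hd := Real.fourier_deriv ik (c1.differentiable (by simp)) ik'
  have e2 : ∀ x, A x * (𝓕 G : 𝓢(ℝ, ℂ)) x =
      (r x * A x) * 𝓕 (fun t => kc t - deriv kc t) x := by
    intro x
    rw [fourier_sub ik ik', hd, SchwartzMap.fourier_coe, hGk]
    simp only [r, smul_eq_mul]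
    have := den_ne x
    field_simp
  rw [e1]
  simp_rw [e2]
  rw [← integral_fourier_mul h.1 (g := fun t => kc t - deriv kc t) (ik.sub ik')]
  apply integral_eq_zero_of_ae
  refine .of_forall fun ξ => ?_
  rcases lt_or_ge ξ 0 with hξ | hξ
  · simp [h.2 ξ hξ]
  · have n1 : ξ ∉ tsupport kc := by
      intro hm
      have : ξ ∈ tsupport k := tsupport_comp_subset (g := Complex.ofReal) rfl k hm
      exact absurd (k3 this) (by simpa using hξ)
    have n2 : kc ξ = 0 := image_eq_zero_of_notMem_tsupport n1
    have n3 : deriv kc ξ = 0 := by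
      by_contra hne
      exact n1 (support_deriv_subset hne)
    simp [n2, n3]


/-- the Poisson-type kernel `|r|²` -/
noncomputable def pk (x : ℝ) : ℝ := ‖r x‖ ^ 2

lemma pk_eq (x : ℝ) : pk x = (1 + (2 * Real.pi * x) ^ 2)⁻¹ := by
  rw [pk, r, norm_inv, inv_pow, ← Complex.normSq_eq_norm_sq, normSq_den]
  congr 1; ring

lemma pk_pos (x : ℝ) : 0 < pk x := by
  rw [pk_eq]; positivity

lemma pk_cont : Continuous pk := by
  unfold pk; have := r_cont; fun_prop

lemma pk_integrable : Integrable pk := by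
  have h := integrable_inv_one_add_sq.comp_mul_left' (R := 2 * Real.pi) (by positivity)
  refine h.congr (.of_forall fun x => ?_)
  simp only [pk_eq]

lemma conj_r (x : ℝ) : (starRingEnd ℂ) (r x) = r (-x) := by
  simp [r, Complex.conj_ofNat]

lemma r_add_conj (x : ℝ) : r x + r (-x) = 2 * (pk x : ℂ) := by
  have h1 := den_ne x
  have h2 : (1 + 2 * Real.pi * I * x : ℂ) ≠ 0 := by
    have := den_ne (-x); simpa using this
  have h3 : (pk x : ℂ) = r x * r (-x) := by
    rw [← conj_r, Complex.mul_conj, Complex.normSq_eq_norm_sq]; rfl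
  rw [h3]
  simp only [r, Complex.ofReal_neg, mul_neg, sub_neg_eq_add]
  field_simp
  ring

/-- `E ξ = exp (-|ξ|)` -/
noncomputable def Ex (ξ : ℝ) : ℂ := (Real.exp (-|ξ|) : ℂ)

lemma Ex_cont : Continuous Ex := by unfold Ex; fun_prop

lemma Ex_integrable : Integrable Ex := by
  have h1 : IntegrableOn Ex (Set.Ioi 0) := by
    refine IntegrableOn.congr_fun (f := fun t : ℝ => ((Real.exp (-t) : ℝ) : ℂ))
      (integrableOn_exp_neg_Ioi 0).ofReal (fun t ht => ?_) measurableSet_Ioi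
    simp only [Ex, abs_of_pos (Set.mem_Ioi.1 ht)]
  have h2 : IntegrableOn Ex (Set.Iic 0) := by
    refine IntegrableOn.congr_fun (f := fun t : ℝ => ((Real.exp t : ℝ) : ℂ))
      (integrableOn_exp_Iic 0).ofReal (fun t ht => ?_) measurableSet_Iic
    simp only [Ex, abs_of_nonpos (Set.mem_Iic.1 ht), neg_neg]
  rw [← integrableOn_univ, ← Set.Iic_union_Ioi (a := (0:ℝ))]
  exact h2.union h1

lemma fourier_Ex (x : ℝ) : 𝓕 Ex x = 2 * (pk x : ℂ) := by
  have hi : Integrable (fun t => (fourierChar (-(t * x)) : ℂ) * Ex t) := by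
    refine Ex_integrable.bdd_mul (c := 1) ?_ (.of_forall fun _ => (Circle.norm_coe _).le)
    apply Continuous.aestronglyMeasurable
    exact continuous_subtype_val.comp (Real.continuous_fourierChar.comp (by fun_prop))
  rw [Real.fourier_real_eq]
  simp only [Circle.smul_def, smul_eq_mul]
  rw [← intervalIntegral.integral_Iic_add_Ioi (b := (0:ℝ)) hi.integrableOn hi.integrableOn,
    ← r_add_conj]
  congr 1
  · have := integral_comp_neg_Ioi (0:ℝ) (fun t => (fourierChar (-(t * x)) : ℂ) * Ex t)
    rw [neg_zero] at this
    rw [← this, ← r_integral]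
    refine setIntegral_congr_fun measurableSet_Ioi fun t ht => ?_
    simp only [Ex, abs_neg, abs_of_pos (Set.mem_Ioi.1 ht)]
    rw [mul_comm]; congr 3; ring
  · rw [← r_integral]
    refine setIntegral_congr_fun measurableSet_Ioi fun t ht => ?_
    simp only [Ex, abs_of_pos (Set.mem_Ioi.1 ht)]
    rw [mul_comm]; congr 3; ring

lemma fourier_pk (ξ : ℝ) : 𝓕 (fun x => (pk x : ℂ)) ξ = (1 / 2) * Ex ξ := by
  have h1 : 𝓕⁻ Ex = fun x => 2 * (pk x : ℂ) := by
    ext x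
    rw [Real.fourierInv_eq_fourier_neg, fourier_Ex]
    simp [pk_eq]
  have h2 : Integrable (𝓕 Ex) := by
    rw [show 𝓕 Ex = fun x => 2 * (pk x : ℂ) from funext fourier_Ex]
    exact pk_integrable.ofReal.const_mul 2
  have h3 := congrFun (Continuous.fourier_fourierInv_eq Ex_cont Ex_integrable h2) ξ
  rw [h1, fourier_const_mul] at h3
  rw [← h3]; ring

lemma isH1_z_pk : IsH1 (fun x => z x * (pk x : ℂ)) := by
  have hp : Integrable (fun x => (pk x : ℂ)) := pk_integrable.ofReal
  have e : (fun x => z x * (pk x : ℂ)) = fun x => (pk x : ℂ) - 2 * (r x * (pk x : ℂ)) := by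
    ext x; simp only [z]; ring
  rw [e]
  have hr := (integrable_r_mul hp).const_mul 2
  refine ⟨hp.sub hr, fun ξ hξ => ?_⟩
  rw [fourier_sub hp hr, fourier_const_mul, fourier_r_mul hp]
  have h1 : ∫ t in Set.Ioi (0:ℝ), (Real.exp (-t) : ℂ) * 𝓕 (fun x => (pk x : ℂ)) (ξ - t)
      = ∫ t in Set.Ioi (0:ℝ), ((1/2) * (Real.exp ξ : ℂ)) * Complex.exp ((-2:ℂ) * t) := by
    refine setIntegral_congr_fun measurableSet_Ioi fun t ht => ?_
    have ht' : 0 < t := ht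
    simp only [fourier_pk, Ex]
    rw [abs_of_neg (by linarith)]
    have : (Real.exp (-t) : ℂ) * (Real.exp (-(-(ξ - t))) : ℂ)
      = (Real.exp ξ : ℂ) * Complex.exp ((-2:ℂ) * t) := by
      simp only [Complex.ofReal_exp, ← Complex.exp_add]
      congr 1; push_cast; ring
    linear_combination (1/2) * this
  rw [h1, integral_const_mul, integral_exp_mul_complex_Ioi (by simp), fourier_pk, Ex, abs_of_neg hξ]
  simp
  ring

lemma integral_pk : ∫ x, pk x = 1 / 2 := by
  have h := fourier_pk 0
  rw [Real.fourier_real_eq] at h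
  simp [Ex] at h
  rw [integral_complex_ofReal] at h
  have h' : ((∫ x, pk x : ℝ) : ℂ) = ((1/2 : ℝ) : ℂ) := by rw [h]; simp
  exact_mod_cast h'

lemma ode_aux {V : ℝ → ℂ} (hV : Continuous V) {C : ℝ} (hb : ∀ ξ, ‖V ξ‖ ≤ C)
    (h : ∀ ξ ≤ 0, V ξ = 2 * ∫ t in Set.Ioi (0:ℝ), (Real.exp (-t) : ℂ) * V (ξ - t)) :
    ∀ ξ ≤ 0, V ξ = V 0 * (Real.exp ξ : ℂ) := by
  set Y : ℝ → ℂ := fun ξ => (Real.exp ξ : ℂ) * V ξ with hY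
  have Yc : Continuous Y := by fun_prop
  have Yi : ∀ b, IntegrableOn Y (Set.Iic b) := by
    intro b
    refine Integrable.mul_bdd (c := C) ?_ hV.aestronglyMeasurable (.of_forall hb)
    exact (integrableOn_exp_Iic b).ofReal
  set K : ℝ → ℂ := fun ξ => (∫ s in Set.Iic (0:ℝ), Y s) + ∫ s in (0:ℝ)..ξ, Y s with hK
  have KJ : ∀ ξ, K ξ = ∫ s in Set.Iic ξ, Y s := by
    intro ξ
    have := intervalIntegral.integral_Iic_sub_Iic (Yi 0) (Yi ξ)
    simp only [hK, ← this]; ring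
  have hYK : ∀ ξ ≤ 0, Y ξ = 2 * K ξ := by
    intro ξ hξ
    simp only [hY, h ξ hξ]
    rw [KJ ξ]
    have e1 : ∫ s in Set.Iic ξ, Y s = ∫ t in Set.Ioi (0:ℝ), Y (ξ - t) := by
      have := integral_comp_neg_Ioi (-ξ) Y
      rw [neg_neg] at this
      rw [← this]
      have := (measurePreserving_sub_right (volume : Measure ℝ) ξ).setIntegral_preimage_emb
        (MeasurableEquiv.subRight ξ).measurableEmbedding (fun t => Y (-t)) (Set.Ioi (-ξ))
      rw [← this]
      have hp : (fun t => t - ξ) ⁻¹' Set.Ioi (-ξ) = Set.Ioi 0 := by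
        ext t; simp
      rw [hp]
      refine integral_congr_ae (.of_forall fun t => ?_)
      simp
    rw [e1]
    have e2 : ∫ t in Set.Ioi (0:ℝ), Y (ξ - t) =
        (Real.exp ξ : ℂ) * ∫ t in Set.Ioi (0:ℝ), (Real.exp (-t) : ℂ) * V (ξ - t) := by
      rw [← integral_const_mul]
      refine integral_congr_ae (.of_forall fun t => ?_)
      simp only [hY]
      rw [sub_eq_add_neg ξ t, Real.exp_add]; push_cast; ring
    rw [e2]; ring
  have Kd : ∀ x, HasDerivAt K (Y x) x := fun x =>
    ((Yc.integral_hasStrictDerivAt 0 x).hasDerivAt).const_add _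
  have Kc : Continuous K := continuous_iff_continuousAt.2 fun x => (Kd x).continuousAt
  intro ξ hξ
  have hQ : ∀ x, HasDerivAt (fun x : ℝ => (Real.exp (-2 * x) : ℂ) * K x)
      (((-2 * Real.exp (-2 * x) : ℝ) : ℂ) * K x + (Real.exp (-2 * x) : ℂ) * Y x) x := by
    intro x
    refine HasDerivAt.mul ?_ (Kd x)
    have : HasDerivAt (fun x : ℝ => Real.exp (-2 * x)) (-2 * Real.exp (-2 * x)) x := by
      have := ((hasDerivAt_id x).const_mul (-2)).exp
      simpa [mul_comm] using this
    exact this.ofReal_comp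
  have hc := constant_of_has_deriv_right_zero (a := ξ) (b := 0)
    (f := fun x : ℝ => (Real.exp (-2 * x) : ℂ) * K x)
    (by apply Continuous.continuousOn; fun_prop)
    (fun x hx => by
      have := (hQ x).hasDerivWithinAt (s := Set.Ici x)
      convert this using 1
      rw [hYK x hx.2.le]; push_cast; ring) 0 ⟨hξ, le_rfl⟩
  simp at hc
  have y0 := hYK 0 le_rfl
  have y1 := hYK ξ hξ
  simp only [hY, Real.exp_zero, Complex.ofReal_one, one_mul] at y0 y1
  have : V ξ = (Real.exp (-ξ) : ℂ) * ((Real.exp ξ : ℂ) * V ξ) := by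
    rw [← mul_assoc, ← Complex.ofReal_mul, ← Real.exp_add]; simp
  rw [this, y1, y0, hc]
  have : Complex.exp (-(2 * ξ)) * (Real.exp ξ : ℂ) = (Real.exp (-ξ) : ℂ) := by
    simp only [Complex.ofReal_exp, ← Complex.exp_add]; congr 1; push_cast; ring
  linear_combination (-2) * K ξ * this

lemma fourier_real_neg (v : ℝ → ℝ) (ξ : ℝ) :
    𝓕 (fun x => (v x : ℂ)) (-ξ) = (starRingEnd ℂ) (𝓕 (fun x => (v x : ℂ)) ξ) := by
  rw [Real.fourier_real_eq, Real.fourier_real_eq, ← integral_conj]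
  refine integral_congr_ae (.of_forall fun x => ?_)
  simp only [Circle.smul_def, smul_eq_mul, map_mul, Complex.conj_ofReal, ← Circle.coe_inv_eq_conj,
    ← AddChar.map_neg_eq_inv]
  congr 3; ring

lemma unique_pk {v : ℝ → ℝ} (hv : Integrable v) (h : IsH1 (fun x => z x * (v x : ℂ))) :
    ∃ c : ℝ, ∀ᵐ x, v x = c * pk x := by
  have hvc : Integrable (fun x => (v x : ℂ)) := hv.ofReal
  set V := 𝓕 (fun x => (v x : ℂ)) with hV
  have h0 : V 0 = ((∫ x, v x : ℝ) : ℂ) := by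
    rw [hV, Real.fourier_real_eq]
    simp only [mul_zero, neg_zero, AddChar.map_zero_eq_one, one_smul]
    exact integral_complex_ofReal
  have key : ∀ ξ ≤ 0, V ξ = V 0 * (Real.exp ξ : ℂ) := by
    refine ode_aux (C := ∫ x, ‖(v x : ℂ)‖) (fourier_continuous hvc) (fun ξ => fourier_norm_le _ ξ) ?_
    intro ξ hξ
    have e : (fun x => z x * (v x : ℂ)) = fun x => (v x : ℂ) - 2 * (r x * (v x : ℂ)) := by
      ext x; simp only [z]; ring
    have := h.le hξ
    rw [e, fourier_sub hvc ((integrable_r_mul hvc).const_mul 2), fourier_const_mul,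
      fourier_r_mul hvc] at this
    exact sub_eq_zero.1 this
  refine ⟨2 * ∫ x, v x, ?_⟩
  have hinj := fourier_injective hvc (pk_integrable.ofReal.const_mul (2 * V 0)) (fun ξ => ?_)
  · filter_upwards [hinj] with x hx
    rw [h0] at hx
    have hx' : (v x : ℂ) = ((2 * (∫ x, v x) * pk x : ℝ) : ℂ) := by
      push_cast; exact hx
    exact Complex.ofReal_injective hx'
  · have e := fourier_const_mul (2 * V 0) (fun x => (pk x : ℂ)) ξ
    refine Eq.trans ?_ e.symm
    rw [fourier_pk, Ex]
    change V ξ = _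
    rcases le_total ξ 0 with hξ | hξ
    · rw [abs_of_nonpos hξ, key ξ hξ]; simp; ring
    · rw [abs_of_nonneg hξ]
      have e1 : V ξ = (starRingEnd ℂ) (V (-ξ)) := by
        have := fourier_real_neg v (-ξ); rwa [neg_neg] at this
      rw [e1, key (-ξ) (by linarith), h0, map_mul, Complex.conj_ofReal, Complex.conj_ofReal]
      ring

lemma nsq (a : L2) : ‖a‖ ^ 2 = ∫ x, ‖a x‖ ^ 2 := by
  have h := inner_self_eq_norm_sq_to_K (𝕜 := ℂ) a
  rw [L2.inner_def] at h
  simp only [inner_self_eq_norm_sq_to_K] at h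
  have h2 : ((∫ x, ‖a x‖ ^ 2 : ℝ) : ℂ) = ((‖a‖ ^ 2 : ℝ) : ℂ) := by
    rw [← integral_complex_ofReal, Complex.ofReal_pow]
    refine Eq.trans ?_ h
    refine integral_congr_ae (.of_forall fun x => ?_)
    simp
  exact (Complex.ofReal_injective h2).symm

lemma outer_exists {s : ℝ → ℝ} (hs : MemLp (fun x => (s x : ℂ)) 2 volume) (hpos : ∀ x, 0 < s x)
    {ε : ℝ} (hε : 0 < ε) (hle : ∀ x, ε * pk x ≤ s x ^ 2) :
    ∃ k : L2, ∃ c : ℝ, 0 < c ∧ (∀ᵐ x, ‖k x‖ ^ 2 = c * pk x) ∧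
      IsH1 (fun x => (starRingEnd ℂ) (k x) * s x * z x) ∧
      ∀ ψ : L2, IsH1 (fun x => ψ x * s x) → IsH1 (fun x => ψ x * k x) := by
  have smeas := hs.aestronglyMeasurable
  have zmeas := z_cont.aestronglyMeasurable (μ := (volume : Measure ℝ))
  have memE : ∀ l : ℝ, MemLp (fun x => (s x : ℂ) * z x * ec l x) 2 volume := by
    intro l
    refine hs.of_le ((smeas.mul zmeas).mul (ec_cont l).aestronglyMeasurable)
      (.of_forall fun x => ?_)
    simp [z_norm, ec_norm]
  set S : L2 := hs.toLp with hS
  have S_ae : S =ᵐ[volume] fun x => (s x : ℂ) := hs.coeFn_toLp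
  set E : ℝ → L2 := fun l => (memE l).toLp with hE
  have E_ae : ∀ l, E l =ᵐ[volume] fun x => (s x : ℂ) * z x * ec l x := fun l =>
    (memE l).coeFn_toLp
  set N : Submodule ℂ L2 := (Submodule.span ℂ (E '' Set.Ici 0)).topologicalClosure with hNdef
  have hN : ∀ T : L2 →L[ℂ] ℂ, (∀ l : ℝ, 0 ≤ l → T (E l) = 0) → ∀ n ∈ N, T n = 0 := by
    intro T hT n hn
    have h1 : N ≤ LinearMap.ker (T : L2 →ₗ[ℂ] ℂ) := by
      refine Submodule.topologicalClosure_minimal _ ?_ T.isClosed_ker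
      rw [Submodule.span_le]
      rintro _ ⟨l, hl, rfl⟩
      exact hT l hl
    exact h1 hn
  have hEN : ∀ l : ℝ, 0 ≤ l → E l ∈ N := fun l hl =>
    Submodule.le_topologicalClosure _ (Submodule.subset_span ⟨l, hl, rfl⟩)
  have : CompleteSpace N := (Submodule.isClosed_topologicalClosure _).completeSpace_coe
  obtain ⟨n, hn, k, hk, hSk⟩ := N.exists_add_mem_mem_orthogonal S
  have S_nk : ∀ᵐ x, (s x : ℂ) = n x + k x := by
    have := Lp.coeFn_add n k
    rw [← hSk] at this
    filter_upwards [this, S_ae] with x h1 h2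
    rw [← h2, h1]; rfl
  have kmeas : AEStronglyMeasurable k volume := Lp.aestronglyMeasurable k
  have claim1 : ∀ ψ : L2, IsH1 (fun x => ψ x * s x) → IsH1 (fun x => ψ x * k x) := by
    intro ψ hψ
    have h1 : IsH1 (fun x => ψ x * n x) := by
      refine ⟨integrable_mul_L2 ψ n, fun ξ hξ => ?_⟩
      rw [← FT_prodL]
      refine hN ((FT ξ) ∘L (prodL ψ)) (fun l hl => ?_) n hn
      change FT ξ (prodL ψ (E l)) = 0
      rw [FT_prodL]
      refine ((hψ.z_mul.ec_mul hl).congr ?_).2 ξ hξ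
      filter_upwards [E_ae l] with x hx
      rw [hx]; ring
    refine (hψ.sub h1).congr ?_
    filter_upwards [S_nk] with x hx
    rw [hx]; ring
  have cmeas : AEStronglyMeasurable (fun x => (starRingEnd ℂ) (k x)) volume :=
    Complex.continuous_conj.comp_aestronglyMeasurable kmeas
  have memc : MemLp (fun x => (starRingEnd ℂ) (k x) * z x) 2 volume := by
    refine (Lp.memLp k).of_le (cmeas.mul zmeas) (.of_forall fun x => ?_)
    simp [z_norm]
  set ψ₀ : L2 := memc.toLp with hψ₀
  have ψ₀_ae : ψ₀ =ᵐ[volume] fun x => (starRingEnd ℂ) (k x) * z x := memc.coeFn_toLp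
  have claim2 : IsH1 (fun x => (starRingEnd ℂ) (k x) * s x * z x) := by
    have hi : Integrable (fun x => (starRingEnd ℂ) (k x) * s x * z x) := by
      refine (integrable_mul_L2 ψ₀ S).congr ?_
      filter_upwards [ψ₀_ae, S_ae] with x h1 h2
      rw [h1, h2]; ring
    refine ⟨hi, fun ξ hξ => ?_⟩
    have h1 := (Submodule.mem_orthogonal' N k).1 hk (E (-ξ)) (hEN _ (by linarith))
    rw [L2.inner_def] at h1
    rw [Real.fourier_real_eq, ← h1]
    refine integral_congr_ae ?_
    filter_upwards [E_ae (-ξ)] with x hx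
    rw [hx]
    simp only [Circle.smul_def, smul_eq_mul, RCLike.inner_apply, ec, mul_neg]
    ring
  have claim3 : IsH1 (fun x => z x * ((‖k x‖ ^ 2 : ℝ) : ℂ)) := by
    have h1 : IsH1 (fun x => ψ₀ x * s x) := by
      refine claim2.congr ?_
      filter_upwards [ψ₀_ae] with x h1
      rw [h1]; ring
    refine (claim1 ψ₀ h1).congr ?_
    filter_upwards [ψ₀_ae] with x h1
    rw [h1, ← Complex.normSq_eq_norm_sq, ← Complex.mul_conj]; ring
  have kint : Integrable (fun x => ‖k x‖ ^ 2) :=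
    (memLp_two_iff_integrable_sq_norm kmeas).1 (Lp.memLp k)
  obtain ⟨c, hc⟩ := unique_pk kint claim3
  have c0 : 0 ≤ c := by
    obtain ⟨x, hx⟩ := hc.exists
    have h1 := pk_pos x
    have h2 : 0 ≤ c * pk x := by rw [← hx]; positivity
    exact nonneg_of_mul_nonneg_left h2 h1
  have c1 : c ≠ 0 := by
    rintro rfl
    have memp : MemLp (fun x => ((pk x / s x : ℝ) : ℂ)) 2 volume := by
      have hsm : AEMeasurable s := by
        have := Complex.measurable_re.comp_aemeasurable smeas.aemeasurable
        exact this
      have hmm : AEStronglyMeasurable (fun x => pk x / s x) volume :=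
        (pk_cont.measurable.aemeasurable.div hsm).aestronglyMeasurable
      refine MemLp.ofReal (f := fun x => pk x / s x) ?_
      rw [memLp_two_iff_integrable_sq hmm]
      refine (pk_integrable.const_mul ε⁻¹).mono' (hmm.pow 2) (.of_forall fun x => ?_)
      have h1 := hpos x
      have h2 := pk_pos x
      have h3 := hle x
      rw [Real.norm_of_nonneg (by positivity), div_pow, div_le_iff₀ (by positivity),
        inv_mul_eq_div, div_mul_eq_mul_div, le_div_iff₀ hε]
      nlinarith
    set ψ : L2 := memp.toLp with hψ
    have ψ_ae : ψ =ᵐ[volume] fun x => ((pk x / s x : ℝ) : ℂ) := memp.coeFn_toLp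
    have hT := hN ((FT 0) ∘L (prodL ψ)) (fun l hl => by
      change FT 0 (prodL ψ (E l)) = 0
      rw [FT_prodL]
      refine ((isH1_z_pk.ec_mul hl).congr ?_).zero
      filter_upwards [ψ_ae, E_ae l] with x h1 h2
      rw [h1, h2]
      have : (s x : ℂ) ≠ 0 := by exact_mod_cast (hpos x).ne'
      push_cast
      field_simp) n hn
    change FT 0 (prodL ψ n) = 0 at hT
    rw [FT_zero_prodL] at hT
    have h2 : ∫ x, ψ x * n x = ∫ x, (pk x : ℂ) := by
      refine integral_congr_ae ?_
      filter_upwards [ψ_ae, S_nk, hc] with x h1 h2 h3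
      have hk0 : k x = 0 := by simpa using h3
      rw [hk0, add_zero] at h2
      have : (s x : ℂ) ≠ 0 := by exact_mod_cast (hpos x).ne'
      rw [h1, ← h2]
      push_cast
      field_simp
    rw [h2, integral_complex_ofReal, integral_pk] at hT
    norm_num at hT
  exact ⟨k, c, lt_of_le_of_ne c0 c1.symm, hc, claim2, claim1⟩

lemma factor {h : ℝ → ℂ} (hh : IsH1 h) {ε : ℝ} (hε : 0 < ε) :
    ∃ A G : L2, (∀ᵐ ξ, ξ ∈ Set.Iio (0:ℝ) → (Φ A) ξ = 0) ∧
      (∀ᵐ ξ, ξ ∈ Set.Iio (0:ℝ) → (Φ G) ξ = 0) ∧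
      (h =ᵐ[volume] fun x => A x * G x) ∧ ‖A‖ * ‖G‖ ≤ (∫ x, ‖h x‖) + ε := by
  set w : ℝ → ℝ := fun x => ‖h x‖ + ε * pk x with hw
  have wpos : ∀ x, 0 < w x := fun x => by have := pk_pos x; positivity
  have wint : Integrable w := hh.1.norm.add (pk_integrable.const_mul ε)
  have wI : ∫ x, w x = (∫ x, ‖h x‖) + ε / 2 := by
    simp only [hw]
    rw [integral_add hh.1.norm (pk_integrable.const_mul ε), integral_const_mul, integral_pk]
    ring
  set s : ℝ → ℝ := fun x => Real.sqrt (w x) with hsdef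
  have spos : ∀ x, 0 < s x := fun x => Real.sqrt_pos.2 (wpos x)
  have ssq : ∀ x, s x ^ 2 = w x := fun x => Real.sq_sqrt (wpos x).le
  have smeas : AEMeasurable s := wint.aestronglyMeasurable.aemeasurable.sqrt
  have hs : MemLp (fun x => (s x : ℂ)) 2 volume := by
    refine MemLp.ofReal ?_
    rw [memLp_two_iff_integrable_sq smeas.aestronglyMeasurable]
    simpa only [ssq] using wint
  obtain ⟨k, c, c0, hc, hk1, hk2⟩ := outer_exists hs spos hε (fun x => by
    rw [ssq]; simp only [hw]; linarith [norm_nonneg (h x)])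
  have hmeas := hh.1.aestronglyMeasurable.aemeasurable
  have kmeas : AEMeasurable k volume := (Lp.aestronglyMeasurable k).aemeasurable
  have rmeas : AEMeasurable r volume := r_cont.measurable.aemeasurable
  have scmeas : AEMeasurable (fun x => (s x : ℂ)) volume := hs.aestronglyMeasurable.aemeasurable
  set d : ℂ := (Real.sqrt c : ℂ) with hd
  have d0 : d ≠ 0 := by
    rw [hd]; exact_mod_cast (Real.sqrt_pos.2 c0).ne'
  have dn : ‖d‖ = Real.sqrt c := by
    rw [hd, Complex.norm_real, Real.norm_of_nonneg (Real.sqrt_nonneg _)]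
  have nk : ∀ᵐ x, ‖k x‖ = Real.sqrt c * ‖r x‖ := by
    filter_upwards [hc] with x hx
    have := congrArg Real.sqrt hx
    rwa [Real.sqrt_sq (norm_nonneg _), Real.sqrt_mul c0.le, pk, Real.sqrt_sq (norm_nonneg _)] at this
  have hle : ∀ x, ‖h x‖ ≤ s x * s x := fun x => by
    rw [← sq, ssq]; simp only [hw]; have := pk_pos x; nlinarith
  have s0 : ∀ x, (s x : ℂ) ≠ 0 := fun x => by exact_mod_cast (spos x).ne'
  have sn : ∀ x, ‖(s x : ℂ)‖ = s x := fun x => by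
    rw [Complex.norm_real, Real.norm_of_nonneg (spos x).le]
  have scp := Real.sqrt_pos.2 c0
  have rp : ∀ x, 0 < ‖r x‖ := fun x => norm_pos_iff.2 (r_ne x)
  have cr0 : ∀ x, (starRingEnd ℂ) (r x) ≠ 0 := fun x => by simpa using r_ne x
  have nA : ∀ᵐ x, ‖h x * k x / (s x * d * r x)‖ ≤ ‖(s x : ℂ)‖ := by
    filter_upwards [nk] with x hx
    have h1 := spos x
    have h2 := rp x
    rw [norm_div, norm_mul, norm_mul, norm_mul, hx, dn, sn, div_le_iff₀ (by positivity)]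
    have := mul_le_mul_of_nonneg_right (hle x) (mul_pos scp h2).le
    nlinarith
  have nG : ∀ᵐ x, ‖(starRingEnd ℂ) (k x) * s x / (d * (starRingEnd ℂ) (r x))‖ ≤ ‖(s x : ℂ)‖ := by
    filter_upwards [nk] with x hx
    have h1 := spos x
    have h2 := rp x
    rw [norm_div, norm_mul, norm_mul, RCLike.norm_conj, RCLike.norm_conj, hx, dn, sn,
      div_le_iff₀ (by positivity)]
    nlinarith
  have memA : MemLp (fun x => h x * k x / (s x * d * r x)) 2 volume :=
    hs.of_le ((hmeas.mul kmeas).div ((scmeas.mul_const d).mul rmeas)).aestronglyMeasurable nA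
  have memG : MemLp (fun x => (starRingEnd ℂ) (k x) * s x / (d * (starRingEnd ℂ) (r x))) 2 volume :=
    hs.of_le (((Complex.continuous_conj.measurable.comp_aemeasurable kmeas).mul scmeas).div
      ((Complex.continuous_conj.measurable.comp_aemeasurable rmeas).const_mul d)).aestronglyMeasurable nG
  have nψ : ∀ x, ‖h x / s x‖ ≤ ‖(s x : ℂ)‖ := fun x => by
    rw [norm_div, sn, div_le_iff₀ (spos x)]; exact hle x
  have memψ : MemLp (fun x => h x / s x) 2 volume :=
    hs.of_le (hmeas.div scmeas).aestronglyMeasurable (.of_forall nψ)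
  have A_ae := memA.coeFn_toLp
  have G_ae := memG.coeFn_toLp
  have ψ_ae := memψ.coeFn_toLp
  have bound : ∀ a : L2, (∀ᵐ x, ‖a x‖ ≤ ‖(s x : ℂ)‖) → ‖a‖ ^ 2 ≤ (∫ x, ‖h x‖) + ε / 2 := by
    intro a ha
    rw [nsq, ← wI]
    refine integral_mono_ae ((memLp_two_iff_integrable_sq_norm
      (Lp.aestronglyMeasurable a)).1 (Lp.memLp a)) wint ?_
    filter_upwards [ha] with x hx
    rw [← ssq]
    rw [sn] at hx
    exact pow_le_pow_left₀ (norm_nonneg _) hx 2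
  refine ⟨memA.toLp, memG.toLp, mem_H2 _ ?_, mem_H2 _ ?_, ?_, ?_⟩
  · have h1 : IsH1 (fun x => (memψ.toLp : L2) x * s x) := by
      refine hh.congr ?_
      filter_upwards [ψ_ae] with x hx
      rw [hx, div_mul_cancel₀ _ (s0 x)]
    refine ((hk2 _ h1).const_mul d⁻¹).congr ?_
    filter_upwards [ψ_ae, A_ae] with x h1 h2
    rw [h1, h2]
    have := s0 x
    have := r_ne x
    field_simp
  · refine (hk1.const_mul (-d⁻¹)).congr ?_
    filter_upwards [G_ae] with x h1
    rw [h1]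
    have e := z_eq x
    have e1 : r x = - (z x * (starRingEnd ℂ) (r x)) := by rw [e, neg_neg]
    rw [show r x * ((starRingEnd ℂ) (k x) * s x / (d * (starRingEnd ℂ) (r x)))
      = - (z x * (starRingEnd ℂ) (r x)) *
        ((starRingEnd ℂ) (k x) * s x / (d * (starRingEnd ℂ) (r x))) by rw [← e1]]
    have := cr0 x
    field_simp
  · filter_upwards [A_ae, G_ae, nk] with x h1 h2 h3
    rw [h1, h2]
    have e1 : k x * (starRingEnd ℂ) (k x) = d ^ 2 * (r x * (starRingEnd ℂ) (r x)) := by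
      rw [Complex.mul_conj, Complex.mul_conj, Complex.normSq_eq_norm_sq,
        Complex.normSq_eq_norm_sq, h3, hd]
      push_cast; ring
    have := s0 x
    have := r_ne x
    have := cr0 x
    rw [div_mul_div_comm, eq_div_iff (by positivity)]
    linear_combination (-(h x * s x)) * e1
  · have b1 := bound (memA.toLp) (by filter_upwards [A_ae, nA] with x h1 h2; rw [h1]; exact h2)
    have b2 := bound (memG.toLp) (by filter_upwards [G_ae, nG] with x h1 h2; rw [h1]; exact h2)
    nlinarith [sq_nonneg (‖(memA.toLp : L2)‖ - ‖(memG.toLp : L2)‖)]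

lemma conv_supp {a b f g : ℝ → ℂ} (ha : a =ᵐ[volume] (Set.Ioi (0:ℝ)).indicator f)
    (hb : b =ᵐ[volume] (Set.Ioi (0:ℝ)).indicator g) (u : ℝ) :
    ∫ t, a (u - t) * b t = ∫ t in Set.Ioo 0 u, f (u - t) * g t := by
  rw [← integral_indicator measurableSet_Ioo]
  refine integral_congr_ae ?_
  have ha' := (mp_sub u).quasiMeasurePreserving.ae ha
  filter_upwards [ha', hb] with t h1 h2
  rw [h1, h2]
  by_cases h3 : 0 < t
  · by_cases h4 : t < u
    · rw [Set.indicator_of_mem (show u - t ∈ Set.Ioi (0:ℝ) by simpa using h4),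
        Set.indicator_of_mem (show t ∈ Set.Ioi (0:ℝ) from h3),
        Set.indicator_of_mem (show t ∈ Set.Ioo 0 u from ⟨h3, h4⟩)]
    · rw [Set.indicator_of_notMem (show u - t ∉ Set.Ioi (0:ℝ) by simpa using h4),
        Set.indicator_of_notMem (show t ∉ Set.Ioo 0 u from fun h => h4 h.2), zero_mul]
  · rw [Set.indicator_of_notMem (show t ∉ Set.Ioi (0:ℝ) from h3),
        Set.indicator_of_notMem (show t ∉ Set.Ioo 0 u from fun h => h3 h.1), mul_zero]

lemma ext_exists (f : Lp ℂ 2 muplus) :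
    ∃ a : L2, a =ᵐ[volume] (Set.Ioi (0:ℝ)).indicator f ∧ ‖a‖ = ‖f‖ := by
  have h1 : MemLp ((Set.Ioi (0:ℝ)).indicator f) 2 volume :=
    (memLp_indicator_iff_restrict measurableSet_Ioi).2 (Lp.memLp f)
  refine ⟨h1.toLp, h1.coeFn_toLp, ?_⟩
  rw [Lp.norm_toLp, eLpNorm_indicator_eq_eLpNorm_restrict measurableSet_Ioi, Lp.norm_def]
  rfl

lemma res_exists (a : L2) (ha : ∀ᵐ ξ, ξ ∈ Set.Iio (0:ℝ) → a ξ = 0) :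
    ∃ f : Lp ℂ 2 muplus, a =ᵐ[volume] (Set.Ioi (0:ℝ)).indicator f ∧ ‖f‖ ≤ ‖a‖ := by
  have h1 : MemLp a 2 muplus := (Lp.memLp a).restrict (Set.Ioi 0)
  refine ⟨h1.toLp, ?_, ?_⟩
  · have h2 := h1.coeFn_toLp
    have h3 : ∀ᵐ x, x ∈ Set.Ioi (0:ℝ) → h1.toLp a x = a x :=
      (ae_restrict_iff' measurableSet_Ioi).1 h2
    have h4 : ∀ᵐ x : ℝ, x ≠ 0 := by simp [ae_iff]
    filter_upwards [ha, h3, h4] with x e1 e2 e3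
    rcases lt_or_gt_of_ne e3 with h | h
    · rw [e1 h, Set.indicator_of_notMem]
      simpa using h.le
    · rw [Set.indicator_of_mem (show x ∈ Set.Ioi (0:ℝ) from h), e2 h]
  · rw [Lp.norm_toLp, Lp.norm_def]
    exact ENNReal.toReal_mono (Lp.eLpNorm_ne_top a) (eLpNorm_mono_measure _ Measure.restrict_le_self)

lemma rep_to_h {F : ℝ → ℂ} {f g : ℕ → Lp ℂ 2 muplus} (hr : A2Rep F f g) :
    ∃ c : L1, (∀ u < 0, FT u c = 0) ∧ (∀ u : ℝ, 0 < u → FT u c = F u) ∧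
      ‖c‖ ≤ ∑' n, ‖f n‖ * ‖g n‖ := by
  choose a ha na using fun n => ext_exists (f n)
  choose b hb nb using fun n => ext_exists (g n)
  have hle : ∀ n, ‖prodL (Φ.symm (a n)) (Φ.symm (b n))‖ ≤ ‖f n‖ * ‖g n‖ := fun n => by
    refine (norm_prodL_le _ _).trans ?_
    rw [LinearIsometryEquiv.norm_map, LinearIsometryEquiv.norm_map, na, nb]
  have hsn : Summable fun n => ‖prodL (Φ.symm (a n)) (Φ.symm (b n))‖ :=
    Summable.of_nonneg_of_le (fun n => norm_nonneg _) hle hr.1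
  have hs : Summable fun n => prodL (Φ.symm (a n)) (Φ.symm (b n)) := hsn.of_norm
  have hFT : ∀ u n, FT u (prodL (Φ.symm (a n)) (Φ.symm (b n))) =
      ∫ t in Set.Ioo 0 u, (f n : ℝ → ℂ) (u - t) * (g n : ℝ → ℂ) t := by
    intro u n
    rw [FT_prodL, conv_thm, LinearIsometryEquiv.apply_symm_apply,
      LinearIsometryEquiv.apply_symm_apply]
    exact conv_supp (ha n) (hb n) u
  refine ⟨∑' n, prodL (Φ.symm (a n)) (Φ.symm (b n)), fun u hu => ?_, fun u hu => ?_, ?_⟩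
  · rw [(FT u).map_tsum hs]
    simp only [hFT, Set.Ioo_eq_empty (show ¬ (0:ℝ) < u by linarith)]
    simp
  · rw [(FT u).map_tsum hs, hr.2 u hu]
    simp only [hFT]
  · exact (norm_tsum_le_tsum_norm hsn).trans (hsn.tsum_le_tsum hle hr.1)

lemma h_to_rep {F h : ℝ → ℂ} (hh : IsH1 h) (hF : ∀ u : ℝ, 0 < u → F u = 𝓕 h u)
    {ε : ℝ} (hε : 0 < ε) : ∃ f g : ℕ → Lp ℂ 2 muplus, A2Rep F f g ∧
      ∑' n, ‖f n‖ * ‖g n‖ ≤ (∫ x, ‖h x‖) + ε := by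
  obtain ⟨A, G, hA, hG, hAG, hn⟩ := factor hh hε
  obtain ⟨f, hf, nf⟩ := res_exists (Φ A) hA
  obtain ⟨g, hg, ng⟩ := res_exists (Φ G) hG
  rw [LinearIsometryEquiv.norm_map] at nf ng
  have hz : ∀ n ≠ 0, ‖(Pi.single 0 f : ℕ → Lp ℂ 2 muplus) n‖ *
      ‖(Pi.single 0 g : ℕ → Lp ℂ 2 muplus) n‖ = 0 := by
    intro n hn0
    rw [Pi.single_eq_of_ne hn0, norm_zero, zero_mul]
  refine ⟨Pi.single 0 f, Pi.single 0 g, ⟨(hasSum_single 0 hz).summable, fun u hu => ?_⟩, ?_⟩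
  · rw [tsum_eq_single 0]
    · rw [Pi.single_eq_same, Pi.single_eq_same, ← conv_supp hf hg u, ← conv_thm, hF u hu]
      exact Real.fourier_congr_ae hAG u
    · intro n hn0
      rw [Pi.single_eq_of_ne hn0, Pi.single_eq_of_ne hn0]
      refine integral_eq_zero_of_ae ?_
      have h0 := Lp.coeFn_zero (E := ℂ) 2 muplus
      have h1 := ae_restrict_of_ae_restrict_of_subset
        (show Set.Ioo 0 u ⊆ Set.Ioi (0:ℝ) from fun t ht => ht.1) h0
      filter_upwards [h1] with t ht
      rw [ht]; simp
  · rw [tsum_eq_single 0 hz, Pi.single_eq_same, Pi.single_eq_same]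
    exact (mul_le_mul nf ng (norm_nonneg _) (norm_nonneg _)).trans hn

lemma norm_le_of_rep {F h : ℝ → ℂ} (hh : IsH1 h) (hF : ∀ u : ℝ, 0 < u → F u = 𝓕 h u)
    {f g : ℕ → Lp ℂ 2 muplus} (hr : A2Rep F f g) :
    ∫ x, ‖h x‖ ≤ ∑' n, ‖f n‖ * ‖g n‖ := by
  obtain ⟨c, c1, c2, c3⟩ := rep_to_h hr
  have ci : Integrable c volume := L1.integrable_coeFn c
  have he : 𝓕 h = 𝓕 (c : ℝ → ℂ) := by
    refine Continuous.ext_on (dense_compl_singleton (0:ℝ)) (fourier_continuous hh.1)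
      (fourier_continuous ci) fun u hu => ?_
    rw [← FT_apply]
    rcases lt_or_gt_of_ne (show u ≠ 0 from hu) with h' | h'
    · rw [hh.2 u h', c1 u h']
    · rw [c2 u h', hF u h']
  have hae := fourier_injective hh.1 ci (fun ξ => congrFun he ξ)
  refine le_trans (le_of_eq ?_) c3
  rw [L1.norm_eq_integral_norm]
  refine integral_congr_ae ?_
  filter_upwards [hae] with x hx
  rw [hx]

end A2H1

/-- `F ∈ A₂(ℝ₊)` iff `F = (𝓕 h)|_{(0,∞)}` for some `h ∈ H¹(ℝ)` (an integrable
function whose Fourier transform vanishes on `(−∞,0)`), and then `‖F‖_{A₂} = ‖h‖_{L¹}`;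
i.e. `h ↦ (𝓕 h)|_{(0,∞)}` is an isometric isomorphism from `H¹(ℝ)` onto `A₂(ℝ₊)`. -/
theorem A2_eq_H1 (F : ℝ → ℂ) :
    ((∃ f g : ℕ → Lp ℂ 2 muplus, A2Rep F f g) ↔
      ∃ h : ℝ → ℂ, Integrable h ∧ (∀ ξ : ℝ, ξ < 0 → 𝓕 h ξ = 0) ∧
        ∀ u : ℝ, 0 < u → F u = 𝓕 h u) ∧
    ∀ h : ℝ → ℂ, Integrable h → (∀ ξ : ℝ, ξ < 0 → 𝓕 h ξ = 0) →
      (∀ u : ℝ, 0 < u → F u = 𝓕 h u) →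
      sInf (A2NormSet F) = ∫ x, ‖h x‖ := by
  refine ⟨⟨?_, ?_⟩, ?_⟩
  · rintro ⟨f, g, hr⟩
    obtain ⟨c, c1, c2, -⟩ := A2H1.rep_to_h hr
    exact ⟨c, L1.integrable_coeFn c, fun ξ hξ => c1 ξ hξ, fun u hu => (c2 u hu).symm⟩
  · rintro ⟨h, h1, h2, h3⟩
    obtain ⟨f, g, hr, -⟩ := A2H1.h_to_rep ⟨h1, h2⟩ h3 one_pos
    exact ⟨f, g, hr⟩
  · intro h h1 h2 h3
    have lb : ∀ c ∈ A2NormSet F, ∫ x, ‖h x‖ ≤ c := by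
      rintro _ ⟨f, g, hr, rfl⟩
      exact A2H1.norm_le_of_rep ⟨h1, h2⟩ h3 hr
    apply le_antisymm
    · refine le_of_forall_pos_le_add fun ε hε => ?_
      obtain ⟨f, g, hr, hle⟩ := A2H1.h_to_rep ⟨h1, h2⟩ h3 hε
      exact (csInf_le ⟨_, lb⟩ ⟨f, g, hr, rfl⟩).trans hle
    · obtain ⟨f, g, hr, -⟩ := A2H1.h_to_rep ⟨h1, h2⟩ h3 one_pos
      exact le_csInf ⟨_, f, g, hr, rfl⟩ lb
end

section
/- Let ν be a bounded (complex) Borel measure on (0,∞). Then the formula H_ν(f) = ∫_{(0,∞)} θ_u(f) dν(u) (a Bochner integral in L¹(ℝ₊)) defines a bounded operator H_ν ∈ B(L¹(ℝ₊)) with ‖H_ν‖ ≤ ‖ν‖ (total variation norm); H_ν is Hankelian; and for every f ∈ L¹(ℝ₊) and g ∈ L^∞(ℝ₊), ⟨H_ν f, g⟩ = ∫_{(0,∞)} (f ∗ g)(u) dν(u). -/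
open scoped ENNReal
open MeasureTheory

theorem thetaMP (u : ℝ) : MeasurePreserving (fun t : ℝ => u - t) volume volume :=
  Measure.measurePreserving_sub_left volume u

theorem extMemLp (f : Lp ℂ 1 muplus) :
    MemLp ((Set.Ioi (0 : ℝ)).indicator (f : ℝ → ℂ)) 1 volume :=
  (memLp_indicator_iff_restrict measurableSet_Ioi).2 (Lp.memLp f)

/-- Extension by zero. -/
noncomputable def extZ (f : Lp ℂ 1 muplus) : Lp ℂ 1 (volume : Measure ℝ) := (extMemLp f).toLp _

/-- The operator `θ_u`. -/
noncomputable def thetaOp (f : Lp ℂ 1 muplus) (u : ℝ) : Lp ℂ 1 muplus :=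
  LpToLpRestrictCLM ℝ ℂ ℂ volume 1 (Set.Ioi 0) (Lp.compMeasurePreserving _ (thetaMP u) (extZ f))

theorem thetaOp_coeFn (f : Lp ℂ 1 muplus) (u : ℝ) :
    (thetaOp f u : ℝ → ℂ) =ᵐ[muplus] fun t => (Set.Ioi (0 : ℝ)).indicator (f : ℝ → ℂ) (u - t) := by
  refine (LpToLpRestrictCLM_coeFn ℂ (Set.Ioi 0) _).trans ?_
  refine ae_restrict_of_ae ?_
  refine (Lp.coeFn_compMeasurePreserving _ (thetaMP u)).trans ?_
  exact (thetaMP u).quasiMeasurePreserving.ae_eq_comp (extMemLp f).coeFn_toLp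

theorem thetaOp_continuous (f : Lp ℂ 1 muplus) : Continuous (thetaOp f) := by
  refine (LpToLpRestrictCLM ℝ ℂ ℂ volume 1 (Set.Ioi 0)).continuous.comp ?_
  let G : C(ℝ, C(ℝ, ℝ)) :=
    (ContinuousMap.mk (fun a : ℝ × ℝ => a.1 - a.2) (by fun_prop)).curry
  exact (continuous_const (y := extZ f)).compMeasurePreservingLp G.continuous
    (fun u => thetaMP u) (by simp)

theorem ae_muplus {p : ℝ → Prop} : (∀ᵐ t ∂muplus, p t) ↔ ∀ᵐ t : ℝ, 0 < t → p t := by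
  unfold muplus
  exact ae_restrict_iff' measurableSet_Ioi

theorem ae_sub {p : ℝ → Prop} (h : ∀ᵐ t : ℝ, p t) (u : ℝ) : ∀ᵐ t : ℝ, p (u - t) :=
  (thetaMP u).quasiMeasurePreserving.ae h

theorem ae_sub_right {p : ℝ → Prop} (h : ∀ᵐ t : ℝ, p t) (u : ℝ) : ∀ᵐ t : ℝ, p (t - u) :=
  (measurePreserving_sub_right volume u).quasiMeasurePreserving.ae h

theorem thetaOp_add (f g : Lp ℂ 1 muplus) (u : ℝ) :
    thetaOp (f + g) u = thetaOp f u + thetaOp g u := by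
  apply Lp.ext
  filter_upwards [thetaOp_coeFn (f + g) u, thetaOp_coeFn f u, thetaOp_coeFn g u,
    Lp.coeFn_add (thetaOp f u) (thetaOp g u),
    ae_muplus.2 ((ae_sub (ae_muplus.1 (Lp.coeFn_add f g)) u).mono fun t h _ => h)]
    with t h1 h2 h3 h4 h5
  rw [h1, h4, Pi.add_apply, h2, h3]
  by_cases h : 0 < u - t
  · simpa [Set.indicator, h] using h5 h
  · simp [Set.indicator, h]

theorem thetaOp_smul (c : ℂ) (f : Lp ℂ 1 muplus) (u : ℝ) :
    thetaOp (c • f) u = c • thetaOp f u := by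
  apply Lp.ext
  filter_upwards [thetaOp_coeFn (c • f) u, thetaOp_coeFn f u,
    Lp.coeFn_smul c (thetaOp f u),
    ae_muplus.2 ((ae_sub (ae_muplus.1 (Lp.coeFn_smul c f)) u).mono fun t h _ => h)]
    with t h1 h2 h4 h5
  rw [h1, h4, Pi.smul_apply, h2]
  by_cases h : 0 < u - t
  · simpa [Set.indicator, h] using h5 h
  · simp [Set.indicator, h]

theorem thetaOp_norm (f : Lp ℂ 1 muplus) (u : ℝ) : ‖thetaOp f u‖ ≤ ‖f‖ := by
  have h1 : ‖thetaOp f u‖ ≤ ‖Lp.compMeasurePreserving _ (thetaMP u) (extZ f)‖ :=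
    norm_Lp_toLp_restrict_le (Set.Ioi 0) _
  rw [Lp.norm_compMeasurePreserving] at h1
  refine h1.trans (le_of_eq ?_)
  rw [extZ, Lp.norm_toLp, Lp.norm_def, eLpNorm_indicator_eq_eLpNorm_restrict measurableSet_Ioi]
  rfl

theorem thetaOp_integrable (ρ : Measure ℝ) [IsFiniteMeasure ρ]
    (w : ℝ → ℂ) (hw : Measurable w) (hw1 : ∀ u : ℝ, ‖w u‖ = 1) (f : Lp ℂ 1 muplus) :
    Integrable (fun u => w u • thetaOp f u) ρ := by
  refine Integrable.of_bound
    (hw.aestronglyMeasurable.smul (thetaOp_continuous f).aestronglyMeasurable) ‖f‖ ?_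
  refine Filter.Eventually.of_forall fun u => ?_
  rw [norm_smul, hw1, one_mul]
  exact thetaOp_norm f u

/-- The operator `H_ν`. -/
noncomputable def HnuOp (ρ : Measure ℝ) [IsFiniteMeasure ρ]
    (w : ℝ → ℂ) (hw : Measurable w) (hw1 : ∀ u : ℝ, ‖w u‖ = 1) :
    Lp ℂ 1 muplus →L[ℂ] Lp ℂ 1 muplus :=
  LinearMap.mkContinuous
    { toFun := fun f => ∫ u, w u • thetaOp f u ∂ρ
      map_add' := fun f g => by
        simp only [thetaOp_add, smul_add]
        exact integral_add (thetaOp_integrable ρ w hw hw1 f) (thetaOp_integrable ρ w hw hw1 g)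
      map_smul' := fun c f => by
        simp only [thetaOp_smul, RingHom.id_apply]
        rw [← integral_smul]
        simp only [smul_comm c] }
    (ρ Set.univ).toReal (fun f => by
      refine (norm_integral_le_of_norm_le_const (C := ‖f‖)
        (Filter.Eventually.of_forall fun u => ?_)).trans ?_
      · rw [norm_smul, hw1, one_mul]
        exact thetaOp_norm f u
      · rw [mul_comm]; rfl)

theorem pair_theta (f : Lp ℂ 1 muplus) (g : Lp ℂ ∞ muplus) (u : ℝ) :
    ∫ t, (thetaOp f u : ℝ → ℂ) t * (g : ℝ → ℂ) t ∂muplus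
      = ∫ t in Set.Ioo 0 u, (f : ℝ → ℂ) (u - t) * (g : ℝ → ℂ) t := by
  rw [← integral_indicator measurableSet_Ioo]
  have key : ∀ F : ℝ → ℂ, ∫ t, F t ∂muplus = ∫ t, (Set.Ioi (0 : ℝ)).indicator F t := fun F => by
    rw [integral_indicator measurableSet_Ioi]; rfl
  rw [key]
  refine integral_congr_ae ?_
  filter_upwards [ae_muplus.1 (thetaOp_coeFn f u)] with t h
  by_cases h0 : 0 < t
  · rw [Set.indicator_of_mem (by exact h0), h h0]
    by_cases h1 : t < u <;> simp [Set.indicator, h0, h1]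
  · simp [Set.indicator, h0]

theorem Hnu_pair (ρ : Measure ℝ) [IsFiniteMeasure ρ]
    (w : ℝ → ℂ) (hw : Measurable w) (hw1 : ∀ u : ℝ, ‖w u‖ = 1)
    (f : Lp ℂ 1 muplus) (g : Lp ℂ ∞ muplus) :
    ∫ t, (HnuOp ρ w hw hw1 f : ℝ → ℂ) t * (g : ℝ → ℂ) t ∂muplus
      = ∫ u, (∫ t in Set.Ioo 0 u, (f : ℝ → ℂ) (u - t) * (g : ℝ → ℂ) t) * w u ∂ρ := by
  let φ : Lp ℂ 1 muplus →L[ℂ] ℂ :=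
    ((ContinuousLinearMap.mul ℂ ℂ).lpPairing muplus 1 ∞).flip g
  have hφ : ∀ h : Lp ℂ 1 muplus, φ h = ∫ t, (h : ℝ → ℂ) t * (g : ℝ → ℂ) t ∂muplus := fun h =>
    ContinuousLinearMap.lpPairing_eq_integral _ h g
  rw [← hφ]
  change φ (∫ u, w u • thetaOp f u ∂ρ) = _
  rw [← φ.integral_comp_comm (thetaOp_integrable ρ w hw hw1 f)]
  refine integral_congr_ae (Filter.Eventually.of_forall fun u => ?_)
  change φ (w u • thetaOp f u) = _
  rw [map_smul, hφ, pair_theta, smul_eq_mul, mul_comm]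

theorem conv_shift (v : ℝ) (hv : 0 < v) (f fv : Lp ℂ 1 muplus) (g gv : Lp ℂ ∞ muplus)
    (hf : (fv : ℝ → ℂ) =ᵐ[muplus] shiftR v (f : ℝ → ℂ))
    (hg : (gv : ℝ → ℂ) =ᵐ[muplus] shiftR v (g : ℝ → ℂ)) (u : ℝ) :
    (∫ t in Set.Ioo 0 u, (fv : ℝ → ℂ) (u - t) * (g : ℝ → ℂ) t)
      = ∫ t in Set.Ioo 0 u, (f : ℝ → ℂ) (u - t) * (gv : ℝ → ℂ) t := by
  let K : ℝ → ℂ := (Set.Ioo 0 (u - v)).indicator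
    fun t => (f : ℝ → ℂ) (u - v - t) * (g : ℝ → ℂ) t
  rw [← integral_indicator measurableSet_Ioo, ← integral_indicator measurableSet_Ioo]
  trans ∫ t, K t
  · refine integral_congr_ae ?_
    filter_upwards [ae_sub (ae_muplus.1 hf) u] with t h
    by_cases h0 : 0 < t
    · by_cases h1 : t < u
      · rw [Set.indicator_of_mem (show t ∈ Set.Ioo 0 u from ⟨h0, h1⟩), h (by linarith)]
        by_cases h2 : t < u - v
        · have h3 : v < u - t := by linarith
          have h4 : u - t - v = u - v - t := by ring
          simp [K, Set.indicator, shiftR, h0, h2, h3, h4]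
        · have h3 : ¬ v < u - t := by linarith
          simp [K, Set.indicator, shiftR, h2, h3]
      · have h2 : ¬ t < u - v := by linarith
        simp [K, Set.indicator, h1, h2]
    · simp [K, Set.indicator, h0]
  · rw [← integral_sub_right_eq_self K v]
    refine integral_congr_ae ?_
    filter_upwards [ae_muplus.1 hg] with t h
    by_cases h1 : t < u
    · by_cases h0 : 0 < t
      · rw [Set.indicator_of_mem (show t ∈ Set.Ioo 0 u from ⟨h0, h1⟩), h h0]
        by_cases h2 : v < t
        · simp [K, Set.indicator, shiftR, h1, h2]
        · simp [K, Set.indicator, shiftR, h2]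
      · have h2 : ¬ v < t := by linarith
        simp [K, Set.indicator, h0, h2]
    · simp [K, Set.indicator, h1]

/-- a bounded complex Borel measure `ν` on `(0,∞)` — encoded via its total
variation `ρ` (a finite positive measure vanishing on `(−∞,0]`) and a unimodular density
`w` (so `dν = w dρ`, `‖ν‖ = ρ(univ)`) — gives rise to a Hankelian operator
`H_ν f = ∫ θ_u f dν(u)` on `L¹(ℝ₊)` with `‖H_ν‖ ≤ ‖ν‖` and
`⟨H_ν f, g⟩ = ∫ (f ∗ g)(u) dν(u)` for `f ∈ L¹(ℝ₊)`, `g ∈ L^∞(ℝ₊)`. -/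
theorem H_nu_hankelian (ρ : Measure ℝ) [IsFiniteMeasure ρ] (hρ : ρ (Set.Iic 0) = 0)
    (w : ℝ → ℂ) (hw : Measurable w) (hw1 : ∀ u : ℝ, ‖w u‖ = 1) :
    ∃ H : Lp ℂ 1 muplus →L[ℂ] Lp ℂ 1 muplus,
      ‖H‖ ≤ (ρ Set.univ).toReal ∧
      IsHankelianLp 1 ∞ H ∧
      (∀ (f : Lp ℂ 1 muplus) (Θ : ℝ → Lp ℂ 1 muplus),
        (∀ u : ℝ, 0 < u →
          (Θ u : ℝ → ℂ) =ᵐ[muplus] fun t => if t < u then (f : ℝ → ℂ) (u - t) else 0) →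
        (∀ u : ℝ, u ≤ 0 → Θ u = 0) →
        H f = ∫ u, w u • Θ u ∂ρ) ∧
      ∀ (f : Lp ℂ 1 muplus) (g : Lp ℂ ∞ muplus),
        ∫ t, (H f : ℝ → ℂ) t * (g : ℝ → ℂ) t ∂muplus
          = ∫ u, (∫ t in Set.Ioo 0 u, (f : ℝ → ℂ) (u - t) * (g : ℝ → ℂ) t) * w u ∂ρ := by
  refine ⟨HnuOp ρ w hw hw1, LinearMap.mkContinuous_norm_le _ ENNReal.toReal_nonneg _, ?_, ?_,
    Hnu_pair ρ w hw hw1⟩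
  · intro v hv f fv g gv hf hg
    rw [Hnu_pair, Hnu_pair]
    simp only [conv_shift v hv f fv g gv hf hg]
  · intro f Θ h1 h2
    have hΘ : Θ = thetaOp f := by
      funext u
      apply Lp.ext
      rcases lt_or_ge 0 u with hu | hu
      · refine (h1 u hu).trans ((thetaOp_coeFn f u).trans ?_).symm
        refine Filter.Eventually.of_forall fun t => ?_
        simp [Set.indicator]
      · rw [h2 u hu]
        filter_upwards [thetaOp_coeFn f u, Lp.coeFn_zero ℂ 1 muplus,
          ae_muplus.2 (Filter.Eventually.of_forall fun t ht => ht)] with t h3 h4 h5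
        have h6 : ¬ t < u := by linarith
        rw [h3, h4]
        simp [Set.indicator, h6]
    rw [hΘ]
    rfl
end
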